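/- (Well-posedness of the Poisson equation.) Assume V ∈ C^∞(𝕋^d). For every f ∈ C^∞(X) with f ∈ L²(μ_β) and ∫_X f dμ_β = 0, there exists exactly one function u ∈ C^∞(X) with u ∈ L²(μ_β) and ∫_X u dμ_β = 0 such that 𝓛 u = f pointwise on X. -/

import Mathlib

open MeasureTheory Real Filter

noncomputable section

/-- The state space `X = 𝕋^d × ℝ^d × ℝ^{dm}`, realised as
`ℝ^d × ℝ^d × (ℝ^d)^m` with functions that are `ℤ^d`-periodic in the first variable. -/
abbrev Xsp (d m : ℕ) := (Fin d → ℝ) × (Fin d → ℝ) × (Fin m → Fin d → ℝ)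

/-- The direction in the `z_j`-block given by the vector `v`. -/
def zdir (d m : ℕ) (j : Fin m) (v : Fin d → ℝ) : Xsp d m :=
  (0, 0, Function.update 0 j v)

/-- The partial derivative `∂_{z_{j,k}} φ`. -/
def pZ (d m : ℕ) (j : Fin m) (k : Fin d) (φ : Xsp d m → ℝ) (x : Xsp d m) : ℝ :=
  fderiv ℝ φ x (zdir d m j (Pi.single k 1))

/-- The partial derivative `∂_{p_k} φ`. -/
def pP (d m : ℕ) (k : Fin d) (φ : Xsp d m → ℝ) (x : Xsp d m) : ℝ :=
  fderiv ℝ φ x (0, Pi.single k 1, 0)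

/-- The partial derivative `∂_{q_k} φ`. -/
def pQ (d m : ℕ) (k : Fin d) (φ : Xsp d m → ℝ) (x : Xsp d m) : ℝ :=
  fderiv ℝ φ x (Pi.single k 1, 0, 0)

/-- The operator `𝓛` (negative of the generator of the Markovian GLE dynamics):
`𝓛φ = −p·∇_qφ + ∇V·∇_pφ − Σ_j λ_j z_j·∇_pφ + Σ_j λ_j p·∇_{z_j}φ
      + Σ_j α_j z_j·∇_{z_j}φ − β⁻¹ Σ_j α_j Δ_{z_j}φ`. -/
def gen (d m : ℕ) (β : ℝ) (α lam : Fin m → ℝ) (V : (Fin d → ℝ) → ℝ)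
    (φ : Xsp d m → ℝ) (x : Xsp d m) : ℝ :=
  - fderiv ℝ φ x (x.2.1, 0, 0)
  + fderiv ℝ φ x (0, (fun i => fderiv ℝ V x.1 (Pi.single i 1)), 0)
  - fderiv ℝ φ x (0, ∑ j, lam j • x.2.2 j, 0)
  + ∑ j, lam j * fderiv ℝ φ x (zdir d m j x.2.1)
  + ∑ j, α j * fderiv ℝ φ x (zdir d m j (x.2.2 j))
  - β⁻¹ * ∑ j, α j * ∑ k, fderiv ℝ (pZ d m j k φ) x (zdir d m j (Pi.single k 1))

/-- The (unnormalised) Gibbs density `exp(−β(V(q) + |p|²/2 + |z|²/2))`. -/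
def gdens (d m : ℕ) (β : ℝ) (V : (Fin d → ℝ) → ℝ) (x : Xsp d m) : ℝ :=
  Real.exp (-β * (V x.1 + (∑ i, (x.2.1 i) ^ 2) / 2 + (∑ j, ∑ i, (x.2.2 j i) ^ 2) / 2))

/-- The fundamental domain `[0,1)^d` for the torus in the `q`-variable. -/
def cube (d : ℕ) : Set (Fin d → ℝ) := {q | ∀ i, q i ∈ Set.Ico (0 : ℝ) 1}

/-- Lebesgue measure on `X = 𝕋^d × ℝ^d × ℝ^{dm}` (the `q`-variable being
restricted to a fundamental domain of the torus). -/
def volX (d m : ℕ) : Measure (Xsp d m) :=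
  (volume : Measure (Xsp d m)).restrict {x | x.1 ∈ cube d}

/-- The Gibbs measure `μ_β`, with density `Z⁻¹ exp(−β(V(q)+|p|²/2+|z|²/2))`. -/
def gibbs (d m : ℕ) (β Z : ℝ) (V : (Fin d → ℝ) → ℝ) : Measure (Xsp d m) :=
  (volX d m).withDensity fun x => ENNReal.ofReal (Z⁻¹ * gdens d m β V x)

/-- `ℤ^d`-periodicity in the `q`-variable. -/
def PerQ (d m : ℕ) (φ : Xsp d m → ℝ) : Prop :=
  ∀ (k : Fin d → ℤ) (x : Xsp d m), φ (x.1 + (fun i => (k i : ℝ)), x.2) = φ x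

/-- `ℤ^d`-periodicity of the potential. -/
def PerV (d : ℕ) (V : (Fin d → ℝ) → ℝ) : Prop :=
  ∀ (k : Fin d → ℤ) (q : Fin d → ℝ), V (q + fun i => (k i : ℝ)) = V q

/-- A test function: smooth, periodic in `q`, compactly supported in `(p,z)`. -/
def IsTest (d m : ℕ) (φ : Xsp d m → ℝ) : Prop :=
  ContDiff ℝ (⊤ : ℕ∞) φ ∧ PerQ d m φ ∧
    ∃ K : Set ((Fin d → ℝ) × (Fin m → Fin d → ℝ)),
      IsCompact K ∧ ∀ x : Xsp d m, x.2 ∉ K → φ x = 0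

section Kernel

open scoped FourierTransform RealInnerProductSpace ContDiff

/-! ### Smoothing along characteristics -/


/-- A Duhamel bound for a damped scalar equation whose source is controlled by the damping. -/
lemma sq_norm_le_of_damped_ode {w G : ℝ → ℂ} {E E' h : ℝ → ℝ}
    (hw : ∀ s, HasDerivAt w ((E' s : ℂ) * w s + G s) s)
    (hE : ∀ s, HasDerivAt E (E' s) s) (hE0 : E 0 = 0)
    (hE' : ∀ s, 0 ≤ E' s) (cE' : Continuous E') (cG : Continuous G) (ch : Continuous h)
    (hG : ∀ s, ‖G s‖ ^ 2 ≤ (1 + E' s) * h s) :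
    ‖w 0‖ ^ 2 ≤ 2 * exp (-E 1) * ‖w 1‖ ^ 2 + 4 * ∫ s in (0 : ℝ)..1, exp (-E s) * h s := by
  have cE : Continuous E := continuous_iff_continuousAt.2 fun s => (hE s).continuousAt
  have hh : ∀ s, 0 ≤ h s := fun s => by
    have h1 := (sq_nonneg ‖G s‖).trans (hG s)
    exact nonneg_of_mul_nonneg_right h1 (by linarith [hE' s])
  have Emono : Monotone E := monotone_of_hasDerivAt_nonneg hE hE'
  have Epos : ∀ s, 0 ≤ s → 0 ≤ E s := fun s hs => hE0 ▸ Emono hs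
  have key : ∀ s, HasDerivAt (fun s => ((exp (-E s) : ℝ) : ℂ) * w s)
      (((exp (-E s) : ℝ) : ℂ) * G s) s := by
    intro s
    have h1 : HasDerivAt (fun s => ((exp (-E s) : ℝ) : ℂ)) ((exp (-E s) * (-E' s) : ℝ) : ℂ) s :=
      ((hE s).neg.exp).ofReal_comp
    refine (h1.mul (hw s)).congr_deriv ?_
    push_cast
    ring
  have ftc : ∫ s in (0 : ℝ)..1, ((exp (-E s) : ℝ) : ℂ) * G s
      = ((exp (-E 1) : ℝ) : ℂ) * w 1 - w 0 := by
    rw [intervalIntegral.integral_eq_sub_of_hasDerivAt (fun s _ => key s)]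
    · simp [hE0]
    · exact (by fun_prop : Continuous fun s => ((exp (-E s) : ℝ) : ℂ) * G s).intervalIntegrable _ _
  have ftcE : ∫ s in (0 : ℝ)..1, exp (-E s) * E' s = 1 - exp (-E 1) := by
    have : ∀ s, HasDerivAt (fun s => - exp (-E s)) (exp (-E s) * E' s) s := fun s => by
      refine ((hE s).neg.exp).neg.congr_deriv ?_
      rw [Pi.neg_apply]
      ring
    rw [intervalIntegral.integral_eq_sub_of_hasDerivAt (fun s _ => this s)]
    · simp [hE0]; ring
    · exact (by fun_prop : Continuous fun s => exp (-E s) * E' s).intervalIntegrable _ _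
  set J := ∫ s in (0 : ℝ)..1, exp (-E s) * h s with hJ
  set I := ∫ s in (0 : ℝ)..1, exp (-E s) * ‖G s‖ with hI
  have hI0 : 0 ≤ I := intervalIntegral.integral_nonneg (by norm_num) fun s _ => by positivity
  have hJ0 : 0 ≤ J := intervalIntegral.integral_nonneg (by norm_num)
    fun s _ => mul_nonneg (exp_pos _).le (hh s)
  have hone : ∫ s in (0 : ℝ)..1, exp (-E s) ≤ 1 := by
    have : ∫ s in (0 : ℝ)..1, exp (-E s) ≤ ∫ s in (0 : ℝ)..1, (1 : ℝ) :=
      intervalIntegral.integral_mono_on (by norm_num)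
        ((by fun_prop : Continuous fun s => exp (-E s)).intervalIntegrable _ _) (by simp)
        fun s hs => by simpa using Epos s hs.1
    simpa using this
  have amgm : ∀ l > 0, I ≤ l + J / (2 * l) := by
    intro l hl
    have h1 : I ≤ ∫ s in (0 : ℝ)..1, ((l / 2) * exp (-E s) + (l / 2) * (exp (-E s) * E' s)
        + (1 / (2 * l)) * (exp (-E s) * h s)) := by
      apply intervalIntegral.integral_mono_on (by norm_num)
      · exact (by fun_prop : Continuous fun s => exp (-E s) * ‖G s‖).intervalIntegrable _ _
      · exact (by fun_prop : Continuous _).intervalIntegrable _ _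
      · intro s _
        have h2 : ‖G s‖ ≤ l / 2 * (1 + E' s) + 1 / (2 * l) * h s := by
          apply abs_le_of_sq_le_sq' _ _ |>.2
          · refine (hG s).trans ?_
            have : (l / 2 * (1 + E' s) + 1 / (2 * l) * h s) ^ 2 - (1 + E' s) * h s
              = (l / 2 * (1 + E' s) - 1 / (2 * l) * h s) ^ 2 := by
              field_simp; ring
            nlinarith [sq_nonneg (l / 2 * (1 + E' s) - 1 / (2 * l) * h s)]
          · have := hE' s
            have := hh s
            positivity
        calc exp (-E s) * ‖G s‖ ≤ exp (-E s) * (l / 2 * (1 + E' s) + 1 / (2 * l) * h s) := by gcongr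
          _ = _ := by ring
    rw [intervalIntegral.integral_add, intervalIntegral.integral_add,
      intervalIntegral.integral_const_mul, intervalIntegral.integral_const_mul,
      intervalIntegral.integral_const_mul, ftcE, ← hJ] at h1
    · have : (1 / (2 * l)) * J = J / (2 * l) := by ring
      nlinarith [exp_pos (-E 1)]
    all_goals exact (by fun_prop : Continuous _).intervalIntegrable _ _
  have hIJ : I ^ 2 ≤ 2 * J := by
    rcases hI0.eq_or_lt with h0 | h0
    · rw [← h0]; simpa using hJ0
    · have h1 := amgm (I / 2) (by positivity)
      have h2 : J / (2 * (I / 2)) = J / I := by congr 1; ring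
      rw [h2] at h1
      have h3 : I / 2 ≤ J / I := by linarith
      rw [le_div_iff₀ h0] at h3
      nlinarith
  have hIn : ‖∫ s in (0 : ℝ)..1, ((exp (-E s) : ℝ) : ℂ) * G s‖ ≤ I := by
    refine (intervalIntegral.norm_integral_le_integral_norm (by norm_num)).trans (le_of_eq ?_)
    refine intervalIntegral.integral_congr fun s _ => ?_
    simp only [norm_mul, Complex.norm_real, norm_of_nonneg (exp_pos _).le]
  have h0 : ‖w 0‖ ≤ exp (-E 1) * ‖w 1‖ + I := by
    have : w 0 = ((exp (-E 1) : ℝ) : ℂ) * w 1 - ∫ s in (0 : ℝ)..1, ((exp (-E s) : ℝ) : ℂ) * G s := by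
      rw [ftc]; ring
    rw [this]
    refine (norm_sub_le _ _).trans (add_le_add (le_of_eq ?_) hIn)
    simp only [norm_mul, Complex.norm_real, norm_of_nonneg (exp_pos _).le]
  have he : exp (-E 1) ≤ 1 := by simpa using Epos 1 (by norm_num)
  calc ‖w 0‖ ^ 2 ≤ (exp (-E 1) * ‖w 1‖ + I) ^ 2 := by gcongr
    _ ≤ 2 * (exp (-E 1) * ‖w 1‖) ^ 2 + 2 * I ^ 2 := by
        nlinarith [sq_nonneg (exp (-E 1) * ‖w 1‖ - I)]
    _ ≤ 2 * exp (-E 1) * ‖w 1‖ ^ 2 + 4 * J := by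
        have : exp (-E 1) ^ 2 ≤ exp (-E 1) := by nlinarith [exp_pos (-E 1)]
        have h5 := mul_le_mul_of_nonneg_right this (sq_nonneg ‖w 1‖)
        nlinarith

/-- The data of a Kolmogorov-type operator `⟨B y, ∇⟩ + ∑ ∂_{e i}²` with nilpotent drift
satisfying the rank condition; `A` is the adjoint of `B`. -/
structure KolData (F ι : Type*) [NormedAddCommGroup F] [InnerProductSpace ℝ F] [Fintype ι] where
  A : F →L[ℝ] F
  B : F →L[ℝ] F
  e : ι → F
  c : ℝ
  c_pos : 0 < c
  adj : ∀ θ y, ⟪θ, B y⟫ = ⟪A θ, y⟫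
  nil : ∀ θ, A (A (A θ)) = 0
  coer : ∀ θ, c * ‖θ‖ ^ 2 ≤ ∑ i, (⟪θ, e i⟫ ^ 2 + ⟪A θ, e i⟫ ^ 2 + ⟪A (A θ), e i⟫ ^ 2)

namespace KolData

variable {F ι : Type*} [NormedAddCommGroup F] [InnerProductSpace ℝ F] [Fintype ι]
  (K : KolData F ι)

/-- The characteristic flow `exp (s A)`. -/
def flow (s : ℝ) : F →L[ℝ] F :=
  ContinuousLinearMap.id ℝ F + s • K.A + (s ^ 2 / 2) • (K.A.comp K.A)

lemma flow_apply (s : ℝ) (θ : F) : K.flow s θ = θ + s • K.A θ + (s ^ 2 / 2) • K.A (K.A θ) := by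
  simp [flow]

lemma flow_neg_flow (s : ℝ) (θ : F) : K.flow (-s) (K.flow s θ) = θ := by
  simp only [flow_apply, map_add, map_smul, K.nil, smul_zero, map_zero, add_zero, smul_add, smul_smul]
  module

lemma hasDerivAt_flow (s : ℝ) (θ : F) :
    HasDerivAt (fun s => K.flow s θ) (K.A (K.flow s θ)) s := by
  simp only [flow_apply, map_add, map_smul, K.nil, smul_zero, add_zero]
  have h1 : HasDerivAt (fun s : ℝ => s • K.A θ) ((1 : ℝ) • K.A θ) s :=
    (hasDerivAt_id s).smul_const _
  have h2 : HasDerivAt (fun s : ℝ => (s ^ 2 / 2) • K.A (K.A θ)) (s • K.A (K.A θ)) s := by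
    have : HasDerivAt (fun s : ℝ => s ^ 2 / 2) s s := by
      refine ((hasDerivAt_pow 2 s).div_const 2).congr_deriv ?_
      simp
    exact this.smul_const _
  refine (((hasDerivAt_const s θ).add h1).add h2).congr_deriv ?_
  simp

lemma exists_flow_bound : ∃ C ≥ 1, ∀ s, |s| ≤ 1 → ∀ θ, ‖K.flow s θ‖ ≤ C * ‖θ‖ := by
  refine ⟨1 + ‖K.A‖ + ‖K.A‖ * ‖K.A‖, by nlinarith [norm_nonneg K.A], fun s hs θ => ?_⟩
  rw [flow_apply]
  have hA := K.A.le_opNorm θ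
  have hA2 : ‖K.A (K.A θ)‖ ≤ ‖K.A‖ * ‖K.A‖ * ‖θ‖ :=
    (K.A.le_opNorm _).trans (by rw [mul_assoc]; gcongr)
  have hs2 : |s ^ 2 / 2| ≤ 1 := by
    rw [abs_of_nonneg (by positivity)]
    have : s ^ 2 ≤ 1 := by rw [← sq_abs]; exact pow_le_one₀ (abs_nonneg _) hs
    linarith
  calc ‖θ + s • K.A θ + (s ^ 2 / 2) • K.A (K.A θ)‖
      ≤ ‖θ‖ + |s| * ‖K.A θ‖ + |s ^ 2 / 2| * ‖K.A (K.A θ)‖ := by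
        refine (norm_add₃_le).trans ?_
        simp only [norm_smul, Real.norm_eq_abs]
        rfl
    _ ≤ ‖θ‖ + 1 * (‖K.A‖ * ‖θ‖) + 1 * (‖K.A‖ * ‖K.A‖ * ‖θ‖) := by gcongr
    _ = _ := by ring

/-- The damping rate in Fourier space. -/
def rate (θ : F) : ℝ := 4 * π ^ 2 * ∑ i, ⟪θ, K.e i⟫ ^ 2

lemma rate_nonneg (θ : F) : 0 ≤ K.rate θ := by
  unfold rate; positivity

lemma continuous_rate : Continuous K.rate := by
  unfold rate; fun_prop

/-- The damping accumulated along the characteristic flow. -/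
def damp (θ : F) (s : ℝ) : ℝ :=
  4 * π ^ 2 * ∑ i, (⟪θ, K.e i⟫ ^ 2 * s + ⟪θ, K.e i⟫ * ⟪K.A θ, K.e i⟫ * s ^ 2
    + (⟪K.A θ, K.e i⟫ ^ 2 + ⟪θ, K.e i⟫ * ⟪K.A (K.A θ), K.e i⟫) * s ^ 3 / 3
    + ⟪K.A θ, K.e i⟫ * ⟪K.A (K.A θ), K.e i⟫ * s ^ 4 / 4
    + ⟪K.A (K.A θ), K.e i⟫ ^ 2 * s ^ 5 / 20)

lemma hasDerivAt_damp (θ : F) (s : ℝ) :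
    HasDerivAt (K.damp θ) (K.rate (K.flow s θ)) s := by
  unfold damp rate
  refine HasDerivAt.const_mul _ (HasDerivAt.fun_sum fun i _ => ?_)
  set a := ⟪θ, K.e i⟫
  set b := ⟪K.A θ, K.e i⟫
  set c := ⟪K.A (K.A θ), K.e i⟫
  have : ⟪K.flow s θ, K.e i⟫ = a + s * b + s ^ 2 / 2 * c := by
    simp [flow_apply, inner_add_left, inner_smul_left, a, b, c]
  rw [this]
  have h1 := (hasDerivAt_id s).const_mul (a ^ 2)
  have h2 := (hasDerivAt_pow 2 s).const_mul (a * b)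
  have h3 := ((hasDerivAt_pow 3 s).const_mul (b ^ 2 + a * c)).div_const 3
  have h4 := ((hasDerivAt_pow 4 s).const_mul (b * c)).div_const 4
  have h5 := ((hasDerivAt_pow 5 s).const_mul (c ^ 2)).div_const 20
  refine ((((h1.add h2).add h3).add h4).add h5).congr_deriv ?_
  push_cast
  ring

lemma damp_zero (θ : F) : K.damp θ 0 = 0 := by
  simp [damp]

lemma damp_lower (θ : F) {s : ℝ} (hs : 0 ≤ s) (hs1 : s ≤ 1) :
    K.c / 2000 * s ^ 5 * ‖θ‖ ^ 2 ≤ K.damp θ s := by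
  have key : ∀ a b c : ℝ, s ^ 5 / 2000 * (a ^ 2 + b ^ 2 + c ^ 2) ≤
      a ^ 2 * s + a * b * s ^ 2 + (b ^ 2 + a * c) * s ^ 3 / 3 + b * c * s ^ 4 / 4
        + c ^ 2 * s ^ 5 / 20 := by
    intro a b c
    have h0 : ∀ x y z : ℝ, (x ^ 2 + y ^ 2 + z ^ 2) / 2000 ≤
        x ^ 2 + x * y + (y ^ 2 + x * z) / 3 + y * z / 4 + z ^ 2 / 20 := by
      intro x y z
      nlinarith [sq_nonneg (x + y / 2 + z / 6), sq_nonneg (y + z / 2), sq_nonneg z,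
        sq_nonneg ((x + y / 2 + z / 6) + (y + z / 2) / 2),
        sq_nonneg ((x + y / 2 + z / 6) - z / 12), sq_nonneg ((y + z / 2) / 2 + z / 12),
        sq_nonneg ((y + z / 2) + z / 2)]
    have h1 := mul_le_mul_of_nonneg_left (h0 a (b * s) (c * s ^ 2)) hs
    have h4 : s ^ 4 ≤ 1 := pow_le_one₀ hs hs1
    have h2 : s ^ 2 ≤ 1 := pow_le_one₀ hs hs1
    have e1 : s ^ 5 * a ^ 2 ≤ s * a ^ 2 := by
      have : s ^ 5 = s * s ^ 4 := by ring
      rw [this]; gcongr; nlinarith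
    have e2 : s ^ 5 * b ^ 2 ≤ s * (b * s) ^ 2 := by
      have : s ^ 5 * b ^ 2 = s * (b * s) ^ 2 * s ^ 2 := by ring
      rw [this]; exact mul_le_of_le_one_right (by positivity) h2
    nlinarith
  have hpi : 1 ≤ 4 * π ^ 2 := by nlinarith [pi_gt_three]
  unfold damp
  have h1 : s ^ 5 / 2000 * (K.c * ‖θ‖ ^ 2) ≤
      ∑ i, (⟪θ, K.e i⟫ ^ 2 * s + ⟪θ, K.e i⟫ * ⟪K.A θ, K.e i⟫ * s ^ 2
    + (⟪K.A θ, K.e i⟫ ^ 2 + ⟪θ, K.e i⟫ * ⟪K.A (K.A θ), K.e i⟫) * s ^ 3 / 3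
    + ⟪K.A θ, K.e i⟫ * ⟪K.A (K.A θ), K.e i⟫ * s ^ 4 / 4
    + ⟪K.A (K.A θ), K.e i⟫ ^ 2 * s ^ 5 / 20) := by
    refine (mul_le_mul_of_nonneg_left (K.coer θ) (by positivity)).trans ?_
    rw [Finset.mul_sum]
    exact Finset.sum_le_sum fun i _ => key _ _ _
  have h2 : 0 ≤ s ^ 5 / 2000 * (K.c * ‖θ‖ ^ 2) := by have := K.c_pos; positivity
  nlinarith

/-- A solution of the transported equation in Fourier space is controlled by averages of
itself and of its sources along characteristics. -/
lemma sq_norm_le_along_flow {v g₀ : F → ℂ} {g : ι → F → ℂ} (hv : Differentiable ℝ v)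
    (cg₀ : Continuous g₀) (cg : ∀ i, Continuous (g i))
    (eqn : ∀ θ, fderiv ℝ v θ (K.A θ) = (K.rate θ : ℂ) * v θ
      + (g₀ θ + ∑ i, ((2 * π * ⟪θ, K.e i⟫ : ℝ) : ℂ) * g i θ))
    {h : F → ℝ} (ch : Continuous h) (hvh : ∀ θ, ‖v θ‖ ^ 2 ≤ h θ)
    (hgh : ∀ θ, ‖g₀ θ‖ ^ 2 + ∑ i, ‖g i θ‖ ^ 2 ≤ h θ) (θ : F) :
    ‖v θ‖ ^ 2 ≤ 2 * exp (-(K.c / 2000 * ‖θ‖ ^ 2)) * h (K.flow 1 θ)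
      + 4 * ∫ s in (0 : ℝ)..1, exp (-(K.c / 2000 * s ^ 5 * ‖θ‖ ^ 2)) * h (K.flow s θ) := by
  have cflow : Continuous fun s => K.flow s θ :=
    continuous_iff_continuousAt.2 fun s => (K.hasDerivAt_flow s θ).continuousAt
  have hh : ∀ θ, 0 ≤ h θ := fun θ => (sq_nonneg _).trans (hvh θ)
  have main := sq_norm_le_of_damped_ode (w := fun s => v (K.flow s θ))
    (G := fun s => g₀ (K.flow s θ)
      + ∑ i, ((2 * π * ⟪K.flow s θ, K.e i⟫ : ℝ) : ℂ) * g i (K.flow s θ))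
    (E := K.damp θ) (E' := fun s => K.rate (K.flow s θ)) (h := fun s => h (K.flow s θ))
    (fun s => by
      rw [← eqn]
      exact (hv _).hasFDerivAt.comp_hasDerivAt s (K.hasDerivAt_flow s θ))
    (fun s => K.hasDerivAt_damp θ s) (K.damp_zero θ) (fun s => K.rate_nonneg _)
    (K.continuous_rate.comp cflow) ?_ (ch.comp cflow) ?_
  · have f0 : K.flow 0 θ = θ := by simp [flow_apply]
    have cdamp : Continuous (K.damp θ) :=
      continuous_iff_continuousAt.2 fun s => (K.hasDerivAt_damp θ s).continuousAt
    have chf := ch.comp cflow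
    simp only [f0] at main
    refine main.trans (add_le_add ?_ (mul_le_mul_of_nonneg_left ?_ (by norm_num)))
    · have := K.damp_lower θ zero_le_one le_rfl
      gcongr
      · linarith
      · exact hvh _
    · refine intervalIntegral.integral_mono_on (by norm_num) ?_ ?_ fun s hs => ?_
      · exact (Continuous.mul (by fun_prop) chf).intervalIntegrable _ _
      · exact (Continuous.mul (by fun_prop) chf).intervalIntegrable _ _
      · have := K.damp_lower θ hs.1 hs.2
        gcongr
        exact hh _
  · refine (cg₀.comp cflow).add (continuous_finsetSum _ fun i _ => ?_)
    exact (by fun_prop : Continuous fun s => ((2 * π * ⟪K.flow s θ, K.e i⟫ : ℝ) : ℂ)).mul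
      ((cg i).comp cflow)
  · intro s
    set y := K.flow s θ
    have h1 : ‖g₀ y + ∑ i, ((2 * π * ⟪y, K.e i⟫ : ℝ) : ℂ) * g i y‖
        ≤ ‖g₀ y‖ + ∑ i, |2 * π * ⟪y, K.e i⟫| * ‖g i y‖ := by
      refine (norm_add_le _ _).trans (add_le_add le_rfl ((norm_sum_le _ _).trans (le_of_eq ?_)))
      refine Finset.sum_congr rfl fun i _ => ?_
      rw [norm_mul, Complex.norm_real, Real.norm_eq_abs]
    have h2 : (∑ i, |2 * π * ⟪y, K.e i⟫| * ‖g i y‖) ^ 2 ≤ K.rate y * ∑ i, ‖g i y‖ ^ 2 := by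
      refine (Finset.sum_mul_sq_le_sq_mul_sq _ _ _).trans (le_of_eq ?_)
      congr 1
      simp only [rate, sq_abs, Finset.mul_sum, mul_pow]
      refine Finset.sum_congr rfl fun i _ => ?_
      ring
    set S := ∑ i, |2 * π * ⟪y, K.e i⟫| * ‖g i y‖
    set T := ∑ i, ‖g i y‖ ^ 2
    have hS : 0 ≤ S := Finset.sum_nonneg fun i _ => by positivity
    have hT : 0 ≤ T := Finset.sum_nonneg fun i _ => by positivity
    have hr := K.rate_nonneg y
    have h3 : (‖g₀ y‖ + S) ^ 2 ≤ (1 + K.rate y) * (‖g₀ y‖ ^ 2 + T) := by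
      have : 2 * (‖g₀ y‖ * S) ≤ K.rate y * ‖g₀ y‖ ^ 2 + T := by
        have h4 : (‖g₀ y‖ * S) ^ 2 ≤ (K.rate y * ‖g₀ y‖ ^ 2) * T := by
          rw [mul_pow]
          calc ‖g₀ y‖ ^ 2 * S ^ 2 ≤ ‖g₀ y‖ ^ 2 * (K.rate y * T) := by gcongr
            _ = _ := by ring
        have h5 : 0 ≤ K.rate y * ‖g₀ y‖ ^ 2 := by positivity
        refine abs_le_of_sq_le_sq' (a := 2 * (‖g₀ y‖ * S)) ?_ (by positivity) |>.2
        nlinarith [sq_nonneg (K.rate y * ‖g₀ y‖ ^ 2 - T)]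
      nlinarith
    calc _ ≤ (‖g₀ y‖ + S) ^ 2 := by gcongr
      _ ≤ (1 + K.rate y) * (‖g₀ y‖ ^ 2 + T) := h3
      _ ≤ _ := by
        have := hgh y
        gcongr

end KolData

end Kernel

section Pairing

open scoped FourierTransform RealInnerProductSpace ContDiff

/-! ### Weak solutions and their localised Fourier transforms -/

/-- Smooth and compactly supported. -/
def IsCc {F E : Type*} [NormedAddCommGroup F] [NormedSpace ℝ F] [NormedAddCommGroup E]
    [NormedSpace ℝ E] (φ : F → E) : Prop :=
  ContDiff ℝ (⊤ : ℕ∞) φ ∧ HasCompactSupport φ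

namespace IsCc

variable {F E E' : Type*} [NormedAddCommGroup F] [NormedSpace ℝ F] [NormedAddCommGroup E]
    [NormedSpace ℝ E] [NormedAddCommGroup E'] [NormedSpace ℝ E']

lemma add {φ ψ : F → E} (h : IsCc φ) (h' : IsCc ψ) : IsCc (fun y => φ y + ψ y) :=
  ⟨h.1.add h'.1, h.2.add h'.2⟩

lemma sum {κ : Type*} (s : Finset κ) {φ : κ → F → E} (h : ∀ i, IsCc (φ i)) :
    IsCc (fun y => ∑ i ∈ s, φ i y) := by
  classical
  induction s using Finset.induction_on with
  | empty => exact ⟨by simpa using contDiff_const, HasCompactSupport.zero⟩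
  | insert a s ha ih => simpa [Finset.sum_insert ha] using (h a).add ih

lemma smul_left {φ : F → E} (h : IsCc φ) {b : F → ℝ} (hb : ContDiff ℝ (⊤ : ℕ∞) b) :
    IsCc (fun y => b y • φ y) :=
  ⟨hb.smul h.1, h.2.smul_left⟩

lemma mul_left {φ : F → ℝ} (h : IsCc φ) {b : F → ℝ} (hb : ContDiff ℝ (⊤ : ℕ∞) b) :
    IsCc (fun y => b y * φ y) := h.smul_left hb

lemma clm {φ : F → E} (h : IsCc φ) (L : E →L[ℝ] E') : IsCc (fun y => L (φ y)) :=
  ⟨L.contDiff.comp h.1, h.2.comp_left L.map_zero⟩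

lemma fderiv_apply {φ : F → E} (h : IsCc φ) {w : F → F} (hw : ContDiff ℝ (⊤ : ℕ∞) w) :
    IsCc (fun y => fderiv ℝ φ y (w y)) := by
  refine ⟨(h.1.fderiv_right le_rfl).clm_apply hw, ?_⟩
  refine (h.2.fderiv ℝ).mono' fun y hy => subset_closure ?_
  contrapose! hy
  simp only [Function.mem_support, not_not] at hy ⊢
  simp [hy]

lemma continuous {φ : F → E} (h : IsCc φ) : Continuous φ := h.1.continuous

end IsCc

namespace KolData

variable {F ι : Type*} [NormedAddCommGroup F] [InnerProductSpace ℝ F] [Fintype ι]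
  {E E' : Type*} [NormedAddCommGroup E] [NormedSpace ℝ E] [NormedAddCommGroup E'] [NormedSpace ℝ E']
  (K : KolData F ι) (b : ι → F → ℝ)

/-- The operator `⟨B y, ∇φ⟩ + ∑ ∂_{e i}² φ + ∑ b i ∂_{e i} φ`. -/
def aop (φ : F → E) (y : F) : E :=
  fderiv ℝ φ y (K.B y) + ∑ i, fderiv ℝ (fun x => fderiv ℝ φ x (K.e i)) y (K.e i)
    + ∑ i, b i y • fderiv ℝ φ y (K.e i)

variable {b}

lemma isCc_aop (hb : ∀ i, ContDiff ℝ (⊤ : ℕ∞) (b i)) {φ : F → E} (h : IsCc φ) :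
    IsCc (K.aop b φ) :=
  ((h.fderiv_apply K.B.contDiff).add (IsCc.sum _ fun i =>
    (h.fderiv_apply contDiff_const).fderiv_apply contDiff_const)).add
    (IsCc.sum _ fun i => (h.fderiv_apply contDiff_const).smul_left (hb i))

lemma aop_clm {φ : F → E} (h : ContDiff ℝ (⊤ : ℕ∞) φ) (L : E →L[ℝ] E') (y : F) :
    K.aop b (fun y => L (φ y)) y = L (K.aop b φ y) := by
  have hd : Differentiable ℝ φ := h.differentiable (by simp)
  have h1 : ∀ y w, fderiv ℝ (fun y => L (φ y)) y w = L (fderiv ℝ φ y w) := fun y w => by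
    rw [show (fun y => L (φ y)) = L ∘ φ from rfl, fderiv_comp y L.differentiableAt (hd y)]
    simp
  have hd2 : ∀ w, Differentiable ℝ fun y => fderiv ℝ φ y w := fun w =>
    ((h.fderiv_right (m := (⊤ : ℕ∞)) le_rfl).clm_apply contDiff_const).differentiable (by simp)
  have h2 : ∀ y w, fderiv ℝ (fun x => L (fderiv ℝ φ x w)) y w
      = L (fderiv ℝ (fun x => fderiv ℝ φ x w) y w) := fun y w => by
    rw [show (fun y => L (fderiv ℝ φ y w)) = L ∘ (fun y => fderiv ℝ φ y w) from rfl,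
      fderiv_comp y L.differentiableAt (hd2 w y)]
    simp
  simp [aop, h1, h2, map_add, map_sum]

/-- The complex exponential `exp (-2πi⟨y, θ⟩)`. -/
def wave (θ y : F) : ℂ := Complex.exp (↑(-2 * π * ⟪y, θ⟫) * Complex.I)

lemma contDiff_wave (θ : F) : ContDiff ℝ (⊤ : ℕ∞) (wave θ) := by
  unfold wave
  refine ContDiff.cexp (ContDiff.mul ?_ contDiff_const)
  exact Complex.ofRealCLM.contDiff.comp (contDiff_const.mul (contDiff_id.inner ℝ contDiff_const))

lemma hasFDerivAt_wave (θ y : F) : HasFDerivAt (wave θ)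
    ((((innerSL ℝ θ).smulRight ((-2 * π * Complex.I) * wave θ y)))) y := by
  have h1 : HasFDerivAt (fun y : F => ⟪y, θ⟫) (innerSL ℝ θ) y := by
    have := (innerSL ℝ θ).hasFDerivAt (x := y)
    refine this.congr_of_eventuallyEq (Eventually.of_forall fun x => ?_)
    simp [real_inner_comm]
  have h2 := Complex.ofRealCLM.hasFDerivAt.comp y (h1.const_mul (-2 * π))
  have h3 := (h2.mul_const Complex.I).cexp
  refine h3.congr_fderiv ?_
  ext w
  simp [wave]
  ring

lemma fderiv_ofReal_mul_wave {ψ : F → ℝ} (h : Differentiable ℝ ψ) (θ y w : F) :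
    fderiv ℝ (fun y => (ψ y : ℂ) * wave θ y) y w
      = (fderiv ℝ ψ y w : ℂ) * wave θ y + (-2 * π * Complex.I * ⟪w, θ⟫) * (ψ y * wave θ y) := by
  have h1 : HasFDerivAt (fun y => (ψ y : ℂ)) (Complex.ofRealCLM.comp (fderiv ℝ ψ y)) y :=
    Complex.ofRealCLM.hasFDerivAt.comp y (h y).hasFDerivAt
  have h2 := h1.mul (hasFDerivAt_wave θ y)
  have h3 : fderiv ℝ (fun y => (ψ y : ℂ) * wave θ y) y = _ := h2.fderiv
  rw [h3]
  simp [real_inner_comm]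
  ring

lemma aop_mul_wave {ψ : F → ℝ} (h : ContDiff ℝ (⊤ : ℕ∞) ψ) (θ y : F) :
    K.aop b (fun y => (ψ y : ℂ) * wave θ y) y =
      wave θ y * (((K.aop b ψ y : ℝ) : ℂ) + (-2 * π * Complex.I * ⟪K.B y, θ⟫) * ψ y - K.rate θ * ψ y
        + ∑ i, (-2 * π * Complex.I * ⟪K.e i, θ⟫) *
          ((2 * fderiv ℝ ψ y (K.e i) + b i y * ψ y : ℝ) : ℂ)) := by
  have hd : Differentiable ℝ ψ := h.differentiable (by simp)
  have hd2 : ∀ w, Differentiable ℝ fun y => fderiv ℝ ψ y w := fun w =>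
    ((h.fderiv_right (m := (⊤ : ℕ∞)) le_rfl).clm_apply contDiff_const).differentiable (by simp)
  have key : ∀ w, fderiv ℝ (fun x => fderiv ℝ (fun y => (ψ y : ℂ) * wave θ y) x w) y w
      = (fderiv ℝ (fun x => fderiv ℝ ψ x w) y w : ℂ) * wave θ y
        + 2 * (-2 * π * Complex.I * ⟪w, θ⟫) * (fderiv ℝ ψ y w * wave θ y)
        + (-2 * π * Complex.I * ⟪w, θ⟫) ^ 2 * (ψ y * wave θ y) := by
    intro w
    have : (fun x => fderiv ℝ (fun y => (ψ y : ℂ) * wave θ y) x w)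
      = fun x => ((fderiv ℝ ψ x w : ℝ) : ℂ) * wave θ x
        + (-2 * π * Complex.I * ⟪w, θ⟫) * (ψ x * wave θ x) := by
      ext x; rw [fderiv_ofReal_mul_wave hd]
    have d1 : ∀ {χ : F → ℝ}, Differentiable ℝ χ →
        Differentiable ℝ fun x => (χ x : ℂ) * wave θ x := fun hχ =>
      (Complex.ofRealCLM.differentiable.comp hχ).mul ((contDiff_wave θ).differentiable (by simp))
    rw [this, fderiv_fun_add (d1 (hd2 w) y) ((d1 hd y).const_mul _)]
    rw [fderiv_const_mul (d1 hd y)]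
    simp only [add_apply, smul_apply,
      fderiv_ofReal_mul_wave hd, fderiv_ofReal_mul_wave (hd2 w), smul_eq_mul]
    ring
  simp only [aop, rate]
  simp only [key]
  simp only [fderiv_ofReal_mul_wave hd, smul_eq_mul]
  push_cast
  have hs : ∑ i, ((fderiv ℝ (fun x => fderiv ℝ ψ x (K.e i)) y (K.e i) : ℂ) * wave θ y
        + 2 * (-2 * π * Complex.I * ⟪K.e i, θ⟫) * (fderiv ℝ ψ y (K.e i) * wave θ y)
        + (-2 * π * Complex.I * ⟪K.e i, θ⟫) ^ 2 * (ψ y * wave θ y))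
      + ∑ i, (b i y) • ((fderiv ℝ ψ y (K.e i) : ℂ) * wave θ y
        + (-2 * π * Complex.I * ⟪K.e i, θ⟫) * (ψ y * wave θ y))
      = wave θ y * (∑ i, (fderiv ℝ (fun x => fderiv ℝ ψ x (K.e i)) y (K.e i) : ℂ)
        + ∑ i, (b i y : ℂ) * (fderiv ℝ ψ y (K.e i) : ℂ)
        - (4 * π ^ 2 * ∑ i, (⟪θ, K.e i⟫ : ℂ) ^ 2) * ψ y
        + ∑ i, (-2 * π * Complex.I * ⟪K.e i, θ⟫) *
          (2 * (fderiv ℝ ψ y (K.e i) : ℂ) + b i y * ψ y)) := by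
    rw [Finset.mul_sum, Finset.sum_mul, ← Finset.sum_add_distrib, ← Finset.sum_add_distrib,
      ← Finset.sum_sub_distrib, ← Finset.sum_add_distrib, Finset.mul_sum]
    refine Finset.sum_congr rfl fun i _ => ?_
    rw [real_inner_comm θ, Complex.real_smul]
    linear_combination (4 * π ^ 2 * ⟪θ, K.e i⟫ ^ 2 * (ψ y * wave θ y) : ℂ) * Complex.I_sq
  linear_combination hs

variable [FiniteDimensional ℝ F] [MeasurableSpace F] [BorelSpace F]

/-- `U` solves `(aop)ᵗ U = g` in the sense of distributions. -/
structure WeakSol (b : ι → F → ℝ) (U g : F → ℝ) : Prop where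
  smooth : ∀ i, ContDiff ℝ (⊤ : ℕ∞) (b i)
  loc : LocallyIntegrable U
  loc' : LocallyIntegrable g
  eqn : ∀ φ : F → ℝ, IsCc φ → ∫ y, U y * K.aop b φ y = ∫ y, g y * φ y

variable {K}

lemma _root_.MeasureTheory.LocallyIntegrable.mul_isCc {U : F → ℝ} (h : LocallyIntegrable U)
    {φ : F → ℝ} (hφ : IsCc φ) : Integrable fun y => U y * φ y :=
  h.integrable_smul_right_of_hasCompactSupport hφ.continuous hφ.2

lemma _root_.MeasureTheory.LocallyIntegrable.mul_isCc_complex {U : F → ℝ} (h : LocallyIntegrable U)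
    {φ : F → ℂ} (hφ : IsCc φ) : Integrable fun y => (U y : ℂ) * φ y := by
  simpa using h.integrable_smul_right_of_hasCompactSupport hφ.continuous hφ.2

lemma WeakSol.eqn_complex {U g : F → ℝ} (h : K.WeakSol b U g) {φ : F → ℂ} (hφ : IsCc φ) :
    ∫ y, (U y : ℂ) * K.aop b φ y = ∫ y, (g y : ℂ) * φ y := by
  have i1 := h.loc.mul_isCc_complex (K.isCc_aop h.smooth hφ)
  have i2 := h.loc'.mul_isCc_complex hφ
  apply Complex.ext
  · have := h.eqn _ (hφ.clm Complex.reCLM)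
    simp only [K.aop_clm hφ.1] at this
    rw [← Complex.reCLM_apply, ← Complex.reCLM_apply, ← Complex.reCLM.integral_comp_comm i1,
      ← Complex.reCLM.integral_comp_comm i2]
    simpa using this
  · have := h.eqn _ (hφ.clm Complex.imCLM)
    simp only [K.aop_clm hφ.1] at this
    rw [← Complex.imCLM_apply, ← Complex.imCLM_apply, ← Complex.imCLM.integral_comp_comm i1,
      ← Complex.imCLM.integral_comp_comm i2]
    simpa using this

/-- Fourier transform of a real function. -/
def ft (U : F → ℝ) : F → ℂ := 𝓕 fun y => (U y : ℂ)

lemma ft_eq (U : F → ℝ) (θ : F) : ft U θ = ∫ y, (U y : ℂ) * wave θ y := by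
  rw [ft, Real.fourier_eq']
  simp [wave, mul_comm]

lemma isCc_ofReal_mul_wave {φ : F → ℝ} (h : IsCc φ) (θ : F) :
    IsCc fun y => (φ y : ℂ) * wave θ y :=
  ⟨(Complex.ofRealCLM.contDiff.comp h.1).mul (contDiff_wave θ),
    (h.2.comp_left (g := ((↑) : ℝ → ℂ)) (by simp)).mul_right⟩

lemma integrable_mul_wave {U : F → ℝ} (hU : LocallyIntegrable U) {φ : F → ℝ} (h : IsCc φ) (θ : F) :
    Integrable fun y => ((U y * φ y : ℝ) : ℂ) * wave θ y := by
  refine (hU.mul_isCc_complex (isCc_ofReal_mul_wave h θ)).congr (Eventually.of_forall fun y => ?_)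
  push_cast
  ring

lemma integrable_norm_mul {U : F → ℝ} (hU : LocallyIntegrable U) {φ : F → ℝ} (h : IsCc φ) :
    Integrable fun y => ‖y‖ * ‖((U y * φ y : ℝ) : ℂ)‖ := by
  have : Integrable fun y => U y * (‖y‖ * φ y) :=
    hU.integrable_smul_right_of_hasCompactSupport (continuous_norm.mul h.continuous) h.2.mul_left
  refine this.norm.congr (Eventually.of_forall fun y => ?_)
  simp
  ring

lemma differentiable_ft {U : F → ℝ} (hU : LocallyIntegrable U) {φ : F → ℝ} (h : IsCc φ) :
    Differentiable ℝ (ft fun y => U y * φ y) :=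
  Real.differentiable_fourier (hU.mul_isCc h).ofReal (integrable_norm_mul hU h)

lemma continuous_ft {U : F → ℝ} (hU : LocallyIntegrable U) {φ : F → ℝ} (h : IsCc φ) :
    Continuous (ft fun y => U y * φ y) := (differentiable_ft hU h).continuous

lemma fderiv_ft {U : F → ℝ} (hU : LocallyIntegrable U) {φ : F → ℝ} (h : IsCc φ) (θ w : F) :
    fderiv ℝ (ft fun y => U y * φ y) θ w
      = ∫ y, (-2 * π * Complex.I * ⟪w, y⟫) * (((U y * φ y : ℝ) : ℂ) * wave θ y) := by
  have i1 : Integrable fun y => ((U y * φ y : ℝ) : ℂ) := (hU.mul_isCc h).ofReal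
  have i2 := integrable_norm_mul hU h
  unfold ft
  have i3 : Integrable (VectorFourier.fourierSMulRight (innerSL ℝ)
      fun y => ((U y * φ y : ℝ) : ℂ)) :=
    (i2.const_mul (2 * π * ‖innerSL ℝ (E := F)‖)).mono' i1.1.fourierSMulRight
      (Eventually.of_forall fun y => (VectorFourier.norm_fourierSMulRight_le _ _ _).trans
        (le_of_eq (mul_assoc _ _ _)))
  rw [Real.fderiv_fourier i1 i2, Real.fourier_continuousLinearMap_apply i3, Real.fourier_eq']
  refine integral_congr_ae (Eventually.of_forall fun y => ?_)
  have : (innerSL ℝ) y w = ⟪w, y⟫ := by rw [innerSL_apply_apply, real_inner_comm]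
  simp [wave, VectorFourier.fourierSMulRight_apply, this]
  ring

lemma WeakSol.ft_eqn {U g : F → ℝ} (h : K.WeakSol b U g) {ψ : F → ℝ} (hψ : IsCc ψ) (θ : F) :
    fderiv ℝ (ft fun y => U y * ψ y) θ (K.A θ) = (K.rate θ : ℂ) * ft (fun y => U y * ψ y) θ
      + ((ft (fun y => g y * ψ y) θ - ft (fun y => U y * K.aop b ψ y) θ)
      + ∑ i, ((2 * π * ⟪θ, K.e i⟫ : ℝ) : ℂ) *
        (Complex.I * ft (fun y => U y * (2 * fderiv ℝ ψ y (K.e i) + b i y * ψ y)) θ)) := by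
  have hi : ∀ i, IsCc fun y => 2 * fderiv ℝ ψ y (K.e i) + b i y * ψ y := fun i =>
    ((hψ.fderiv_apply contDiff_const).mul_left contDiff_const).add (hψ.mul_left (h.smooth i))
  have hB : IsCc fun y => ⟪K.A θ, y⟫ * ψ y := hψ.mul_left (contDiff_const.inner ℝ contDiff_id)
  have key := h.eqn_complex (isCc_ofReal_mul_wave hψ θ)
  rw [fderiv_ft h.loc hψ]
  simp only [ft_eq]
  simp only [← mul_assoc, K.aop_mul_wave hψ.1] at key ⊢
  have e1 : ∀ y, (U y : ℂ) * wave θ y * ((K.aop b ψ y : ℝ) + (-2 * π * Complex.I * ⟪K.B y, θ⟫) * ψ y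
      - K.rate θ * ψ y + ∑ i, (-2 * π * Complex.I * ⟪K.e i, θ⟫) *
          ((2 * fderiv ℝ ψ y (K.e i) + b i y * ψ y : ℝ) : ℂ))
      = ((U y * K.aop b ψ y : ℝ) : ℂ) * wave θ y
        + (-2 * π * Complex.I) * (((U y * (⟪K.A θ, y⟫ * ψ y) : ℝ) : ℂ) * wave θ y)
        - K.rate θ * (((U y * ψ y : ℝ) : ℂ) * wave θ y)
        + ∑ i, (-2 * π * Complex.I * ⟪K.e i, θ⟫) *
          (((U y * (2 * fderiv ℝ ψ y (K.e i) + b i y * ψ y) : ℝ) : ℂ) * wave θ y) := by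
    intro y
    rw [real_inner_comm θ, K.adj, mul_add, Finset.mul_sum]
    congr 1
    · push_cast; ring
    · refine Finset.sum_congr rfl fun i _ => ?_
      push_cast; ring
  have j1 := integrable_mul_wave h.loc (K.isCc_aop h.smooth hψ) θ
  have j2 := (integrable_mul_wave h.loc hB θ).const_mul (-2 * π * Complex.I)
  have j3 := (integrable_mul_wave h.loc hψ θ).const_mul (K.rate θ : ℂ)
  have j4 := fun i => (integrable_mul_wave h.loc (hi i) θ).const_mul
    (-2 * π * Complex.I * ⟪K.e i, θ⟫)
  simp only [e1] at key
  have j12 : Integrable fun y => ((U y * K.aop b ψ y : ℝ) : ℂ) * wave θ y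
      + (-2 * π * Complex.I) * (((U y * (⟪K.A θ, y⟫ * ψ y) : ℝ) : ℂ) * wave θ y) := j1.add j2
  rw [integral_add (by exact j12.sub j3) (integrable_finsetSum _ fun i _ => j4 i),
    integral_sub j12 j3, integral_add j1 j2, integral_finsetSum _ fun i _ => j4 i] at key
  simp only [integral_const_mul] at key
  have e2 : ∫ y, (-2 * π * Complex.I * ⟪K.A θ, y⟫) * ((U y * ψ y : ℝ) : ℂ) * wave θ y
      = (-2 * π * Complex.I) * ∫ y, ((U y * (⟪K.A θ, y⟫ * ψ y) : ℝ) : ℂ) * wave θ y := by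
    rw [← integral_const_mul]
    congr 1; ext y; push_cast; ring
  have e3 : ∫ y, (g y : ℂ) * ψ y * wave θ y = ∫ y, ((g y * ψ y : ℝ) : ℂ) * wave θ y := by
    congr 1; ext y; push_cast; ring
  have e4 : ∑ i, (-2 * π * Complex.I * ⟪K.e i, θ⟫) *
      ∫ y, ((U y * (2 * fderiv ℝ ψ y (K.e i) + b i y * ψ y) : ℝ) : ℂ) * wave θ y
      = - ∑ i, ((2 * π * ⟪θ, K.e i⟫ : ℝ) : ℂ) * Complex.I *
        ∫ y, ((U y * (2 * fderiv ℝ ψ y (K.e i) + b i y * ψ y) : ℝ) : ℂ) * wave θ y := by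
    rw [← Finset.sum_neg_distrib]
    refine Finset.sum_congr rfl fun i _ => ?_
    rw [real_inner_comm θ]
    push_cast
    ring
  rw [e3, e4] at key
  rw [e2]
  linear_combination key

end KolData

end Pairing

section Smoothing

open scoped FourierTransform RealInnerProductSpace ContDiff SchwartzMap

/-! ### Hypoellipticity -/

lemma exists_integral_exp_bound {κ : ℝ} (hκ : 0 < κ) : ∃ C > 0, ∀ r, 0 ≤ r →
    ∫ s in (0 : ℝ)..1, exp (-(κ * s ^ 5 * r ^ 2)) ≤ C / (1 + r) ^ (1 / 5 : ℝ) := by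
  refine ⟨2 + 4 / κ, by positivity, fun r hr => ?_⟩
  set t := (1 + r) ^ (1 / 5 : ℝ) with ht
  have t1 : 1 ≤ t := one_le_rpow (by linarith) (by norm_num)
  have t0 : 0 < t := by linarith
  have t5 : t ^ 5 = 1 + r := by
    rw [ht, ← rpow_natCast, ← rpow_mul (by linarith)]; norm_num
  have tle : t ≤ 1 + r := by rw [← t5]; exact le_self_pow₀ t1 (by norm_num)
  have ci : ∀ a b, IntervalIntegrable (fun s : ℝ => exp (-(κ * s ^ 5 * r ^ 2))) volume a b :=
    fun a b => (by fun_prop : Continuous fun s : ℝ => exp (-(κ * s ^ 5 * r ^ 2))).intervalIntegrable _ _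
  have hle1 : ∀ s : ℝ, 0 ≤ s → exp (-(κ * s ^ 5 * r ^ 2)) ≤ 1 := fun s hs => by
    rw [exp_le_one_iff]; have : 0 ≤ κ * s ^ 5 * r ^ 2 := by positivity
    linarith
  have td : 1 / t ≤ 1 := by rw [div_le_one t0]; exact t1
  have td0 : 0 ≤ 1 / t := by positivity
  have p1 : ∫ s in (0 : ℝ)..(1 / t), exp (-(κ * s ^ 5 * r ^ 2)) ≤ 1 / t := by
    have := intervalIntegral.integral_mono_on td0 (ci 0 (1 / t))
      (intervalIntegrable_const (c := (1 : ℝ))) fun s hs => hle1 s hs.1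
    simpa using this
  rcases le_or_gt r 1 with h | h
  · have : ∫ s in (0 : ℝ)..1, exp (-(κ * s ^ 5 * r ^ 2)) ≤ 1 := by
      have := intervalIntegral.integral_mono_on zero_le_one (ci 0 1)
        (intervalIntegrable_const (c := (1 : ℝ))) fun s hs => hle1 s hs.1
      simpa using this
    refine this.trans ?_
    rw [le_div_iff₀ t0]
    have : 0 < 4 / κ := by positivity
    linarith
  · have p2 : ∫ s in (1 / t)..1, exp (-(κ * s ^ 5 * r ^ 2)) ≤ 4 / κ / t := by
      have hb : ∀ s ∈ Set.Icc (1 / t) 1, exp (-(κ * s ^ 5 * r ^ 2)) ≤ 4 / κ / t := by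
        intro s hs
        have hs5 : (1 / t) ^ 5 ≤ s ^ 5 := pow_le_pow_left₀ td0 hs.1 5
        have h1 : κ * t / 4 ≤ κ * s ^ 5 * r ^ 2 := by
          calc κ * t / 4 ≤ κ * (1 / t) ^ 5 * r ^ 2 := by
                rw [div_pow, one_pow, t5]
                rw [mul_one_div, div_mul_eq_mul_div, le_div_iff₀ (by linarith)]
                have : t * (1 + r) ≤ 4 * r ^ 2 := by nlinarith
                nlinarith
            _ ≤ κ * s ^ 5 * r ^ 2 := by gcongr
        have h2 : exp (-(κ * s ^ 5 * r ^ 2)) ≤ exp (-(κ * t / 4)) := by gcongr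
        refine h2.trans ?_
        rw [exp_neg, show 4 / κ / t = (κ * t / 4)⁻¹ by field_simp]
        exact inv_anti₀ (by positivity) (by linarith [add_one_le_exp (κ * t / 4)])
      have := intervalIntegral.integral_mono_on td (ci (1 / t) 1)
        (intervalIntegrable_const (c := 4 / κ / t)) hb
      refine this.trans ?_
      rw [intervalIntegral.integral_const, smul_eq_mul]
      refine mul_le_of_le_one_left (by positivity) (by linarith)
    rw [← intervalIntegral.integral_add_adjacent_intervals (ci 0 (1 / t)) (ci (1 / t) 1)]
    have : (2 + 4 / κ) / t = 2 * (1 / t) + 4 / κ / t := by ring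
    linarith

/-- The weight measuring decay in Fourier space. -/
def wt {F : Type*} [NormedAddCommGroup F] (θ : F) : ℝ := (1 + ‖θ‖) ^ (1 / 5 : ℝ)

lemma one_le_wt {F : Type*} [NormedAddCommGroup F] (θ : F) : 1 ≤ wt θ :=
  one_le_rpow (by linarith [norm_nonneg θ]) (by norm_num)

lemma wt_pow_five {F : Type*} [NormedAddCommGroup F] (θ : F) : wt θ ^ 5 = 1 + ‖θ‖ := by
  have := norm_nonneg θ
  rw [wt, ← rpow_natCast, ← rpow_mul (by linarith)]; norm_num

lemma continuous_wt {F : Type*} [NormedAddCommGroup F] : Continuous (wt : F → ℝ) :=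
  Continuous.rpow_const (by fun_prop) fun θ => Or.inr (by norm_num)

namespace KolData

variable {F ι : Type*} [NormedAddCommGroup F] [InnerProductSpace ℝ F] [Fintype ι]
  (K : KolData F ι) {b : ι → F → ℝ}

lemma exists_wt_flow : ∃ C ≥ 1, ∀ s, |s| ≤ 1 → ∀ θ : F, wt θ ≤ C * wt (K.flow s θ) := by
  obtain ⟨C, hC, h⟩ := K.exists_flow_bound
  refine ⟨C ^ (1 / 5 : ℝ), one_le_rpow hC (by norm_num), fun s hs θ => ?_⟩
  have h1 := h (-s) (by rwa [abs_neg]) (K.flow s θ)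
  rw [K.flow_neg_flow] at h1
  have h2 := norm_nonneg (K.flow s θ)
  have h3 := norm_nonneg θ
  unfold wt
  rw [← mul_rpow (by linarith) (by linarith)]
  exact rpow_le_rpow (by linarith) (by nlinarith) (by norm_num)

/-- One step of the gain of decay. -/
lemma decay_step {k : ℕ} {v g₀ : F → ℂ} {g : ι → F → ℂ} (hv : Differentiable ℝ v)
    (cg₀ : Continuous g₀) (cg : ∀ i, Continuous (g i))
    (eqn : ∀ θ, fderiv ℝ v θ (K.A θ) = (K.rate θ : ℂ) * v θ
      + (g₀ θ + ∑ i, ((2 * π * ⟪θ, K.e i⟫ : ℝ) : ℂ) * g i θ))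
    (dv : ∃ C, ∀ θ, wt θ ^ k * ‖v θ‖ ^ 2 ≤ C) (dg₀ : ∃ C, ∀ θ, wt θ ^ k * ‖g₀ θ‖ ^ 2 ≤ C)
    (dg : ∀ i, ∃ C, ∀ θ, wt θ ^ k * ‖g i θ‖ ^ 2 ≤ C) :
    ∃ C, ∀ θ, wt θ ^ (k + 1) * ‖v θ‖ ^ 2 ≤ C := by
  obtain ⟨Cv, hCv⟩ := dv
  obtain ⟨C0, hC0⟩ := dg₀
  choose Ci hCi using dg
  have w1 : ∀ θ : F, 0 < wt θ := fun θ => by linarith [one_le_wt θ]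
  have Cv0 : 0 ≤ Cv := by have := w1 0; exact le_trans (by positivity) (hCv 0)
  have C00 : 0 ≤ C0 := by have := w1 0; exact le_trans (by positivity) (hC0 0)
  have Ci0 : ∀ i, 0 ≤ Ci i := fun i => by have := w1 0; exact le_trans (by positivity) (hCi i 0)
  have Cs0 : 0 ≤ ∑ i, Ci i := Finset.sum_nonneg fun i _ => Ci0 i
  set M := Cv + (C0 + ∑ i, Ci i) with hM
  have hM0 : 0 ≤ M := by positivity
  obtain ⟨D, hD1, hD⟩ := K.exists_wt_flow
  obtain ⟨J, hJ0, hJ⟩ := exists_integral_exp_bound (κ := K.c / 2000) (by have := K.c_pos; positivity)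
  have ch : Continuous fun θ : F => M / wt θ ^ k :=
    continuous_const.div (continuous_wt.pow k) fun θ => (pow_pos (w1 θ) k).ne'
  have main := K.sq_norm_le_along_flow hv cg₀ cg eqn (h := fun θ => M / wt θ ^ k) ch
    (fun θ => by
      rw [le_div_iff₀ (pow_pos (w1 θ) k), mul_comm]
      exact (hCv θ).trans (by linarith))
    (fun θ => by
      rw [le_div_iff₀ (pow_pos (w1 θ) k), mul_comm, mul_add, Finset.mul_sum]
      have := Finset.sum_le_sum fun i (_ : i ∈ Finset.univ) => hCi i θ
      linarith [hC0 θ])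
  refine ⟨6 * (M * D ^ k) * J, fun θ => ?_⟩
  have hcp := K.c_pos
  have hfl : ∀ s, |s| ≤ 1 → M / wt (K.flow s θ) ^ k ≤ M * D ^ k / wt θ ^ k := by
    intro s hs
    rw [div_le_div_iff₀ (pow_pos (w1 _) k) (pow_pos (w1 _) k), mul_assoc, ← mul_pow]
    exact mul_le_mul_of_nonneg_left (pow_le_pow_left₀ (w1 _).le (hD s hs θ) k) hM0
  set P := M * D ^ k / wt θ ^ k with hP
  have hP0 : 0 ≤ P := by have := w1 θ; positivity
  set I := ∫ s in (0 : ℝ)..1, exp (-(K.c / 2000 * s ^ 5 * ‖θ‖ ^ 2)) with hI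
  have cI : Continuous fun s : ℝ => exp (-(K.c / 2000 * s ^ 5 * ‖θ‖ ^ 2)) := by fun_prop
  have cfl : Continuous fun s => K.flow s θ :=
    continuous_iff_continuousAt.2 fun s => (K.hasDerivAt_flow s θ).continuousAt
  have b1 : exp (-(K.c / 2000 * ‖θ‖ ^ 2)) ≤ I := by
    have := intervalIntegral.integral_mono_on zero_le_one
      (intervalIntegrable_const (μ := volume) (c := exp (-(K.c / 2000 * ‖θ‖ ^ 2)))) (cI.intervalIntegrable 0 1)
      fun s hs => by
        have : s ^ 5 ≤ 1 := pow_le_one₀ hs.1 hs.2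
        gcongr
        exact mul_le_of_le_one_right (by positivity) this
    simpa using this
  have b2 : ∫ s in (0 : ℝ)..1, exp (-(K.c / 2000 * s ^ 5 * ‖θ‖ ^ 2)) * (M / wt (K.flow s θ) ^ k)
      ≤ I * P := by
    rw [hI, ← intervalIntegral.integral_mul_const]
    refine intervalIntegral.integral_mono_on zero_le_one ?_ ?_ fun s hs => ?_
    · exact (cI.mul (ch.comp cfl)).intervalIntegrable _ _
    · exact (cI.mul continuous_const).intervalIntegrable _ _
    · have := hfl s (by rw [abs_of_nonneg hs.1]; exact hs.2)
      gcongr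
  have b3 := hfl 1 (by simp)
  have hIJ : I ≤ J / wt θ := hJ ‖θ‖ (norm_nonneg _)
  have hv2 : ‖v θ‖ ^ 2 ≤ 6 * (P * (J / wt θ)) := by
    have e0 := (exp_pos (-(K.c / 2000 * ‖θ‖ ^ 2))).le
    calc ‖v θ‖ ^ 2 ≤ 2 * exp (-(K.c / 2000 * ‖θ‖ ^ 2)) * P + 4 * (I * P) := by
          refine (main θ).trans ?_
          gcongr
      _ ≤ 2 * I * P + 4 * (I * P) := by gcongr
      _ = 6 * (P * I) := by ring
      _ ≤ _ := by gcongr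
  calc wt θ ^ (k + 1) * ‖v θ‖ ^ 2 ≤ wt θ ^ (k + 1) * (6 * (P * (J / wt θ))) := by
        have := w1 θ; gcongr
    _ = 6 * (M * D ^ k) * J := by
        have := w1 θ
        rw [hP]; field_simp; ring

end KolData

end Smoothing

section Regularity

open scoped FourierTransform RealInnerProductSpace ContDiff SchwartzMap

section Fourier

variable {F : Type*} [NormedAddCommGroup F] [InnerProductSpace ℝ F]
  [FiniteDimensional ℝ F] [MeasurableSpace F] [BorelSpace F]

open KolData

lemma integral_fourier_mul_eq_flip {f g : F → ℂ} (hf : Integrable f) (hg : Integrable g) :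
    ∫ ξ, 𝓕 f ξ * g ξ = ∫ x, f x * 𝓕 g x := by
  have := VectorFourier.integral_fourierIntegral_smul_eq_flip (L := innerₗ F) (μ := volume)
    (ν := volume) Real.continuous_fourierChar (by exact continuous_inner) hf hg
  rw [flip_innerₗ] at this
  exact this

/-- The Schwartz function attached to a smooth compactly supported real function. -/
def IsCc.toSchwartz {χ : F → ℝ} (h : IsCc χ) : 𝓢(F, ℂ) :=
  (show HasCompactSupport fun y => (χ y : ℂ) from
    h.2.comp_left (g := ((↑) : ℝ → ℂ)) (by simp)).toSchwartzMap (Complex.ofRealCLM.contDiff.comp h.1)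

lemma IsCc.toSchwartz_apply {χ : F → ℝ} (h : IsCc χ) (y : F) : h.toSchwartz y = (χ y : ℂ) := rfl

lemma IsCc.ft_eq {χ : F → ℝ} (h : IsCc χ) (θ : F) : ft χ θ = 𝓕 h.toSchwartz θ := rfl

lemma IsCc.ft_decay {χ : F → ℝ} (h : IsCc χ) (k : ℕ) : ∃ C, ∀ θ, wt θ ^ k * ‖ft χ θ‖ ^ 2 ≤ C := by
  refine ⟨(2 ^ k * (Finset.Iic (k, 0)).sup (fun m => SchwartzMap.seminorm ℝ m.1 m.2)
    (𝓕 h.toSchwartz)) ^ 2, fun θ => ?_⟩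
  have h1 := SchwartzMap.one_add_le_sup_seminorm_apply (𝕜 := ℝ) (m := (k, 0)) (k := k) (n := 0)
    le_rfl le_rfl (𝓕 h.toSchwartz) θ
  rw [norm_iteratedFDeriv_zero, ← h.ft_eq] at h1
  have hw := one_le_wt θ
  have h2 : wt θ ^ k ≤ ((1 + ‖θ‖) ^ k) ^ 2 := by
    rw [← wt_pow_five, ← pow_mul, ← pow_mul]
    exact pow_le_pow_right₀ hw (by omega)
  calc wt θ ^ k * ‖ft χ θ‖ ^ 2 ≤ ((1 + ‖θ‖) ^ k) ^ 2 * ‖ft χ θ‖ ^ 2 := by gcongr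
    _ = ((1 + ‖θ‖) ^ k * ‖ft χ θ‖) ^ 2 := by ring
    _ ≤ _ := by gcongr

lemma exists_smooth_of_ft_decay {f : F → ℝ} (hf : Integrable f) (cf : Continuous (ft f))
    (hdec : ∀ k : ℕ, ∃ C, ∀ θ, (1 + ‖θ‖) ^ k * ‖ft f θ‖ ≤ C) :
    ∃ g : F → ℝ, ContDiff ℝ (⊤ : ℕ∞) g ∧ f =ᵐ[volume] g := by
  set vn : F → ℂ := fun x => ft f (-x) with hvn
  have cvn : Continuous vn := cf.comp continuous_neg
  have h_int : ∀ n : ℕ, Integrable fun x => ‖x‖ ^ n * ‖vn x‖ := by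
    intro n
    set N := Module.finrank ℝ F
    obtain ⟨C, hC⟩ := hdec (n + (N + 1))
    have hr : (Module.finrank ℝ F : ℝ) < ((N + 1 : ℕ) : ℝ) := by push_cast; linarith
    refine ((integrable_one_add_norm (μ := volume) hr).const_mul C).mono'
      (by fun_prop) (Eventually.of_forall fun x => ?_)
    have h0 := norm_nonneg x
    rw [rpow_neg (by linarith), rpow_natCast, norm_of_nonneg (by positivity),
      ← div_eq_mul_inv, le_div_iff₀ (by positivity)]
    refine le_trans ?_ (hC (-x))
    rw [norm_neg, pow_add (1 + ‖x‖) n (N + 1), mul_right_comm]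
    have h1 : ‖x‖ ^ n ≤ (1 + ‖x‖) ^ n := pow_le_pow_left₀ h0 (by linarith) n
    exact mul_le_mul_of_nonneg_right (mul_le_mul_of_nonneg_right h1 (by positivity))
      (norm_nonneg _)
  have ivn : Integrable vn := by
    have := h_int 0
    simp only [pow_zero, one_mul] at this
    exact (integrable_norm_iff cvn.aestronglyMeasurable).1 this
  have sW : ContDiff ℝ (⊤ : ℕ∞) (𝓕 vn) := Real.contDiff_fourier fun n _ => h_int n
  refine ⟨fun x => (𝓕 vn x).re, Complex.reCLM.contDiff.comp sW, ?_⟩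
  refine ae_eq_of_integral_contDiff_smul_eq hf.locallyIntegrable
    (Complex.reCLM.contDiff.comp sW).continuous.locallyIntegrable fun χ hχ hχ' => ?_
  have hc : IsCc χ := ⟨hχ, hχ'⟩
  have e1 : ∫ x, ((f x : ℝ) : ℂ) * χ x = ∫ ξ, ft f ξ * (𝓕⁻ hc.toSchwartz : 𝓢(F, ℂ)) ξ := by
    have := integral_fourier_mul_eq_flip (f := fun x => (f x : ℂ)) (g := ⇑(𝓕⁻ hc.toSchwartz : 𝓢(F, ℂ)))
      hf.ofReal (𝓕⁻ hc.toSchwartz : 𝓢(F, ℂ)).integrable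
    rw [← SchwartzMap.fourier_coe, FourierTransform.fourier_fourierInv_eq] at this
    exact this.symm
  have e2 : ∫ ξ, ft f ξ * (𝓕⁻ hc.toSchwartz : 𝓢(F, ℂ)) ξ = ∫ x, (χ x : ℂ) * 𝓕 vn x := by
    have h2 : ∫ ξ, ft f ξ * (𝓕⁻ hc.toSchwartz : 𝓢(F, ℂ)) ξ = ∫ ξ, 𝓕 (⇑hc.toSchwartz) ξ * vn ξ := by
      rw [← integral_neg_eq_self]
      congr 1; ext ξ
      rw [SchwartzMap.fourierInv_coe, Real.fourierInv_eq_fourier_neg, neg_neg, mul_comm]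
    rw [h2, integral_fourier_mul_eq_flip hc.toSchwartz.integrable ivn]
    rfl
  have i1 : Integrable fun x => (χ x : ℂ) * 𝓕 vn x :=
    Continuous.integrable_of_hasCompactSupport
      ((Complex.continuous_ofReal.comp hχ.continuous).mul sW.continuous)
      ((hχ'.comp_left (g := ((↑) : ℝ → ℂ)) (by simp)).mul_right)
  have e3 := e1.trans e2
  have e4 : ∫ x, ((f x : ℝ) : ℂ) * χ x = ((∫ x, χ x * f x : ℝ) : ℂ) := by
    rw [← integral_complex_ofReal]
    congr 1; ext x; push_cast; ring
  rw [e4] at e3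
  have e5 := congrArg Complex.reCLM e3
  rw [← Complex.reCLM.integral_comp_comm i1] at e5
  simpa using e5

/-- A function that is locally almost everywhere smooth is almost everywhere smooth. -/
lemma exists_smooth_of_local {U : F → ℝ}
    (h : ∀ ψ : F → ℝ, IsCc ψ → ∃ g : F → ℝ, ContDiff ℝ (⊤ : ℕ∞) g ∧
      (fun y => U y * ψ y) =ᵐ[volume] g) :
    ∃ g : F → ℝ, ContDiff ℝ (⊤ : ℕ∞) g ∧ U =ᵐ[volume] g := by
  have hb : ∀ n : ℕ, ∃ ψ : F → ℝ, IsCc ψ ∧ ∀ y ∈ Metric.ball (0 : F) (n + 1), ψ y = 1 := by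
    intro n
    let B : ContDiffBump (0 : F) := ⟨n + 1, n + 2, by positivity, by linarith⟩
    exact ⟨B, ⟨B.contDiff, B.hasCompactSupport⟩,
      fun y hy => B.one_of_mem_closedBall (Metric.ball_subset_closedBall hy)⟩
  choose ψ hψ hψ1 using hb
  choose g hg hUg using fun n => h (ψ n) (hψ n)
  have hU : ∀ n : ℕ, ∀ᵐ y, y ∈ Metric.ball (0 : F) (n + 1) → U y = g n y := fun n => by
    filter_upwards [hUg n] with y hy hb
    rw [← hy, hψ1 n y hb, mul_one]
  have hgg : ∀ n k : ℕ, n ≤ k → Set.EqOn (g n) (g k) (Metric.ball (0 : F) (n + 1)) := by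
    intro n k hnk
    refine Measure.eqOn_open_of_ae_eq (μ := volume) ?_ Metric.isOpen_ball
      (hg n).continuous.continuousOn (hg k).continuous.continuousOn
    rw [EventuallyEq, ae_restrict_iff' Metric.isOpen_ball.measurableSet]
    filter_upwards [hU n, hU k] with y h1 h2 hy
    have : (n : ℝ) ≤ k := by exact_mod_cast hnk
    rw [← h1 hy, ← h2 (Metric.ball_subset_ball (by linarith) hy)]
  have key : ∀ n : ℕ, ∀ y ∈ Metric.ball (0 : F) (n + 1), g ⌈‖y‖⌉₊ y = g n y := by
    intro n y hy
    rw [mem_ball_zero_iff] at hy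
    rcases le_total ⌈‖y‖⌉₊ n with hn | hn
    · exact hgg _ _ hn (by rw [mem_ball_zero_iff]; linarith [Nat.le_ceil ‖y‖])
    · exact (hgg _ _ hn (by rwa [mem_ball_zero_iff])).symm
  refine ⟨fun y => g ⌈‖y‖⌉₊ y, contDiff_iff_contDiffAt.2 fun y => ?_, ?_⟩
  · have hy : y ∈ Metric.ball (0 : F) ((⌈‖y‖⌉₊ : ℝ) + 1) := by
      rw [mem_ball_zero_iff]; linarith [Nat.le_ceil ‖y‖]
    refine ((hg ⌈‖y‖⌉₊).contDiffAt).congr_of_eventuallyEq ?_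
    filter_upwards [Metric.isOpen_ball.mem_nhds hy] with x hx using key _ x hx
  · filter_upwards [ae_all_iff.2 hU] with y hy
    exact hy _ (by rw [mem_ball_zero_iff]; linarith [Nat.le_ceil ‖y‖])

namespace KolData

variable {ι : Type*} [Fintype ι] {K : KolData F ι} {b : ι → F → ℝ} {U g : F → ℝ}

lemma WeakSol.isCc_source (h : K.WeakSol b U g) {ψ : F → ℝ} (hψ : IsCc ψ) (i : ι) :
    IsCc fun y => 2 * fderiv ℝ ψ y (K.e i) + b i y * ψ y :=
  ((hψ.fderiv_apply contDiff_const).mul_left contDiff_const).add (hψ.mul_left (h.smooth i))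

lemma norm_ft_le (f : F → ℝ) (θ : F) : ‖ft f θ‖ ≤ ∫ y, ‖f y‖ := by
  rw [KolData.ft_eq]
  refine (norm_integral_le_integral_norm _).trans (le_of_eq ?_)
  congr 1; ext y
  simp only [norm_mul, wave, Complex.norm_exp_ofReal_mul_I, mul_one, Complex.norm_real]

lemma WeakSol.decay (h : K.WeakSol b U g) (hg : ContDiff ℝ (⊤ : ℕ∞) g) (k : ℕ) :
    ∀ ψ : F → ℝ, IsCc ψ → ∃ C, ∀ θ, wt θ ^ k * ‖ft (fun y => U y * ψ y) θ‖ ^ 2 ≤ C := by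
  induction k with
  | zero =>
    refine fun ψ hψ => ⟨(∫ y, ‖U y * ψ y‖) ^ 2, fun θ => ?_⟩
    rw [pow_zero, one_mul]
    exact pow_le_pow_left₀ (norm_nonneg _) (norm_ft_le _ θ) 2
  | succ k ih =>
    intro ψ hψ
    have ha := K.isCc_aop h.smooth hψ
    refine K.decay_step (differentiable_ft h.loc hψ)
      ((continuous_ft h.loc' hψ).sub (continuous_ft h.loc ha))
      (fun i => continuous_const.mul (continuous_ft h.loc (h.isCc_source hψ i)))
      (h.ft_eqn hψ) (ih ψ hψ) ?_ fun i => ?_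
    · obtain ⟨C1, h1⟩ := (hψ.mul_left hg).ft_decay k
      obtain ⟨C2, h2⟩ := ih _ ha
      refine ⟨2 * C1 + 2 * C2, fun θ => ?_⟩
      have hw : 0 ≤ wt θ ^ k := by have := one_le_wt θ; positivity
      have := norm_sub_le (ft (fun y => g y * ψ y) θ) (ft (fun y => U y * K.aop b ψ y) θ)
      set x := ‖ft (fun y => g y * ψ y) θ‖
      set y := ‖ft (fun y => U y * K.aop b ψ y) θ‖
      have h3 : ‖ft (fun y => g y * ψ y) θ - ft (fun y => U y * K.aop b ψ y) θ‖ ^ 2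
          ≤ 2 * x ^ 2 + 2 * y ^ 2 :=
        (pow_le_pow_left₀ (norm_nonneg _) this 2).trans (by nlinarith [sq_nonneg (x - y)])
      have h4 := mul_le_mul_of_nonneg_left h3 hw
      rw [Pi.sub_apply]
      linarith [h1 θ, h2 θ]
    · obtain ⟨C, hC⟩ := ih _ (h.isCc_source hψ i)
      exact ⟨C, fun θ => by simpa using hC θ⟩

/-- Hypoellipticity: weak solutions with smooth right-hand side are smooth. -/
theorem WeakSol.exists_smooth (h : K.WeakSol b U g) (hg : ContDiff ℝ (⊤ : ℕ∞) g) :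
    ∃ u : F → ℝ, ContDiff ℝ (⊤ : ℕ∞) u ∧ U =ᵐ[volume] u := by
  refine exists_smooth_of_local fun ψ hψ =>
    exists_smooth_of_ft_decay (h.loc.mul_isCc hψ) (continuous_ft h.loc hψ) fun k => ?_
  obtain ⟨C, hC⟩ := h.decay hg (10 * k) ψ hψ
  refine ⟨√C, fun θ => le_sqrt_of_sq_le ?_⟩
  refine le_trans (le_of_eq ?_) (hC θ)
  rw [mul_pow, ← wt_pow_five]
  ring

end KolData

end Fourier

end Regularity

section Compact

open scoped FourierTransform RealInnerProductSpace ContDiff SchwartzMap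

section Compactness

variable {F ι : Type*} [NormedAddCommGroup F] [InnerProductSpace ℝ F]
  [FiniteDimensional ℝ F] [MeasurableSpace F] [BorelSpace F] [Fintype ι]

namespace KolData

variable (K : KolData F ι) {b : ι → F → ℝ}

lemma continuous_flow_uncurry : Continuous fun x : ℝ × F => K.flow x.1 x.2 := by
  simp only [flow_apply]
  fun_prop

lemma exists_lintegral_flow_bound : ∃ C ≥ 0, ∀ s, |s| ≤ 1 → ∀ h : F → ENNReal, Measurable h →
    ∫⁻ θ, h (K.flow s θ) ≤ ENNReal.ofReal C * ∫⁻ θ, h θ := by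
  have cd : Continuous fun s : ℝ => (K.flow s).det := by
    refine ContinuousLinearMap.continuous_det.comp ?_
    unfold flow
    fun_prop
  have hdet : ∀ s, (K.flow (-s)).det * (K.flow s).det = 1 := by
    intro s
    have : (K.flow (-s)).toLinearMap ∘ₗ (K.flow s).toLinearMap = LinearMap.id := by
      ext θ; exact K.flow_neg_flow s θ
    have h2 := congrArg LinearMap.det this
    rw [LinearMap.det_comp, LinearMap.det_id] at h2
    exact h2
  obtain ⟨C, hC⟩ := (isCompact_Icc (a := (-1 : ℝ)) (b := 1)).exists_bound_of_continuousOn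
    cd.continuousOn
  have hC0 : 0 ≤ C := (norm_nonneg _).trans (hC 0 (by simp))
  refine ⟨C, hC0, fun s hs h mh => ?_⟩
  have hne : LinearMap.det (K.flow s).toLinearMap ≠ 0 := by
    intro h0
    have := hdet s
    rw [show (K.flow s).det = 0 from h0, mul_zero] at this
    exact zero_ne_one this
  have hmap := Measure.map_linearMap_addHaar_eq_smul_addHaar (volume : Measure F) hne
  have e1 : ∫⁻ θ, h (K.flow s θ) = ∫⁻ θ, h θ ∂(Measure.map (K.flow s).toLinearMap volume) :=
    (lintegral_map mh (K.flow s).continuous.measurable).symm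
  rw [e1, hmap, lintegral_smul_measure, smul_eq_mul]
  gcongr
  rw [← eq_inv_of_mul_eq_one_left (show (K.flow (-s)).det * LinearMap.det (K.flow s).toLinearMap = 1 from hdet s)]
  exact hC (-s) (by rw [abs_le] at hs; constructor <;> linarith)

/-- Uniform decay of the mass of a solution at high frequencies. -/
lemma exists_tail_bound : ∃ D ≥ 0, ∀ {v g₀ : F → ℂ} {g : ι → F → ℂ} {h : F → ℝ},
    Differentiable ℝ v → Continuous g₀ → (∀ i, Continuous (g i)) →
    (∀ θ, fderiv ℝ v θ (K.A θ) = (K.rate θ : ℂ) * v θ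
      + (g₀ θ + ∑ i, ((2 * π * ⟪θ, K.e i⟫ : ℝ) : ℂ) * g i θ)) → Continuous h →
    (∀ θ, ‖v θ‖ ^ 2 ≤ h θ) → (∀ θ, ‖g₀ θ‖ ^ 2 + ∑ i, ‖g i θ‖ ^ 2 ≤ h θ) →
    ∀ R ≥ 0, ∫⁻ θ in {θ | R ≤ ‖θ‖}, ENNReal.ofReal (‖v θ‖ ^ 2)
      ≤ ENNReal.ofReal (D / (1 + R) ^ (1 / 5 : ℝ)) * ∫⁻ θ, ENNReal.ofReal (h θ) := by
  obtain ⟨C, hC0, hC⟩ := K.exists_lintegral_flow_bound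
  have hκ : 0 < K.c / 2000 := by have := K.c_pos; positivity
  obtain ⟨J, hJ0, hJ⟩ := exists_integral_exp_bound hκ
  set κ := K.c / 2000 with hκd
  refine ⟨6 * C * J, by positivity, ?_⟩
  intro v g₀ g h hv cg₀ cg eqn ch hvh hgh R hR
  have h0 : ∀ θ, 0 ≤ h θ := fun θ => (by positivity : 0 ≤ ‖v θ‖ ^ 2).trans (hvh θ)
  set E : ℝ → ℝ := fun s => exp (-(κ * s ^ 5 * R ^ 2)) with hE
  have cE : Continuous E := by fun_prop
  have E0 : ∀ s, 0 ≤ E s := fun s => (exp_pos _).le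
  set I := ∫ s in (0 : ℝ)..1, E s with hI
  have b1 : exp (-(κ * R ^ 2)) ≤ I := by
    have := intervalIntegral.integral_mono_on zero_le_one
      (intervalIntegrable_const (μ := volume) (c := exp (-(κ * R ^ 2)))) (cE.intervalIntegrable 0 1)
      fun s hs => by
        have : s ^ 5 ≤ 1 := pow_le_one₀ hs.1 hs.2
        simp only [hE]
        gcongr
        exact mul_le_of_le_one_right (by positivity) this
    simpa using this
  have I0 : 0 ≤ I := (exp_pos _).le.trans b1
  have hIl : ∫⁻ s in Set.Ioc (0 : ℝ) 1, ENNReal.ofReal (E s) = ENNReal.ofReal I := by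
    rw [hI, intervalIntegral.integral_of_le zero_le_one,
      ofReal_integral_eq_lintegral_ofReal ((cE.integrableOn_Icc (a := 0) (b := 1)).mono_set Set.Ioc_subset_Icc_self) (Eventually.of_forall E0)]
  have chf : Continuous fun x : ℝ × F => h (K.flow x.1 x.2) := ch.comp K.continuous_flow_uncurry
  have chs : ∀ θ, Continuous fun s => h (K.flow s θ) := fun θ =>
    chf.comp (continuous_id.prodMk continuous_const)
  have cht : ∀ s, Continuous fun θ => h (K.flow s θ) := fun s =>
    chf.comp (continuous_const.prodMk continuous_id)
  have pt : ∀ θ ∈ {θ : F | R ≤ ‖θ‖}, ENNReal.ofReal (‖v θ‖ ^ 2) ≤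
      ENNReal.ofReal (2 * I) * ENNReal.ofReal (h (K.flow 1 θ))
      + 4 * ∫⁻ s in Set.Ioc (0 : ℝ) 1, ENNReal.ofReal (E s) * ENNReal.ofReal (h (K.flow s θ)) := by
    intro θ hθ
    have hθ : R ≤ ‖θ‖ := hθ
    have ii : IntegrableOn (fun s => E s * h (K.flow s θ)) (Set.Ioc 0 1) :=
      ((cE.mul (chs θ)).integrableOn_Icc (a := 0) (b := 1)).mono_set Set.Ioc_subset_Icc_self
    have e1 : ∫⁻ s in Set.Ioc (0 : ℝ) 1, ENNReal.ofReal (E s) * ENNReal.ofReal (h (K.flow s θ))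
        = ENNReal.ofReal (∫ s in (0 : ℝ)..1, E s * h (K.flow s θ)) := by
      rw [intervalIntegral.integral_of_le zero_le_one,
        ofReal_integral_eq_lintegral_ofReal ii
          (Eventually.of_forall fun s => mul_nonneg (E0 s) (h0 _))]
      simp only [ENNReal.ofReal_mul (E0 _)]
    have i0 : 0 ≤ ∫ s in (0 : ℝ)..1, E s * h (K.flow s θ) :=
      intervalIntegral.integral_nonneg zero_le_one fun s _ => mul_nonneg (E0 s) (h0 _)
    rw [e1, ← ENNReal.ofReal_mul (by positivity),
      show (4 : ENNReal) = ENNReal.ofReal 4 by simp, ← ENNReal.ofReal_mul (by norm_num),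
      ← ENNReal.ofReal_add (mul_nonneg (by positivity) (h0 _)) (by positivity)]
    refine ENNReal.ofReal_le_ofReal ((K.sq_norm_le_along_flow hv cg₀ cg eqn ch hvh hgh θ).trans ?_)
    have hs2 : R ^ 2 ≤ ‖θ‖ ^ 2 := pow_le_pow_left₀ hR hθ 2
    have := h0 (K.flow 1 θ)
    gcongr
    · refine le_trans ?_ b1
      gcongr
    · refine intervalIntegral.integral_mono_on zero_le_one ?_ ?_ fun s hs => ?_
      · exact ((by fun_prop : Continuous fun s : ℝ => exp (-(κ * s ^ 5 * ‖θ‖ ^ 2))).mul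
          (chs θ)).intervalIntegrable _ _
      · exact (cE.mul (chs θ)).intervalIntegrable _ _
      · have := h0 (K.flow s θ)
        have := hs.1
        simp only [hE]
        gcongr
  set H := ∫⁻ θ, ENNReal.ofReal (h θ) with hH
  have mh : Measurable fun θ => ENNReal.ofReal (h θ) := (ENNReal.continuous_ofReal.comp ch).measurable
  have mf : ∀ s, Measurable fun θ => ENNReal.ofReal (h (K.flow s θ)) := fun s =>
    (ENNReal.continuous_ofReal.comp (cht s)).measurable
  have m2 : Measurable fun x : F × ℝ =>
      ENNReal.ofReal (E x.2) * ENNReal.ofReal (h (K.flow x.2 x.1)) :=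
    (ENNReal.continuous_ofReal.comp (cE.comp continuous_snd)).measurable.mul
      (ENNReal.continuous_ofReal.comp (chf.comp continuous_swap)).measurable
  have mE : Measurable fun s => ENNReal.ofReal (E s) :=
    (ENNReal.continuous_ofReal.comp cE).measurable
  calc ∫⁻ θ in {θ | R ≤ ‖θ‖}, ENNReal.ofReal (‖v θ‖ ^ 2)
      ≤ ∫⁻ θ in {θ | R ≤ ‖θ‖}, (ENNReal.ofReal (2 * I) * ENNReal.ofReal (h (K.flow 1 θ))
      + 4 * ∫⁻ s in Set.Ioc (0 : ℝ) 1, ENNReal.ofReal (E s) * ENNReal.ofReal (h (K.flow s θ))) :=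
        setLIntegral_mono' (measurableSet_le measurable_const measurable_norm) pt
    _ ≤ ∫⁻ θ, (ENNReal.ofReal (2 * I) * ENNReal.ofReal (h (K.flow 1 θ))
      + 4 * ∫⁻ s in Set.Ioc (0 : ℝ) 1, ENNReal.ofReal (E s) * ENNReal.ofReal (h (K.flow s θ))) :=
        setLIntegral_le_lintegral _ _
    _ = ENNReal.ofReal (2 * I) * (∫⁻ θ, ENNReal.ofReal (h (K.flow 1 θ)))
      + 4 * ∫⁻ s in Set.Ioc (0 : ℝ) 1, ENNReal.ofReal (E s) * ∫⁻ θ, ENNReal.ofReal (h (K.flow s θ)) := by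
        rw [lintegral_add_left ((mf 1).const_mul _), lintegral_const_mul _ (mf 1),
          lintegral_const_mul _ m2.lintegral_prod_right', lintegral_lintegral_swap m2.aemeasurable]
        congr 2
        refine lintegral_congr fun s => lintegral_const_mul (ENNReal.ofReal (E s)) (mf s)
    _ ≤ ENNReal.ofReal (2 * I) * (ENNReal.ofReal C * H)
      + 4 * ∫⁻ s in Set.Ioc (0 : ℝ) 1, ENNReal.ofReal (E s) * (ENNReal.ofReal C * H) := by
        gcongr ?_ + 4 * ?_
        · gcongr
          exact hC 1 (by simp) _ mh
        · refine setLIntegral_mono' measurableSet_Ioc fun s hs => ?_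
          gcongr
          exact hC s (by rw [abs_of_pos hs.1]; exact hs.2) _ mh
    _ = ENNReal.ofReal (6 * C * I) * H := by
        rw [lintegral_mul_const _ mE, hIl,
          show 6 * C * I = 2 * (I * C) + 4 * (I * C) by ring,
          ENNReal.ofReal_add (by positivity) (by positivity),
          ENNReal.ofReal_mul (p := 2) (q := I) (by norm_num),
          ENNReal.ofReal_mul (p := 2) (q := I * C) (by norm_num),
          ENNReal.ofReal_mul (p := 4) (by norm_num), ENNReal.ofReal_mul I0]
        simp only [ENNReal.ofReal_ofNat]
        ring
    _ ≤ _ := by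
        gcongr
        rw [mul_div_assoc]
        gcongr
        exact hJ R hR

end KolData

/-- Plancherel for smooth compactly supported functions. -/
lemma IsCc.lintegral_ft {f : F → ℝ} (hf : IsCc f) :
    ∫⁻ θ, ENNReal.ofReal (‖KolData.ft f θ‖ ^ 2) = ENNReal.ofReal (∫ y, f y ^ 2) := by
  have h1 := SchwartzMap.integral_norm_sq_fourier hf.toSchwartz
  simp only [hf.toSchwartz_apply, Complex.norm_real, norm_eq_abs, sq_abs] at h1
  rw [← h1, ofReal_integral_eq_lintegral_ofReal]
  · rfl
  · exact (memLp_two_iff_integrable_sq_norm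
      (𝓕 hf.toSchwartz).continuous.aestronglyMeasurable).1 ((𝓕 hf.toSchwartz).memLp 2)
  · exact Eventually.of_forall fun θ => by positivity

namespace KolData

variable {K : KolData F ι} {b : ι → F → ℝ} {U g : ℕ → F → ℝ}

/-- Local compactness: bounded weakly null sequences of solutions are locally strongly null. -/
theorem tendsto_integral_sq_of_weakSol (hU : ∀ n, ContDiff ℝ (⊤ : ℕ∞) (U n))
    (hg : ∀ n, ContDiff ℝ (⊤ : ℕ∞) (g n)) (h : ∀ n, K.WeakSol b (U n) (g n))
    (bU : ∀ χ : F → ℝ, IsCc χ → ∃ M, ∀ n, ∫ y, (U n y * χ y) ^ 2 ≤ M)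
    (bg : ∀ χ : F → ℝ, IsCc χ → ∃ M, ∀ n, ∫ y, (g n y * χ y) ^ 2 ≤ M)
    (wk : ∀ χ : F → ℝ, IsCc χ → Tendsto (fun n => ∫ y, U n y * χ y) atTop (nhds 0))
    {χ : F → ℝ} (hχ : IsCc χ) :
    Tendsto (fun n => ∫ y, (U n y * χ y) ^ 2) atTop (nhds 0) := by
  obtain ⟨D, hD0, hD⟩ := K.exists_tail_bound
  have ha := K.isCc_aop (h 0).smooth hχ
  have hsrc := fun i => (h 0).isCc_source hχ i
  obtain ⟨M1, hM1⟩ := bU χ hχ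
  obtain ⟨M2, hM2⟩ := bg χ hχ
  obtain ⟨M3, hM3⟩ := bU _ ha
  choose M4 hM4 using fun i => bU _ (hsrc i)
  set v : ℕ → F → ℂ := fun n => ft fun y => U n y * χ y with hv
  set w1 : ℕ → F → ℂ := fun n => ft fun y => g n y * χ y with hw1
  set w2 : ℕ → F → ℂ := fun n => ft fun y => U n y * K.aop b χ y with hw2
  set w3 : ι → ℕ → F → ℂ := fun i n =>
    ft fun y => U n y * (2 * fderiv ℝ χ y (K.e i) + b i y * χ y) with hw3
  have cv : ∀ n, Continuous (v n) := fun n => continuous_ft (h n).loc hχ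
  have cw1 : ∀ n, Continuous (w1 n) := fun n => continuous_ft (h n).loc' hχ
  have cw2 : ∀ n, Continuous (w2 n) := fun n => continuous_ft (h n).loc ha
  have cw3 : ∀ i n, Continuous (w3 i n) := fun i n => continuous_ft (h n).loc (hsrc i)
  set H : ℕ → F → ℝ := fun n θ => ‖v n θ‖ ^ 2 + (2 * ‖w1 n θ‖ ^ 2 + 2 * ‖w2 n θ‖ ^ 2
    + ∑ i, ‖w3 i n θ‖ ^ 2) with hH
  set M : ENNReal := ENNReal.ofReal M1 + (2 * ENNReal.ofReal M2 + 2 * ENNReal.ofReal M3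
    + ∑ i, ENNReal.ofReal (M4 i)) with hM
  have hMt : M ≠ ⊤ := by
    simp [hM, ENNReal.add_eq_top, ENNReal.mul_eq_top]
  have hHM : ∀ n, ∫⁻ θ, ENNReal.ofReal (H n θ) ≤ M := by
    intro n
    have e : ∀ θ, ENNReal.ofReal (H n θ) = ENNReal.ofReal (‖v n θ‖ ^ 2)
        + (2 * ENNReal.ofReal (‖w1 n θ‖ ^ 2) + 2 * ENNReal.ofReal (‖w2 n θ‖ ^ 2)
          + ∑ i, ENNReal.ofReal (‖w3 i n θ‖ ^ 2)) := by
      intro θ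
      simp only [hH]
      rw [ENNReal.ofReal_add (by positivity) (by positivity),
        ENNReal.ofReal_add (by positivity) (by positivity),
        ENNReal.ofReal_add (by positivity) (by positivity), ENNReal.ofReal_mul (by positivity),
        ENNReal.ofReal_mul (by positivity), ENNReal.ofReal_sum_of_nonneg (fun i _ => by positivity)]
      simp
    have mm : ∀ {f : F → ℂ}, Continuous f → Measurable fun θ => ENNReal.ofReal (‖f θ‖ ^ 2) :=
      fun hf => (ENNReal.continuous_ofReal.comp (hf.norm.pow 2)).measurable
    simp only [e]
    rw [lintegral_add_left (mm (cv n)), lintegral_add_left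
      (show Measurable fun θ => 2 * ENNReal.ofReal (‖w1 n θ‖ ^ 2) + 2 * ENNReal.ofReal (‖w2 n θ‖ ^ 2)
        from ((mm (cw1 n)).const_mul _).add ((mm (cw2 n)).const_mul _)),
      lintegral_add_left ((mm (cw1 n)).const_mul _), lintegral_const_mul _ (mm (cw1 n)),
      lintegral_const_mul _ (mm (cw2 n)), lintegral_finsetSum _ fun i _ => mm (cw3 i n)]
    simp only [hv, hw1, hw2, hw3]
    rw [(hχ.mul_left (hU n)).lintegral_ft, (hχ.mul_left (hg n)).lintegral_ft,
      (ha.mul_left (hU n)).lintegral_ft]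
    simp only [fun i => ((hsrc i).mul_left (hU n)).lintegral_ft]
    have := hM1 n
    have := hM2 n
    have := hM3 n
    rw [hM]
    gcongr with i
    exact hM4 i n
  have tail := fun n => hD (v := v n) (g₀ := w1 n - w2 n) (g := fun i θ => Complex.I * w3 i n θ)
    (h := H n) (differentiable_ft (h n).loc hχ) ((cw1 n).sub (cw2 n))
    (fun i => continuous_const.mul (cw3 i n)) ((h n).ft_eqn hχ)
    (((cv n).norm.pow 2).add (((((cw1 n).norm.pow 2).const_mul 2).add
      (((cw2 n).norm.pow 2).const_mul 2)).add
      (continuous_finsetSum _ fun i _ => (cw3 i n).norm.pow 2)))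
    (fun θ => le_add_of_nonneg_right (by positivity))
    (fun θ => by
      have := norm_sub_le (w1 n θ) (w2 n θ)
      have h3 : ‖w1 n θ - w2 n θ‖ ^ 2 ≤ 2 * ‖w1 n θ‖ ^ 2 + 2 * ‖w2 n θ‖ ^ 2 :=
        (pow_le_pow_left₀ (norm_nonneg _) this 2).trans
          (by nlinarith [sq_nonneg (‖w1 n θ‖ - ‖w2 n θ‖)])
      have h4 : 0 ≤ ‖v n θ‖ ^ 2 := by positivity
      simp only [Pi.sub_apply, norm_mul, Complex.norm_I, one_mul, hH]
      linarith)
  obtain ⟨L, hL⟩ : ∃ L, ∀ n θ, ‖v n θ‖ ≤ L := by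
    refine ⟨M1 + volume.real (tsupport χ), fun n θ => (norm_ft_le _ θ).trans ?_⟩
    have ic := hχ.mul_left (hU n)
    have i2 : Integrable fun y => (U n y * χ y) ^ 2 := by
      have : IsCc fun y => (U n y * χ y) * (U n y * χ y) := ic.mul_left ic.1
      simp only [sq]
      exact this.continuous.integrable_of_hasCompactSupport this.2
    have i3 : Integrable ((tsupport χ).indicator fun _ => (1 : ℝ)) :=
      (integrable_indicator_iff (isClosed_tsupport χ).measurableSet).2
        (integrableOn_const hχ.2.isCompact.measure_lt_top.ne)
    calc ∫ y, ‖U n y * χ y‖ ≤ ∫ y, ((U n y * χ y) ^ 2 + (tsupport χ).indicator (fun _ => (1 : ℝ)) y) := by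
          refine integral_mono ((h n).loc.mul_isCc hχ).norm (i2.add i3) fun y => ?_
          by_cases hy : y ∈ tsupport χ
          · simp only [Set.indicator_of_mem hy, norm_eq_abs]
            rw [← sq_abs]
            nlinarith [sq_nonneg (|U n y * χ y| - 1)]
          · simp [Set.indicator_of_notMem hy, image_eq_zero_of_notMem_tsupport hy]
      _ = (∫ y, (U n y * χ y) ^ 2) + volume.real (tsupport χ) := by
          rw [integral_add i2 i3, integral_indicator (isClosed_tsupport χ).measurableSet]
          simp
      _ ≤ _ := by have := hM1 n; gcongr
  have pw : ∀ θ, Tendsto (fun n => v n θ) atTop (nhds 0) := by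
    intro θ
    have hc : ContDiff ℝ (⊤ : ℕ∞) fun y => (wave θ y).re := Complex.reCLM.contDiff.comp (contDiff_wave θ)
    have hs : ContDiff ℝ (⊤ : ℕ∞) fun y => (wave θ y).im := Complex.imCLM.contDiff.comp (contDiff_wave θ)
    have e : ∀ n, v n θ = ((∫ y, U n y * ((wave θ y).re * χ y) : ℝ) : ℂ)
        + ((∫ y, U n y * ((wave θ y).im * χ y) : ℝ) : ℂ) * Complex.I := by
      intro n
      simp only [hv, ft_eq]
      rw [← integral_complex_ofReal, ← integral_complex_ofReal, ← integral_mul_const,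
        ← integral_add ((h n).loc.mul_isCc (hχ.mul_left hc)).ofReal
          (((h n).loc.mul_isCc (hχ.mul_left hs)).ofReal.mul_const _)]
      congr 1; ext y
      conv_lhs => rw [← Complex.re_add_im (wave θ y)]
      push_cast; ring
    simp only [e]
    have t1 := (Complex.continuous_ofReal.tendsto 0).comp (wk _ (hχ.mul_left hc))
    have t2 := (Complex.continuous_ofReal.tendsto 0).comp (wk _ (hχ.mul_left hs))
    simpa using t1.add (t2.mul_const Complex.I)
  have main : Tendsto (fun n => ∫⁻ θ, ENNReal.ofReal (‖v n θ‖ ^ 2)) atTop (nhds 0) := by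
    rw [ENNReal.tendsto_nhds_zero]
    intro ε hε
    have tR : Tendsto (fun R : ℝ => ENNReal.ofReal (D / (1 + R) ^ (1 / 5 : ℝ)) * M) atTop (nhds 0) := by
      have t1 : Tendsto (fun R : ℝ => D / (1 + R) ^ (1 / 5 : ℝ)) atTop (nhds 0) :=
        tendsto_const_nhds.div_atTop ((tendsto_rpow_atTop (by norm_num)).comp
          (tendsto_atTop_add_const_left _ 1 tendsto_id))
      have t2 := ENNReal.Tendsto.mul_const (ENNReal.tendsto_ofReal t1) (Or.inr hMt)
      simpa using t2
    obtain ⟨R, hR0, hR⟩ := ((eventually_ge_atTop (0 : ℝ)).and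
      (ENNReal.tendsto_nhds_zero.1 tR (ε / 2) (ENNReal.half_pos hε.ne'))).exists
    have low : Tendsto (fun n => ∫⁻ θ in {θ | R ≤ ‖θ‖}ᶜ, ENNReal.ofReal (‖v n θ‖ ^ 2)) atTop (nhds 0) := by
      have := tendsto_lintegral_of_dominated_convergence (μ := volume.restrict {θ : F | R ≤ ‖θ‖}ᶜ)
        (F := fun n θ => ENNReal.ofReal (‖v n θ‖ ^ 2)) (f := fun _ => 0)
        (fun _ => ENNReal.ofReal (L ^ 2))
        (fun n => ENNReal.measurable_ofReal.comp ((cv n).norm.pow 2).measurable)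
        (fun n => Eventually.of_forall fun θ =>
          ENNReal.ofReal_le_ofReal (pow_le_pow_left₀ (norm_nonneg _) (hL n θ) 2))
        (by
          rw [lintegral_const, Measure.restrict_apply_univ]
          refine ENNReal.mul_ne_top ENNReal.ofReal_ne_top ?_
          have : {θ : F | R ≤ ‖θ‖}ᶜ = Metric.ball 0 R := by ext θ; simp
          rw [this]
          exact measure_ball_lt_top.ne)
        (Eventually.of_forall fun θ => by
          have := ENNReal.tendsto_ofReal (((pw θ).norm).pow 2)
          simpa using this)
      simpa using this
    filter_upwards [ENNReal.tendsto_nhds_zero.1 low (ε / 2) (ENNReal.half_pos hε.ne')] with n hn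
    rw [← lintegral_add_compl _ (measurableSet_le measurable_const measurable_norm :
      MeasurableSet {θ : F | R ≤ ‖θ‖}), ← ENNReal.add_halves ε]
    refine add_le_add ((tail n R hR0).trans ?_) hn
    refine le_trans ?_ hR
    gcongr
    exact hHM n
  simp only [hv, fun n => (hχ.mul_left (hU n)).lintegral_ft] at main
  have := (ENNReal.tendsto_toReal ENNReal.zero_ne_top).comp main
  refine (this.congr fun n => ?_)
  exact ENNReal.toReal_ofReal (integral_nonneg fun y => sq_nonneg _)

end KolData

end Compactness

end Compact

section Space

open scoped ContDiff

section Periodic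

variable {d m : ℕ}

/-- Smooth functions on `X`. -/
def IsSm (d m : ℕ) (φ : Xsp d m → ℝ) : Prop := ContDiff ℝ (⊤ : ℕ∞) φ ∧ PerQ d m φ

/-- The lattice vector in `X` attached to `k`. -/
def latv (m : ℕ) {d : ℕ} (k : Fin d → ℤ) : Xsp d m := (fun i => (k i : ℝ), 0)

lemma perQ_iff {E : Type*} {φ : Xsp d m → E} :
    (∀ (k : Fin d → ℤ) (x : Xsp d m), φ (x.1 + (fun i => (k i : ℝ)), x.2) = φ x) ↔
      ∀ k x, φ (x + latv m k) = φ x := by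
  have : ∀ (k : Fin d → ℤ) (x : Xsp d m), x + latv m k = (x.1 + (fun i => (k i : ℝ)), x.2) := by
    intro k x; ext <;> simp [latv]
  simp only [this]

lemma PerQ.add_latv {φ : Xsp d m → ℝ} (h : PerQ d m φ) (k x) : φ (x + latv m k) = φ x :=
  perQ_iff.1 h k x

lemma PerQ.fderiv_add_latv {φ : Xsp d m → ℝ} (h : PerQ d m φ) (k x) :
    fderiv ℝ φ (x + latv m k) = fderiv ℝ φ x := by
  rw [← fderiv_comp_add_right]
  congr 1; ext y; exact h.add_latv k y

lemma fderiv_smooth {E : Type*} [NormedAddCommGroup E] [NormedSpace ℝ E] {φ : E → ℝ}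
    (h : ContDiff ℝ (⊤ : ℕ∞) φ) {w : E → E} (hw : ContDiff ℝ (⊤ : ℕ∞) w) :
    ContDiff ℝ (⊤ : ℕ∞) fun x => fderiv ℝ φ x (w x) :=
  (h.fderiv_right (m := (⊤ : ℕ∞)) (by simp)).clm_apply hw

namespace IsSm

variable {φ ψ : Xsp d m → ℝ}

lemma const (c : ℝ) : IsSm d m fun _ => c := ⟨contDiff_const, fun _ _ => rfl⟩

lemma add (h : IsSm d m φ) (h' : IsSm d m ψ) : IsSm d m fun x => φ x + ψ x :=
  ⟨h.1.add h'.1, fun k x => by simp only [h.2 k x, h'.2 k x]⟩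

lemma sub (h : IsSm d m φ) (h' : IsSm d m ψ) : IsSm d m fun x => φ x - ψ x :=
  ⟨h.1.sub h'.1, fun k x => by simp only [h.2 k x, h'.2 k x]⟩

lemma mul (h : IsSm d m φ) (h' : IsSm d m ψ) : IsSm d m fun x => φ x * ψ x :=
  ⟨h.1.mul h'.1, fun k x => by simp only [h.2 k x, h'.2 k x]⟩

lemma comp (h : IsSm d m φ) {η : ℝ → ℝ} (hη : ContDiff ℝ (⊤ : ℕ∞) η) : IsSm d m fun x => η (φ x) :=
  ⟨hη.comp h.1, fun k x => by simp only [h.2 k x]⟩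

lemma inv (h : IsSm d m φ) (h0 : ∀ x, φ x ≠ 0) : IsSm d m fun x => (φ x)⁻¹ :=
  ⟨h.1.inv h0, fun k x => by simp only [h.2 k x]⟩

lemma const_mul (h : IsSm d m φ) (c : ℝ) : IsSm d m fun x => c * φ x := (const c).mul h

lemma sq (h : IsSm d m φ) : IsSm d m fun x => φ x ^ 2 := by simpa only [pow_two] using h.mul h

lemma sum {ι : Type*} {s : Finset ι} {f : ι → Xsp d m → ℝ} (h : ∀ i, IsSm d m (f i)) :
    IsSm d m fun x => ∑ i ∈ s, f i x :=
  ⟨ContDiff.sum fun i _ => (h i).1, fun k x => by simp only [fun i => (h i).2 k x]⟩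

lemma fderiv (h : IsSm d m φ) {w : Xsp d m → Xsp d m} (hw : ContDiff ℝ (⊤ : ℕ∞) w)
    (hw' : ∀ k x, w (x + latv m k) = w x) : IsSm d m fun x => fderiv ℝ φ x (w x) :=
  ⟨fderiv_smooth h.1 hw, (perQ_iff (φ := fun x => _root_.fderiv ℝ φ x (w x))).2 fun k x => by
    rw [h.2.fderiv_add_latv, hw']⟩

lemma fderiv_const (h : IsSm d m φ) (w : Xsp d m) : IsSm d m fun x => _root_.fderiv ℝ φ x w :=
  h.fderiv contDiff_const fun _ _ => rfl

lemma of_snd {g : (Fin d → ℝ) × (Fin m → Fin d → ℝ) → ℝ} (h : ContDiff ℝ (⊤ : ℕ∞) g) :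
    IsSm d m fun x => g x.2 := ⟨h.comp contDiff_snd, fun _ _ => rfl⟩

lemma of_fst {g : (Fin d → ℝ) → ℝ} (h : ContDiff ℝ (⊤ : ℕ∞) g) (h' : PerV d g) :
    IsSm d m fun x => g x.1 := ⟨h.comp contDiff_fst, fun k x => h' k x.1⟩

lemma continuous (h : IsSm d m φ) : Continuous φ := h.1.continuous

lemma differentiable (h : IsSm d m φ) : Differentiable ℝ φ := h.1.differentiable (by simp)

end IsSm

namespace IsTest

variable {φ ψ : Xsp d m → ℝ}

lemma isSm (h : IsTest d m φ) : IsSm d m φ := ⟨h.1, h.2.1⟩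

lemma of_local (h : IsTest d m φ) (h' : IsSm d m ψ) (hz : ∀ x, φ =ᶠ[nhds x] 0 → ψ x = 0) :
    IsTest d m ψ := by
  obtain ⟨_, _, K, hK, hK0⟩ := h
  refine ⟨h'.1, h'.2, K, hK, fun x hx => hz x ?_⟩
  have : IsOpen {y : Xsp d m | y.2 ∉ K} := (hK.isClosed.isOpen_compl).preimage continuous_snd
  filter_upwards [this.mem_nhds hx] with y hy using hK0 y hy

lemma mul_left (h : IsTest d m φ) (h' : IsSm d m ψ) : IsTest d m fun x => ψ x * φ x :=
  h.of_local (h'.mul h.isSm) fun x hx => by rw [hx.self_of_nhds]; simp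

lemma mul_right (h : IsTest d m φ) (h' : IsSm d m ψ) : IsTest d m fun x => φ x * ψ x :=
  h.of_local (h.isSm.mul h') fun x hx => by rw [hx.self_of_nhds]; simp

lemma const_mul (h : IsTest d m φ) (c : ℝ) : IsTest d m fun x => c * φ x := h.mul_left (.const c)

lemma sq (h : IsTest d m φ) : IsTest d m fun x => φ x ^ 2 := by
  simpa only [pow_two] using h.mul_left h.isSm

lemma add (h : IsTest d m φ) (h' : IsTest d m ψ) : IsTest d m fun x => φ x + ψ x := by
  obtain ⟨K, hK, hK0⟩ := h.2.2
  obtain ⟨K', hK', hK0'⟩ := h'.2.2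
  refine ⟨(h.isSm.add h'.isSm).1, (h.isSm.add h'.isSm).2, K ∪ K', hK.union hK', fun x hx => ?_⟩
  rw [Set.mem_union, not_or] at hx
  simp only [hK0 x hx.1, hK0' x hx.2, add_zero]

lemma zero : IsTest d m fun _ => 0 := ⟨contDiff_const, fun _ _ => rfl, ∅, isCompact_empty, fun _ _ => rfl⟩

lemma sum {ι : Type*} {s : Finset ι} {f : ι → Xsp d m → ℝ} (h : ∀ i, IsTest d m (f i)) :
    IsTest d m fun x => ∑ i ∈ s, f i x := by
  classical
  induction s using Finset.induction_on with
  | empty => simpa using zero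
  | insert a s ha ih => simpa only [Finset.sum_insert ha] using (h a).add ih

lemma fderiv (h : IsTest d m φ) {w : Xsp d m → Xsp d m} (hw : ContDiff ℝ (⊤ : ℕ∞) w)
    (hw' : ∀ k x, w (x + latv m k) = w x) : IsTest d m fun x => fderiv ℝ φ x (w x) :=
  h.of_local (h.isSm.fderiv hw hw') fun x hx => by rw [hx.fderiv_eq]; simp

lemma fderiv_const (h : IsTest d m φ) (w : Xsp d m) : IsTest d m fun x => _root_.fderiv ℝ φ x w :=
  h.fderiv contDiff_const fun _ _ => rfl

end IsTest

instance : (volume : Measure (Xsp d m)).IsAddHaarMeasure := by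
  have : (volume : Measure (Fin m → Fin d → ℝ)).IsAddHaarMeasure :=
    Measure.pi.isAddHaarMeasure fun _ : Fin m => (volume : Measure (Fin d → ℝ))
  have : (volume : Measure ((Fin d → ℝ) × (Fin m → Fin d → ℝ))).IsAddHaarMeasure :=
    Measure.prod.instIsAddHaarMeasure _ _
  exact Measure.prod.instIsAddHaarMeasure _ _

/-- Reduction of the position to the unit cube. -/
def fractX (x : Xsp d m) : Xsp d m := (fun i => Int.fract (x.1 i), x.2)

lemma fractX_eq (x : Xsp d m) : fractX x = x + latv m fun i => -⌊x.1 i⌋ := by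
  ext <;> simp [fractX, latv, Int.fract, sub_eq_add_neg]

lemma fractX_mem (x : Xsp d m) : (fractX x).1 ∈ cube d :=
  fun i => ⟨Int.fract_nonneg _, Int.fract_lt_one _⟩

lemma PerQ.fractX {φ : Xsp d m → ℝ} (h : PerQ d m φ) (x) : φ (fractX x) = φ x := by
  rw [fractX_eq, h.add_latv]

lemma cube_subset_Icc : cube d ⊆ Set.Icc 0 1 := fun q hq =>
  ⟨fun i => (hq i).1, fun i => (hq i).2.le⟩

lemma measurableSet_cube : MeasurableSet (cube d) := by
  have : cube d = Set.univ.pi fun _ => Set.Ico (0 : ℝ) 1 := by ext; simp [cube]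
  rw [this]
  exact MeasurableSet.univ_pi fun _ => measurableSet_Ico

lemma IsTest.exists_bound {φ : Xsp d m → ℝ} (h : IsTest d m φ) : ∃ C, ∀ x, |φ x| ≤ C := by
  obtain ⟨K, hK, hK0⟩ := h.2.2
  obtain ⟨C, hC⟩ := ((isCompact_Icc (a := (0 : Fin d → ℝ)) (b := 1)).prod hK).exists_bound_of_continuousOn
    h.1.continuous.continuousOn
  refine ⟨max C 0, fun x => ?_⟩
  by_cases hx : x.2 ∈ K
  · rw [← h.2.1.fractX]
    exact (hC (_root_.fractX x) ⟨cube_subset_Icc (fractX_mem x), hx⟩).trans (le_max_left _ _)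
  · rw [hK0 x hx, abs_zero]; exact le_max_right _ _

/-- The lattice of periods, acting on `X` by translations. -/
def latX (d m : ℕ) : AddSubgroup (Xsp d m) :=
  AddMonoidHom.range (⟨⟨latv m, by ext <;> simp [latv]⟩, fun k l => by ext <;> simp [latv]⟩ :
    (Fin d → ℤ) →+ Xsp d m)

instance : Countable (latX d m) :=
  (Set.countable_range (latv m : (Fin d → ℤ) → Xsp d m)).to_subtype

instance : VAddInvariantMeasure (latX d m) (Xsp d m) volume :=
  ⟨fun c _ hs => measure_preimage_vadd volume (c : Xsp d m) _⟩

lemma isAddFundamentalDomain_latX :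
    IsAddFundamentalDomain (latX d m) {x : Xsp d m | x.1 ∈ cube d} volume := by
  refine IsAddFundamentalDomain.mk' ((measurable_fst measurableSet_cube).nullMeasurableSet) fun x => ?_
  refine ⟨⟨latv m fun i => -⌊x.1 i⌋, _, rfl⟩, ?_, ?_⟩
  · have := fractX_mem x
    rw [fractX_eq, add_comm] at this
    exact this
  · rintro ⟨_, k, rfl⟩ hk
    have hk : ∀ i, (k i : ℝ) + x.1 i ∈ Set.Ico (0 : ℝ) 1 := hk
    refine Subtype.ext ?_
    show latv m k = latv m _
    congr 1
    ext i
    have h1 := hk i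
    have : ⌊x.1 i⌋ = - k i := by
      rw [Int.floor_eq_iff]; push_cast; constructor <;> linarith [h1.1, h1.2]
    omega

lemma integral_volX_add {F : Xsp d m → ℝ} (hF : PerQ d m F) (v : Xsp d m) :
    ∫ x, F (x + v) ∂volX d m = ∫ x, F x ∂volX d m := by
  have h1 := isAddFundamentalDomain_latX (d := d) (m := m)
  have h2 := h1.vadd_of_comm v
  have e := h2.setIntegral_eq h1 (f := F) (by
    rintro ⟨_, k, rfl⟩ x
    show F (latv m k + x) = F x
    rw [add_comm]; exact hF.add_latv k x)
  rw [volX, ← e]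
  have := (measurePreserving_add_left (volume : Measure (Xsp d m)) v).setIntegral_image_emb
    (MeasurableEquiv.addLeft v).measurableEmbedding F {x : Xsp d m | x.1 ∈ cube d}
  simp only [add_comm _ v]
  exact this.symm

lemma volX_snd_lt_top {K : Set ((Fin d → ℝ) × (Fin m → Fin d → ℝ))} (hK : IsCompact K) :
    volX d m {x | x.2 ∈ K} < ⊤ := by
  have hm : MeasurableSet {x : Xsp d m | x.2 ∈ K} := hK.measurableSet.preimage measurable_snd
  rw [volX, Measure.restrict_apply hm]
  refine lt_of_le_of_lt (measure_mono ?_)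
    ((isCompact_Icc (a := (0 : Fin d → ℝ)) (b := 1)).prod hK).measure_lt_top
  exact fun x hx => ⟨cube_subset_Icc hx.2, hx.1⟩

lemma IsTest.integrable_volX {φ : Xsp d m → ℝ} (h : IsTest d m φ) : Integrable φ (volX d m) := by
  obtain ⟨K, hK, hK0⟩ := h.2.2
  obtain ⟨C, hC⟩ := h.exists_bound
  have : Integrable ({x : Xsp d m | x.2 ∈ K}.indicator fun _ => C) (volX d m) :=
    (integrable_indicator_iff (hK.measurableSet.preimage measurable_snd)).2
      (integrableOn_const (volX_snd_lt_top hK).ne)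
  refine this.mono' h.1.continuous.aestronglyMeasurable (Eventually.of_forall fun x => ?_)
  by_cases hx : x.2 ∈ K
  · rw [Set.indicator_of_mem (show x ∈ {x : Xsp d m | x.2 ∈ K} from hx)]; exact hC x
  · rw [hK0 x hx, norm_zero]
    exact Set.indicator_apply_nonneg fun h => absurd h hx

/-- Integration by parts on `X`. -/
lemma integral_fderiv_volX {φ : Xsp d m → ℝ} (h : IsTest d m φ) (v : Xsp d m) :
    ∫ x, fderiv ℝ φ x v ∂volX d m = 0 := by
  obtain ⟨K, hK, hK0⟩ := (h.fderiv_const v).2.2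
  obtain ⟨C, hC⟩ := (h.fderiv_const v).exists_bound
  set K' : Set ((Fin d → ℝ) × (Fin m → Fin d → ℝ)) :=
    (fun a : ℝ × ((Fin d → ℝ) × (Fin m → Fin d → ℝ)) => a.2 - a.1 • v.2) '' (Set.Icc (-1) 1 ×ˢ K) with hK'
  have cK' : IsCompact K' := (isCompact_Icc.prod hK).image (by fun_prop)
  have hd : ∀ x t, HasDerivAt (fun t : ℝ => φ (x + t • v)) (fderiv ℝ φ (x + t • v) v) t := by
    intro x t
    have h1 := (h.isSm.differentiable (x + t • v)).hasFDerivAt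
    have h2 : HasDerivAt (fun t : ℝ => x + t • v) v t := by
      simpa using ((hasDerivAt_id t).smul_const v).const_add x
    exact h1.comp_hasDerivAt t h2
  have key := hasDerivAt_integral_of_dominated_loc_of_deriv_le (μ := volX d m)
    (F := fun (t : ℝ) x => φ (x + t • v)) (F' := fun (t : ℝ) x => fderiv ℝ φ (x + t • v) v) (x₀ := 0)
    (s := Metric.ball 0 1)
    (bound := {x : Xsp d m | x.2 ∈ K'}.indicator fun _ => C) (Metric.ball_mem_nhds _ one_pos)
    (Eventually.of_forall fun t =>
      (h.1.continuous.comp (continuous_id.add continuous_const)).aestronglyMeasurable)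
    (by simpa using h.integrable_volX)
    (by simpa using (h.fderiv_const v).1.continuous.aestronglyMeasurable)
    (Eventually.of_forall fun x t ht => by
      rw [Metric.mem_ball, dist_zero_right, norm_eq_abs, abs_lt] at ht
      by_cases hx : (x + t • v).2 ∈ K
      · rw [Set.indicator_of_mem]
        · exact hC _
        · exact ⟨(t, (x + t • v).2), ⟨⟨ht.1.le, ht.2.le⟩, hx⟩, by simp⟩
      · have h0 : fderiv ℝ φ (x + t • v) v = 0 := hK0 _ hx
        rw [h0, norm_zero]
        exact Set.indicator_apply_nonneg fun _ => (abs_nonneg _).trans (hC 0))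
    ((integrable_indicator_iff (cK'.measurableSet.preimage measurable_snd)).2
      (integrableOn_const (volX_snd_lt_top cK').ne))
    (Eventually.of_forall fun x t _ => hd x t)
  have h2 := key.2
  simp only [integral_volX_add h.2.1, zero_smul, add_zero] at h2
  exact h2.unique (hasDerivAt_const _ _)

end Periodic

end Space

section Generator

open scoped ContDiff

/-- The data of the Langevin equation. -/
structure Gle (d m : ℕ) where
  β : ℝ
  α : Fin m → ℝ
  lam : Fin m → ℝ
  V : (Fin d → ℝ) → ℝ
  Z : ℝ
  j0 : Fin m
  hβ : 0 < β
  hα : ∀ j, 0 < α j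
  hlam : ∀ j, 0 < lam j
  hV : ContDiff ℝ (⊤ : ℕ∞) V
  hVper : PerV d V
  hZ : 0 < Z
  prob : IsProbabilityMeasure (gibbs d m β Z V)

namespace Gle

variable {d m : ℕ} (D : Gle d m) {φ ψ : Xsp d m → ℝ}

def μ : Measure (Xsp d m) := gibbs d m D.β D.Z D.V

instance : IsProbabilityMeasure D.μ := D.prob

/-- The coordinate direction `z_{j,k}`. -/
def ez (i : Fin m × Fin d) : Xsp d m := zdir d m i.1 (Pi.single i.2 1)
def ep (k : Fin d) : Xsp d m := (0, Pi.single k 1, 0)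
def eq (k : Fin d) : Xsp d m := (Pi.single k 1, 0, 0)

lemma ez_apply (i : Fin m × Fin d) (j k) : (ez i).2.2 j k = if i = (j, k) then 1 else 0 := by
  obtain ⟨j', k'⟩ := i
  by_cases h : j = j'
  · subst h; simp [ez, zdir, Pi.single_apply, eq_comm]
  · simp [ez, zdir, h, Ne.symm h]

@[simp] lemma ez_fst (i : Fin m × Fin d) : (ez i).1 = 0 := rfl
@[simp] lemma ez_snd_fst (i : Fin m × Fin d) : (ez i).2.1 = 0 := rfl

lemma zdir_eq_sum (j : Fin m) (v : Fin d → ℝ) : zdir d m j v = ∑ k, v k • ez (j, k) := by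
  refine Prod.ext ?_ (Prod.ext ?_ ?_)
  · simp [zdir, Prod.fst_sum]
  · simp [zdir, Prod.fst_sum, Prod.snd_sum]
  · ext j' k'
    simp only [Prod.snd_sum, Finset.sum_apply, Prod.smul_snd, Pi.smul_apply, ez_apply, smul_eq_mul]
    by_cases h : j' = j
    · subst h; simp [zdir]
    · simp [zdir, h, Ne.symm h]

lemma eq_sum (x : Xsp d m) :
    x = ∑ k, x.1 k • eq k + ∑ k, x.2.1 k • ep k + ∑ i : Fin m × Fin d, x.2.2 i.1 i.2 • ez i := by
  refine Prod.ext ?_ (Prod.ext ?_ ?_)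
  · ext k; simp [Prod.fst_sum, eq, ep, Pi.single_apply]
  · ext k; simp [Prod.fst_sum, Prod.snd_sum, eq, ep, Pi.single_apply]
  · ext j k
    simp [Prod.snd_sum, eq, ep, ez_apply]

lemma map_eq_sum (L : Xsp d m →L[ℝ] ℝ) (x : Xsp d m) :
    L x = ∑ k, x.1 k * L (eq k) + ∑ k, x.2.1 k * L (ep k) +
      ∑ i : Fin m × Fin d, x.2.2 i.1 i.2 * L (ez i) := by
  conv_lhs => rw [eq_sum x]
  simp

/-- The energy. -/
def E (x : Xsp d m) : ℝ := D.V x.1 + (∑ i, (x.2.1 i) ^ 2) / 2 + (∑ j, ∑ i, (x.2.2 j i) ^ 2) / 2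

lemma contDiff_p (k : Fin d) : IsSm d m fun x => x.2.1 k :=
  .of_snd (g := fun y => y.1 k) (by fun_prop)

lemma contDiff_z (j : Fin m) (k : Fin d) : IsSm d m fun x => x.2.2 j k :=
  .of_snd (g := fun y => y.2 j k) (by fun_prop)

lemma isSm_V : IsSm d m fun x => D.V x.1 := .of_fst D.hV D.hVper

def dV (k : Fin d) (q : Fin d → ℝ) : ℝ := fderiv ℝ D.V q (Pi.single k 1)

lemma dV_smooth (k : Fin d) : ContDiff ℝ (⊤ : ℕ∞) (D.dV k) := fderiv_smooth D.hV contDiff_const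

lemma dV_per (k : Fin d) : PerV d (D.dV k) := fun l q => by
  show fderiv ℝ D.V _ _ = fderiv ℝ D.V _ _
  rw [← fderiv_comp_add_right]
  congr 2; ext y; exact D.hVper l y

lemma isSm_dV (k : Fin d) : IsSm d m fun x => D.dV k x.1 := .of_fst (D.dV_smooth k) (D.dV_per k)

lemma isSm_E : IsSm d m D.E := by
  have h1 : IsSm d m fun x => (∑ i, (x.2.1 i) ^ 2) := .sum fun i => (contDiff_p i).sq
  have h2 : IsSm d m fun x => (∑ j, ∑ i, (x.2.2 j i) ^ 2) := .sum fun j => .sum fun i => (contDiff_z j i).sq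
  have := (D.isSm_V.add (h1.const_mul 2⁻¹)).add (h2.const_mul 2⁻¹)
  convert this using 2
  simp only [E]; ring

lemma fderiv_p (k : Fin d) (x v : Xsp d m) : fderiv ℝ (fun x : Xsp d m => x.2.1 k) x v = v.2.1 k := by
  let L : Xsp d m →L[ℝ] ℝ := (ContinuousLinearMap.proj (R := ℝ) (φ := fun _ : Fin d => ℝ) k).comp
    ((ContinuousLinearMap.fst ℝ _ _).comp (ContinuousLinearMap.snd ℝ _ _))
  exact congrArg (· v) (L.hasFDerivAt (x := x)).fderiv

lemma fderiv_z (j : Fin m) (k : Fin d) (x v : Xsp d m) :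
    fderiv ℝ (fun x : Xsp d m => x.2.2 j k) x v = v.2.2 j k := by
  let L : Xsp d m →L[ℝ] ℝ := (ContinuousLinearMap.proj (R := ℝ) (φ := fun _ : Fin d => ℝ) k).comp
    ((ContinuousLinearMap.proj (R := ℝ) (φ := fun _ : Fin m => Fin d → ℝ) j).comp
    ((ContinuousLinearMap.snd ℝ _ _).comp (ContinuousLinearMap.snd ℝ _ _)))
  exact congrArg (· v) (L.hasFDerivAt (x := x)).fderiv

lemma fderiv_fst {g : (Fin d → ℝ) → ℝ} (hg : Differentiable ℝ g) (x v : Xsp d m) :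
    fderiv ℝ (fun x : Xsp d m => g x.1) x v = fderiv ℝ g x.1 v.1 :=
  congrArg (· v) (((hg x.1).hasFDerivAt.comp x hasFDerivAt_fst).fderiv)

lemma fderiv_E (x v : Xsp d m) : fderiv ℝ D.E x v =
    fderiv ℝ D.V x.1 v.1 + ∑ k, x.2.1 k * v.2.1 k + ∑ j, ∑ k, x.2.2 j k * v.2.2 j k := by
  have hp : ∀ k, HasFDerivAt (fun x : Xsp d m => x.2.1 k) _ x := fun k =>
    ((contDiff_p k).differentiable x).hasFDerivAt
  have hz : ∀ j k, HasFDerivAt (fun x : Xsp d m => x.2.2 j k) _ x := fun j k =>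
    ((contDiff_z j k).differentiable x).hasFDerivAt
  have h1 := (D.isSm_V (m := m) |>.differentiable x).hasFDerivAt
  have h2 := HasFDerivAt.fun_sum (u := Finset.univ) fun k _ => (hp k).pow 2
  have h3 := HasFDerivAt.fun_sum (u := Finset.univ) fun j _ =>
    HasFDerivAt.fun_sum (u := Finset.univ) fun k _ => (hz j k).pow 2
  have := ((h1.fun_add (h2.mul_const 2⁻¹)).fun_add (h3.mul_const 2⁻¹))
  have e : D.E = fun x => D.V x.1 + (∑ i, (x.2.1 i) ^ 2) * 2⁻¹ + (∑ j, ∑ i, (x.2.2 j i) ^ 2) * 2⁻¹ := by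
    ext x; simp only [E]; ring
  rw [e, HasFDerivAt.fderiv this]
  simp only [_root_.add_apply, _root_.smul_apply, _root_.sum_apply, fderiv_p, fderiv_z,
    fderiv_fst (D.hV.differentiable (by simp)), smul_eq_mul, Finset.mul_sum]
  congr 1
  · congr 1; refine Finset.sum_congr rfl fun k _ => by ring
  · refine Finset.sum_congr rfl fun j _ => Finset.sum_congr rfl fun k _ => by ring

/-- The density of `μ`. -/
def ρ (x : Xsp d m) : ℝ := D.Z⁻¹ * gdens d m D.β D.V x

lemma ρ_eq : D.ρ = fun x => D.Z⁻¹ * Real.exp (-D.β * D.E x) := rfl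

lemma ρ_pos (x) : 0 < D.ρ x := mul_pos (inv_pos.2 D.hZ) (Real.exp_pos _)

lemma isSm_ρ : IsSm d m D.ρ := by
  rw [ρ_eq]
  exact ((D.isSm_E.const_mul (-D.β)).comp Real.contDiff_exp).const_mul _

lemma fderiv_ρ (x v) : fderiv ℝ D.ρ x v = -D.β * fderiv ℝ D.E x v * D.ρ x := by
  have h := ((D.isSm_E.differentiable x).hasFDerivAt.const_mul (-D.β)).exp.const_mul D.Z⁻¹
  rw [ρ_eq, h.fderiv]
  simp only [_root_.smul_apply, smul_eq_mul]; ring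

lemma integral_μ (φ : Xsp d m → ℝ) : ∫ x, φ x ∂D.μ = ∫ x, D.ρ x * φ x ∂volX d m := by
  have hm : Measurable fun x => ENNReal.ofReal (D.ρ x) :=
    D.isSm_ρ.continuous.measurable.ennreal_ofReal
  have := integral_withDensity_eq_integral_toReal_smul (μ := volX d m) hm
    (Eventually.of_forall fun x => ENNReal.ofReal_lt_top) φ
  refine this.trans ?_
  refine integral_congr_ae (Eventually.of_forall fun x => ?_)
  simp [ENNReal.toReal_ofReal (D.ρ_pos x).le]

lemma integrable_μ_iff (φ : Xsp d m → ℝ) :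
    Integrable φ D.μ ↔ Integrable (fun x => D.ρ x * φ x) (volX d m) := by
  have hm : Measurable fun x => ENNReal.ofReal (D.ρ x) :=
    D.isSm_ρ.continuous.measurable.ennreal_ofReal
  have := integrable_withDensity_iff_integrable_smul' (μ := volX d m) hm
    (Eventually.of_forall fun x => ENNReal.ofReal_lt_top) (g := φ)
  refine this.trans ?_
  simp [ENNReal.toReal_ofReal (D.ρ_pos _).le]

variable {D}

lemma integrable (h : IsTest d m φ) : Integrable φ D.μ := by
  obtain ⟨C, hC⟩ := h.exists_bound
  exact (integrable_const C).mono' h.isSm.continuous.aestronglyMeasurable (Eventually.of_forall hC)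

lemma fderiv_mul' (h : IsSm d m φ) (h' : IsSm d m ψ) (x v) :
    fderiv ℝ (fun x => φ x * ψ x) x v = φ x * fderiv ℝ ψ x v + ψ x * fderiv ℝ φ x v := by
  rw [fderiv_fun_mul (h.differentiable x) (h'.differentiable x)]
  simp

/-- Integration by parts for the Gibbs measure. -/
lemma integral_fderiv (h : IsTest d m φ) (v : Xsp d m) :
    ∫ x, fderiv ℝ φ x v ∂D.μ = D.β * ∫ x, φ x * fderiv ℝ D.E x v ∂D.μ := by
  have h1 := integral_fderiv_volX (h.mul_left D.isSm_ρ) v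
  have e : ∀ x, fderiv ℝ (fun x => D.ρ x * φ x) x v
      = D.ρ x * fderiv ℝ φ x v - D.ρ x * (D.β * (φ x * fderiv ℝ D.E x v)) := by
    intro x; rw [fderiv_mul' D.isSm_ρ h.isSm, fderiv_ρ]; ring
  simp only [e] at h1
  rw [integral_sub] at h1
  · rw [← integral_μ, ← integral_μ, integral_const_mul] at h1; linarith
  · exact ((h.fderiv_const v).mul_left D.isSm_ρ).integrable_volX
  · exact (((h.mul_right (D.isSm_E.fderiv_const v)).const_mul _).mul_left D.isSm_ρ).integrable_volX

lemma integral_mul_fderiv_of_indep (h : IsTest d m φ) {w : Xsp d m → ℝ} (hw : IsSm d m w) (v : Xsp d m)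
    (h0 : ∀ x, fderiv ℝ w x v = 0) :
    ∫ x, w x * fderiv ℝ φ x v ∂D.μ = D.β * ∫ x, φ x * (w x * fderiv ℝ D.E x v) ∂D.μ := by
  have := integral_fderiv (D := D) (h.mul_left hw) v
  simp only [fderiv_mul' hw h.isSm, h0, mul_zero, add_zero] at this
  rw [this]; congr 1; refine integral_congr_ae (Eventually.of_forall fun x => ?_)
  show _ = _
  ring

variable (D)

/-- The Hamiltonian vector field. -/
def W (x : Xsp d m) : Xsp d m :=
  (x.2.1, fun k => -D.dV k x.1 + ∑ j, D.lam j * x.2.2 j k, fun j => -D.lam j • x.2.1)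

lemma W_smooth : ContDiff ℝ (⊤ : ℕ∞) (D.W (m := m)) := by
  refine ContDiff.prodMk (by fun_prop) (ContDiff.prodMk ?_ ?_)
  · refine contDiff_pi.2 fun k => ContDiff.add ((D.dV_smooth k).comp contDiff_fst).neg ?_
    exact ContDiff.sum fun j _ => by fun_prop
  · refine contDiff_pi.2 fun j => ?_
    exact ContDiff.const_smul (-D.lam j) (show ContDiff ℝ (⊤ : ℕ∞) fun x : Xsp d m => x.2.1 by fun_prop)

lemma W_per (k) (x : Xsp d m) : D.W (x + latv m k) = D.W x := by
  have := fun i => D.dV_per i k x.1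
  simp only [W, latv, Prod.fst_add, Prod.snd_add, add_zero]
  simp only [this]

def ζ (x : Xsp d m) : Xsp d m := (0, 0, fun j => D.α j • x.2.2 j)

lemma ζ_smooth : ContDiff ℝ (⊤ : ℕ∞) (D.ζ (m := m)) := by
  refine ContDiff.prodMk contDiff_const (ContDiff.prodMk contDiff_const ?_)
  refine contDiff_pi.2 fun j => ContDiff.const_smul (D.α j) (show ContDiff ℝ (⊤ : ℕ∞) fun x : Xsp d m => x.2.2 j by fun_prop)

lemma ζ_per (k) (x : Xsp d m) : D.ζ (x + latv m k) = D.ζ x := by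
  simp [ζ, latv]

def a (i : Fin m × Fin d) : ℝ := D.α i.1 / D.β

lemma a_pos (i) : 0 < D.a i := div_pos (D.hα _) D.hβ

def T (φ : Xsp d m → ℝ) (x : Xsp d m) : ℝ := fderiv ℝ φ x (D.W x)

def dz (i : Fin m × Fin d) (φ : Xsp d m → ℝ) (x : Xsp d m) : ℝ := fderiv ℝ φ x (ez i)

def S (φ : Xsp d m → ℝ) (x : Xsp d m) : ℝ := fderiv ℝ φ x (D.ζ x) - ∑ i, D.a i * dz i (dz i φ) x

def Γ (φ ψ : Xsp d m → ℝ) (x : Xsp d m) : ℝ := ∑ i, D.a i * (dz i φ x * dz i ψ x)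

/-- The forward (`σ = 1`) and backward (`σ = -1`) operators. -/
def G (σ : ℝ) (φ : Xsp d m → ℝ) (x : Xsp d m) : ℝ := -σ * D.T φ x + D.S φ x

lemma gen_eq (φ : Xsp d m → ℝ) : gen d m D.β D.α D.lam D.V φ = D.G 1 φ := by
  ext x
  have hz : ∀ j v, fderiv ℝ φ x (zdir d m j v) = ∑ k, v k * fderiv ℝ φ x (ez (j, k)) := by
    intro j v; rw [zdir_eq_sum]; simp
  have h1 := map_eq_sum (fderiv ℝ φ x) (x.2.1, 0, 0)
  have h2 := map_eq_sum (fderiv ℝ φ x) (0, (fun i => fderiv ℝ D.V x.1 (Pi.single i 1)), 0)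
  have h3 := map_eq_sum (fderiv ℝ φ x) (0, ∑ j, D.lam j • x.2.2 j, 0)
  have h4 := map_eq_sum (fderiv ℝ φ x) (D.W x)
  have h5 := map_eq_sum (fderiv ℝ φ x) (D.ζ x)
  simp only [gen, G, T, S, h1, h2, h3, h4, h5, hz]
  simp only [W, ζ, Fintype.sum_prod_type, a, dz, dV]
  simp only [Pi.zero_apply, zero_mul, Finset.sum_const_zero, add_zero, zero_add, Finset.sum_apply,
    Pi.smul_apply, smul_eq_mul, add_mul, neg_mul, Finset.sum_add_distrib, Finset.sum_neg_distrib,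
    Finset.mul_sum, mul_assoc, one_mul, neg_add, neg_neg]
  have : ∀ j k, D.β⁻¹ * (D.α j * fderiv ℝ (pZ d m j k φ) x (zdir d m j (Pi.single k 1)))
      = D.α j / D.β * fderiv ℝ (dz (j, k) φ) x (ez (j, k)) := by
    intro j k; rw [show pZ d m j k φ = dz (j, k) φ from rfl,
      show zdir d m j (Pi.single k 1) = ez (j, k) from rfl]; ring
  simp only [this]
  abel

variable {D}

lemma _root_.IsSm.T (h : IsSm d m φ) : IsSm d m (D.T φ) := h.fderiv D.W_smooth D.W_per
lemma _root_.IsTest.T (h : IsTest d m φ) : IsTest d m (D.T φ) := h.fderiv D.W_smooth D.W_per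
lemma _root_.IsSm.dz (h : IsSm d m φ) (i) : IsSm d m (dz i φ) := h.fderiv_const _
lemma _root_.IsTest.dz (h : IsTest d m φ) (i) : IsTest d m (dz i φ) := h.fderiv_const _
lemma _root_.IsSm.S (h : IsSm d m φ) : IsSm d m (D.S φ) :=
  (h.fderiv D.ζ_smooth D.ζ_per).sub (.sum fun i => ((h.dz i).dz i).const_mul _)
lemma _root_.IsTest.S (h : IsTest d m φ) : IsTest d m (D.S φ) := by
  have := (h.fderiv D.ζ_smooth D.ζ_per).add
    (IsTest.const_mul (.sum (s := Finset.univ) fun i => ((h.dz i).dz i).const_mul (D.a i)) (-1))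
  convert this using 2
  simp only [Gle.S]; ring
lemma _root_.IsSm.G (h : IsSm d m φ) (σ) : IsSm d m (D.G σ φ) := (h.T.const_mul _).add h.S
lemma _root_.IsTest.G (h : IsTest d m φ) (σ) : IsTest d m (D.G σ φ) := (h.T.const_mul _).add h.S
lemma _root_.IsSm.Γ (h : IsSm d m φ) (h' : IsSm d m ψ) : IsSm d m (D.Γ φ ψ) :=
  .sum fun i => ((h.dz i).mul (h'.dz i)).const_mul _
lemma _root_.IsTest.Γ (h : IsTest d m φ) (h' : IsSm d m ψ) : IsTest d m (D.Γ φ ψ) :=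
  .sum fun i => ((h.dz i).mul_right (h'.dz i)).const_mul _

lemma Γ_comm : D.Γ φ ψ = D.Γ ψ φ := by
  ext x; simp only [Γ, mul_comm (dz _ φ x)]

lemma T_mul (h : IsSm d m φ) (h' : IsSm d m ψ) (x) :
    D.T (fun x => φ x * ψ x) x = φ x * D.T ψ x + ψ x * D.T φ x := fderiv_mul' h h' _ _

lemma dz_mul (h : IsSm d m φ) (h' : IsSm d m ψ) (i x) :
    dz i (fun x => φ x * ψ x) x = φ x * dz i ψ x + ψ x * dz i φ x := fderiv_mul' h h' _ _

lemma T_E (x : Xsp d m) : fderiv ℝ D.E x (D.W x) = 0 := by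
  have hV := D.hV
  have e : fderiv ℝ D.V x.1 x.2.1 = ∑ k, x.2.1 k * D.dV k x.1 := by
    conv_lhs => rw [pi_eq_sum_univ' x.2.1]
    simp [dV]
  rw [fderiv_E]
  simp only [W, e, mul_add, Finset.sum_add_distrib, Finset.mul_sum, Pi.smul_apply, smul_eq_mul]
  rw [Finset.sum_comm (f := fun j k => x.2.2 j k * (-D.lam j * x.2.1 k)), ← Finset.sum_add_distrib,
    ← Finset.sum_add_distrib, ← Finset.sum_add_distrib]
  refine Finset.sum_eq_zero fun k _ => ?_
  rw [add_assoc, add_assoc, ← Finset.sum_add_distrib, Finset.sum_eq_zero fun j _ => by ring]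
  ring

lemma integral_add_three {X : Type*} [MeasurableSpace X] {ν : Measure X} {f g h : X → ℝ}
    (hf : Integrable f ν) (hg : Integrable g ν)
    (hh : Integrable h ν) : ∫ x, (f x + g x + h x) ∂ν = ∫ x, f x ∂ν + ∫ x, g x ∂ν + ∫ x, h x ∂ν := by
  rw [integral_add (f := fun x => f x + g x) (hf.add hg) hh, integral_add hf hg]

lemma integral_sum_eq {ι : Type*} [Fintype ι] {c : ℝ} {f g : ι → Xsp d m → ℝ}
    (hf : ∀ i, Integrable (f i) D.μ) (hg : ∀ i, Integrable (g i) D.μ)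
    (h : ∀ i, ∫ x, f i x ∂D.μ = c * ∫ x, g i x ∂D.μ) :
    Integrable (fun x => ∑ i, f i x) D.μ ∧ Integrable (fun x => ∑ i, g i x) D.μ ∧
      ∫ x, ∑ i, f i x ∂D.μ = c * ∫ x, ∑ i, g i x ∂D.μ := by
  refine ⟨integrable_finsetSum _ fun i _ => hf i, integrable_finsetSum _ fun i _ => hg i, ?_⟩
  rw [integral_finsetSum _ fun i _ => hf i, integral_finsetSum _ fun i _ => hg i, Finset.mul_sum]
  exact Finset.sum_congr rfl fun i _ => h i

lemma integral_T (h : IsTest d m φ) : ∫ x, D.T φ x ∂D.μ = 0 := by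
  have hW : ∀ L : Xsp d m → (Xsp d m →L[ℝ] ℝ), ∀ x, L x (D.W x) =
      ∑ k, x.2.1 k * L x (eq k) + ∑ k, (-D.dV k x.1 + ∑ j, D.lam j * x.2.2 j k) * L x (ep k) +
      ∑ i : Fin m × Fin d, (-D.lam i.1 * x.2.1 i.2) * L x (ez i) := fun L x => map_eq_sum (L x) (D.W x)
  have s1 := fun k => contDiff_p (d := d) (m := m) k
  have s2 : ∀ k, IsSm d m fun x => -D.dV k x.1 + ∑ j, D.lam j * x.2.2 j k := fun k => by
    have := ((D.isSm_dV (m := m) k).const_mul (-1)).add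
      (IsSm.sum (s := Finset.univ) fun j => (contDiff_z j k).const_mul (D.lam j))
    simpa using this
  have s3 : ∀ i : Fin m × Fin d, IsSm d m fun x => -D.lam i.1 * x.2.1 i.2 := fun i =>
    (contDiff_p i.2).const_mul _
  have d2 : ∀ k x, fderiv ℝ (fun x : Xsp d m => -D.dV k x.1 + ∑ j, D.lam j * x.2.2 j k) x (ep k) = 0 := by
    intro k x
    have h1 := ((D.isSm_dV (m := m) k).differentiable x).hasFDerivAt
    have h2 := HasFDerivAt.fun_sum (u := Finset.univ) fun j _ =>
      ((contDiff_z (d := d) (m := m) j k).differentiable x).hasFDerivAt.const_mul (D.lam j)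
    rw [HasFDerivAt.fderiv (h1.fun_neg.fun_add h2)]
    simp [fderiv_z, fderiv_fst ((D.dV_smooth k).differentiable (by simp)), ep]
  have d3 : ∀ (i : Fin m × Fin d) x, fderiv ℝ (fun x : Xsp d m => -D.lam i.1 * x.2.1 i.2) x (ez i) = 0 := by
    intro i x
    rw [HasFDerivAt.fderiv ((((contDiff_p (d := d) (m := m) i.2).differentiable x).hasFDerivAt).const_mul (-D.lam i.1))]
    simp [fderiv_p]
  have c1 := fun k => integral_mul_fderiv_of_indep (D := D) h (s1 k) (eq k)
    (fun x => by rw [fderiv_p]; rfl)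
  have c2 := fun k => integral_mul_fderiv_of_indep (D := D) h (s2 k) (ep k) (d2 k)
  have c3 := fun i => integral_mul_fderiv_of_indep (D := D) h (s3 i) (ez i) (d3 i)
  have hE := D.isSm_E (m := m)
  have i1 := fun k => integrable (D := D) ((h.fderiv_const (eq k)).mul_left (s1 k))
  have i2 := fun k => integrable (D := D) ((h.fderiv_const (ep k)).mul_left (s2 k))
  have i3 := fun i => integrable (D := D) ((h.fderiv_const (ez i)).mul_left (s3 i))
  have j1 := fun k => integrable (D := D) (h.mul_right ((s1 k).mul (hE.fderiv_const (eq k))))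
  have j2 := fun k => integrable (D := D) (h.mul_right ((s2 k).mul (hE.fderiv_const (ep k))))
  have j3 := fun i => integrable (D := D) (h.mul_right ((s3 i).mul (hE.fderiv_const (ez i))))
  obtain ⟨p1, q1, e1⟩ := integral_sum_eq i1 j1 c1
  obtain ⟨p2, q2, e2⟩ := integral_sum_eq i2 j2 c2
  obtain ⟨p3, q3, e3⟩ := integral_sum_eq i3 j3 c3
  have A : ∀ x, φ x * fderiv ℝ D.E x (D.W x) = 0 := by simp [T_E]
  simp only [hW (fun x => fderiv ℝ D.E x), mul_add, Finset.mul_sum] at A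
  have B := congrArg (fun f : Xsp d m → ℝ => ∫ x, f x ∂D.μ) (funext A)
  simp only [T, hW (fun x => fderiv ℝ φ x)]
  beta_reduce at B
  rw [integral_add_three q1 q2 q3, integral_zero] at B
  rw [integral_add_three p1 p2 p3, e1, e2, e3, ← mul_add, ← mul_add, B, mul_zero]

lemma fderiv_E_ez (i : Fin m × Fin d) (x : Xsp d m) : fderiv ℝ D.E x (ez i) = x.2.2 i.1 i.2 := by
  rw [fderiv_E]
  simp only [ez_fst, ez_snd_fst, ez_apply]
  rw [← Fintype.sum_prod_type' (f := fun j k => x.2.2 j k * if i = (j, k) then (1 : ℝ) else 0)]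
  simp

lemma fderiv_ζ (φ : Xsp d m → ℝ) (x) :
    fderiv ℝ φ x (D.ζ x) = ∑ i : Fin m × Fin d, D.β * D.a i * (x.2.2 i.1 i.2 * dz i φ x) := by
  rw [map_eq_sum]
  simp only [ζ, Pi.zero_apply, zero_mul, Finset.sum_const_zero, zero_add, a, dz, Pi.smul_apply, smul_eq_mul]
  refine Finset.sum_congr rfl fun i _ => ?_
  have := D.hβ.ne'
  field_simp

/-- Integration by parts in `z`. -/
lemma integral_dz (h : IsTest d m φ) (i) :
    ∫ x, dz i φ x ∂D.μ = D.β * ∫ x, φ x * x.2.2 i.1 i.2 ∂D.μ := by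
  simp only [dz, integral_fderiv h, fderiv_E_ez]

lemma integral_mul_S (h : IsSm d m φ) (h' : IsSm d m ψ) (ht : IsTest d m φ ∨ IsTest d m ψ) :
    ∫ x, φ x * D.S ψ x ∂D.μ = ∫ x, D.Γ φ ψ x ∂D.μ := by
  have t1 : ∀ i, IsTest d m fun x => φ x * dz i ψ x := fun i => by
    rcases ht with ht | ht
    · exact ht.mul_right (h'.dz i)
    · exact (ht.dz i).mul_left h
  have t2 : ∀ i, IsTest d m fun x => φ x * dz i (dz i ψ) x := fun i => by
    rcases ht with ht | ht
    · exact ht.mul_right ((h'.dz i).dz i)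
    · exact ((ht.dz i).dz i).mul_left h
  have t3 : ∀ i, IsTest d m fun x => dz i ψ x * dz i φ x := fun i => by
    rcases ht with ht | ht
    · exact (ht.dz i).mul_left (h'.dz i)
    · exact (ht.dz i).mul_right (h.dz i)
  have t4 : ∀ i : Fin m × Fin d, IsTest d m fun x => φ x * dz i ψ x * x.2.2 i.1 i.2 := fun i =>
    (t1 i).mul_right (contDiff_z i.1 i.2)
  have key : ∀ i : Fin m × Fin d, ∫ x, D.a i * (D.β * (φ x * dz i ψ x * x.2.2 i.1 i.2) - φ x * dz i (dz i ψ) x) ∂D.μ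
      = ∫ x, D.a i * (dz i φ x * dz i ψ x) ∂D.μ := by
    intro i
    have := integral_dz (D := D) (t1 i) i
    simp only [dz_mul h (h'.dz i)] at this
    rw [integral_add (integrable (t2 i)) (integrable (t3 i))] at this
    rw [integral_const_mul, integral_const_mul, integral_sub ((integrable (t4 i)).const_mul _) (integrable (t2 i)),
      integral_const_mul]
    simp only [mul_comm (dz i φ _)]
    congr 1; linarith
  have e : ∀ x, φ x * D.S ψ x = ∑ i : Fin m × Fin d, D.a i * (D.β * (φ x * dz i ψ x * x.2.2 i.1 i.2) - φ x * dz i (dz i ψ) x) := by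
    intro x
    rw [S, fderiv_ζ, ← Finset.sum_sub_distrib, Finset.mul_sum]
    exact Finset.sum_congr rfl fun i _ => by ring
  simp only [e, Γ]
  rw [integral_finsetSum, integral_finsetSum]
  · exact Finset.sum_congr rfl fun i _ => key i
  · intro i _
    have := integrable (D := D) ((t3 i).const_mul (D.a i))
    simpa only [mul_comm (dz i ψ _)] using this
  · intro i _
    exact (((integrable (t4 i)).const_mul _).sub (integrable (t2 i))).const_mul _

lemma integral_mul_T (h : IsSm d m φ) (h' : IsSm d m ψ) (ht : IsTest d m φ ∨ IsTest d m ψ) :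
    ∫ x, φ x * D.T ψ x ∂D.μ = - ∫ x, ψ x * D.T φ x ∂D.μ := by
  have t1 : IsTest d m fun x => φ x * ψ x := by
    rcases ht with ht | ht
    · exact ht.mul_right h'
    · exact ht.mul_left h
  have t2 : IsTest d m fun x => φ x * D.T ψ x := by
    rcases ht with ht | ht
    · exact ht.mul_right h'.T
    · exact ht.T.mul_left h
  have t3 : IsTest d m fun x => ψ x * D.T φ x := by
    rcases ht with ht | ht
    · exact ht.T.mul_left h'
    · exact ht.mul_right h.T
  have := integral_T (D := D) t1
  simp only [T_mul h h'] at this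
  rw [integral_add (integrable t2) (integrable t3)] at this
  linarith

lemma integral_mul_G (h : IsSm d m φ) (h' : IsSm d m ψ) (ht : IsTest d m φ ∨ IsTest d m ψ) (σ : ℝ) :
    ∫ x, φ x * D.G σ ψ x ∂D.μ = ∫ x, ψ x * D.G (-σ) φ x ∂D.μ := by
  have aux : ∀ {φ ψ : Xsp d m → ℝ}, IsSm d m φ → IsSm d m ψ → IsTest d m φ ∨ IsTest d m ψ → ∀ σ : ℝ,
      ∫ x, φ x * D.G σ ψ x ∂D.μ = -σ * ∫ x, φ x * D.T ψ x ∂D.μ + ∫ x, φ x * D.S ψ x ∂D.μ := by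
    intro φ ψ h h' ht σ
    rw [← integral_const_mul, ← integral_add]
    · refine integral_congr_ae (Eventually.of_forall fun x => ?_)
      simp only [G]; ring
    · refine (integrable ?_).const_mul _
      rcases ht with ht | ht
      · exact ht.mul_right h'.T
      · exact ht.T.mul_left h
    · refine integrable ?_
      rcases ht with ht | ht
      · exact ht.mul_right h'.S
      · exact ht.S.mul_left h
  rw [aux h h' ht, aux h' h ht.symm, integral_mul_S h h' ht, integral_mul_S h' h ht.symm,
    integral_mul_T h h' ht, Γ_comm]
  ring

/-- The energy identity. -/
lemma integral_mul_G_self (h : IsTest d m φ) (σ : ℝ) :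
    ∫ x, φ x * D.G σ φ x ∂D.μ = ∫ x, D.Γ φ φ x ∂D.μ := by
  rw [← integral_mul_S h.isSm h.isSm (.inl h)]
  have h0 := integral_mul_T (D := D) h.isSm h.isSm (.inl h)
  have e : ∀ x, φ x * D.G σ φ x = -σ * (φ x * D.T φ x) + φ x * D.S φ x := fun x => by
    simp only [G]; ring
  simp only [e]
  rw [integral_add ((integrable (h.mul_right h.isSm.T)).const_mul _) (integrable (h.mul_right h.isSm.S)),
    integral_const_mul, show ∫ x, φ x * D.T φ x ∂D.μ = 0 by linarith]
  simp

lemma Γ_nonneg (x) : 0 ≤ D.Γ φ φ x :=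
  Finset.sum_nonneg fun i _ => mul_nonneg (D.a_pos i).le (mul_self_nonneg _)

end Gle

end Generator

section Estimates

open scoped ContDiff

namespace Gle

variable {d m : ℕ} {D : Gle d m} {φ ψ u : Xsp d m → ℝ}

section Cutoff

/-- A smooth step, equal to `1` on `(-∞, 1]` and to `0` on `[2, ∞)`. -/
def step (t : ℝ) : ℝ := Real.smoothTransition (2 - t)

lemma step_smooth : ContDiff ℝ (⊤ : ℕ∞) step :=
  Real.smoothTransition.contDiff.comp (contDiff_const.sub contDiff_id)

lemma step_nonneg (t) : 0 ≤ step t := Real.smoothTransition.nonneg _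
lemma step_le_one (t) : step t ≤ 1 := Real.smoothTransition.le_one _
lemma step_eq_one {t : ℝ} (h : t ≤ 1) : step t = 1 := Real.smoothTransition.one_of_one_le (by linarith)
lemma step_eq_zero {t : ℝ} (h : 2 ≤ t) : step t = 0 := Real.smoothTransition.zero_of_nonpos (by linarith)

lemma deriv_step_smooth : ContDiff ℝ (⊤ : ℕ∞) (deriv step) := by
  exact ((contDiff_succ_iff_deriv (n := (⊤ : ℕ∞))).1 (by simpa using step_smooth)).2.2

lemma deriv_step_eq_zero {t : ℝ} (h : t < 1 ∨ 2 < t) : deriv step t = 0 := by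
  rcases h with h | h
  · have : step =ᶠ[nhds t] fun _ => 1 := by
      filter_upwards [Iio_mem_nhds h] with s hs using step_eq_one (le_of_lt hs)
    rw [this.deriv_eq]; simp
  · have : step =ᶠ[nhds t] fun _ => 0 := by
      filter_upwards [Ioi_mem_nhds h] with s hs using step_eq_zero (le_of_lt hs)
    rw [this.deriv_eq]; simp

lemma deriv2_step_eq_zero {t : ℝ} (h : t < 1 ∨ 2 < t) : deriv (deriv step) t = 0 := by
  rcases h with h | h
  · have : deriv step =ᶠ[nhds t] fun _ => 0 := by
      filter_upwards [Iio_mem_nhds h] with s hs using deriv_step_eq_zero (.inl hs)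
    rw [this.deriv_eq]; simp
  · have : deriv step =ᶠ[nhds t] fun _ => 0 := by
      filter_upwards [Ioi_mem_nhds h] with s hs using deriv_step_eq_zero (.inr hs)
    rw [this.deriv_eq]; simp

lemma exists_bound_step : ∃ C, 0 ≤ C ∧ ∀ t, |deriv step t| ≤ C ∧ |deriv (deriv step) t| ≤ C := by
  have aux : ∀ f : ℝ → ℝ, Continuous f → (∀ t, t < 1 ∨ 2 < t → f t = 0) → ∃ C, 0 ≤ C ∧ ∀ t, |f t| ≤ C := by
    intro f hf h0
    obtain ⟨C, hC⟩ := (isCompact_Icc (a := (1 : ℝ)) (b := 2)).exists_bound_of_continuousOn hf.continuousOn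
    refine ⟨max C 0, le_max_right _ _, fun t => ?_⟩
    by_cases ht : t ∈ Set.Icc (1 : ℝ) 2
    · exact (hC t ht).trans (le_max_left _ _)
    · rw [h0 t, abs_zero]
      · exact le_max_right _ _
      · by_contra! h; exact ht h
  have h2 : Continuous (deriv (deriv step)) :=
    (deriv_step_smooth).continuous_deriv (by exact_mod_cast le_top)
  obtain ⟨C, hC0, hC⟩ := aux _ deriv_step_smooth.continuous fun t => deriv_step_eq_zero
  obtain ⟨C', hC0', hC'⟩ := aux _ h2 fun t => deriv2_step_eq_zero
  exact ⟨max C C', hC0.trans (le_max_left _ _), fun t => ⟨(hC t).trans (le_max_left _ _), (hC' t).trans (le_max_right _ _)⟩⟩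

/-- The squared size of the noncompact variables. -/
def sz (x : Xsp d m) : ℝ := ∑ i, (x.2.1 i) ^ 2 + ∑ j, ∑ i, (x.2.2 j i) ^ 2

lemma p_sq_le_sz (x : Xsp d m) (k) : (x.2.1 k) ^ 2 ≤ sz x := by
  have h1 := Finset.single_le_sum (f := fun i => (x.2.1 i) ^ 2) (fun i _ => sq_nonneg _) (Finset.mem_univ k)
  have h2 : 0 ≤ ∑ j, ∑ i, (x.2.2 j i) ^ 2 := by positivity
  simp only [sz]; linarith

lemma z_sq_le_sz (x : Xsp d m) (j k) : (x.2.2 j k) ^ 2 ≤ sz x := by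
  have h1 := Finset.single_le_sum (f := fun i => (x.2.2 j i) ^ 2) (fun i _ => sq_nonneg _) (Finset.mem_univ k)
  have h2 := Finset.single_le_sum (f := fun j => ∑ i, (x.2.2 j i) ^ 2) (fun i _ => by positivity) (Finset.mem_univ j)
  have h3 : 0 ≤ ∑ i, (x.2.1 i) ^ 2 := by positivity
  simp only [sz]; beta_reduce at h1 h2; linarith

lemma sz_nonneg (x : Xsp d m) : 0 ≤ sz x := by unfold sz; positivity

lemma norm_snd_le (x : Xsp d m) : ‖x.2‖ ≤ √(sz x) := by
  have h0 := Real.sqrt_nonneg (sz x)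
  refine max_le ((pi_norm_le_iff_of_nonneg h0).2 fun k => ?_)
    ((pi_norm_le_iff_of_nonneg h0).2 fun j => (pi_norm_le_iff_of_nonneg h0).2 fun k => ?_)
  · exact Real.abs_le_sqrt (p_sq_le_sz x k)
  · exact Real.abs_le_sqrt (z_sq_le_sz x j k)

lemma _root_.PerV.exists_bound {g : (Fin d → ℝ) → ℝ} (hg : Continuous g) (h : PerV d g) :
    ∃ C, 0 ≤ C ∧ ∀ q, |g q| ≤ C := by
  obtain ⟨C, hC⟩ := (isCompact_Icc (a := (0 : Fin d → ℝ)) (b := 1)).exists_bound_of_continuousOn hg.continuousOn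
  refine ⟨max C 0, le_max_right _ _, fun q => ?_⟩
  have := h (fun i => -⌊q i⌋) q
  rw [← this]
  refine (hC _ (cube_subset_Icc fun i => ?_)).trans (le_max_left _ _)
  simp only [Pi.add_apply, Int.cast_neg, ← sub_eq_add_neg]
  exact ⟨Int.fract_nonneg _, Int.fract_lt_one _⟩

lemma E_eq (x : Xsp d m) : D.E x = D.V x.1 + sz x / 2 := by simp only [E, sz]; ring

variable (D) in
lemma exists_bound_E : ∃ B, 0 ≤ B ∧ ∀ x : Xsp d m, sz x ≤ 2 * (D.E x + B) ∧ D.E x ≤ B + sz x / 2 := by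
  obtain ⟨B, hB, h⟩ := D.hVper.exists_bound D.hV.continuous
  refine ⟨B, hB, fun x => ?_⟩
  have := abs_le.1 (h x.1)
  rw [E_eq]; constructor <;> linarith

variable (D) in
/-- The energy cutoff. -/
def χ (R : ℝ) (x : Xsp d m) : ℝ := step (R⁻¹ * D.E x)

lemma isTest_χ {R : ℝ} (hR : 0 < R) : IsTest d m (D.χ R) := by
  have h := (D.isSm_E (m := m) |>.const_mul R⁻¹).comp step_smooth
  obtain ⟨B, hB, hE⟩ := D.exists_bound_E
  refine ⟨h.1, h.2, Metric.closedBall 0 (√(2 * (2 * R + B))), isCompact_closedBall _ _, fun x hx => ?_⟩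
  refine step_eq_zero ?_
  by_contra! hlt
  refine hx ?_
  rw [mem_closedBall_zero_iff]
  refine (norm_snd_le x).trans (Real.sqrt_le_sqrt ?_)
  have : D.E x ≤ 2 * R := by
    rw [inv_mul_lt_iff₀ hR] at hlt; linarith
  linarith [(hE x).1]

lemma χ_eq_one {R : ℝ} (hR : 0 < R) {x : Xsp d m} (h : D.E x ≤ R) : D.χ R x = 1 :=
  step_eq_one (by rw [inv_mul_le_iff₀ hR]; linarith)

lemma χ_eq_zero {R : ℝ} (hR : 0 < R) {x : Xsp d m} (h : 2 * R ≤ D.E x) : D.χ R x = 0 :=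
  step_eq_zero (by rw [le_inv_mul_iff₀ hR]; linarith)

lemma fderiv_scalar {η : ℝ → ℝ} (hη : Differentiable ℝ η) (R : ℝ) (x v : Xsp d m) :
    fderiv ℝ (fun x => η (R⁻¹ * D.E x)) x v = deriv η (R⁻¹ * D.E x) * (R⁻¹ * fderiv ℝ D.E x v) := by
  have h1 := ((D.isSm_E (m := m) |>.differentiable x).hasFDerivAt).const_mul R⁻¹
  have h2 := (hη (R⁻¹ * D.E x)).hasDerivAt.comp_hasFDerivAt x h1
  rw [show (fun x => η (R⁻¹ * D.E x)) = η ∘ (fun x => R⁻¹ * D.E x) from rfl, h2.fderiv]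
  simp

lemma T_χ (R : ℝ) (x : Xsp d m) : D.T (D.χ R) x = 0 := by
  unfold χ T
  rw [fderiv_scalar (step_smooth.differentiable (by simp)), T_E]; simp

lemma dz_χ (R : ℝ) (i) : dz i (D.χ R) = fun x : Xsp d m => deriv step (R⁻¹ * D.E x) * (R⁻¹ * x.2.2 i.1 i.2) := by
  ext x; unfold χ dz
  rw [fderiv_scalar (step_smooth.differentiable (by simp)), fderiv_E_ez]

lemma dz_dz_χ (R : ℝ) (i) (x : Xsp d m) : dz i (dz i (D.χ R)) x =
    deriv step (R⁻¹ * D.E x) * R⁻¹ + deriv (deriv step) (R⁻¹ * D.E x) * (R⁻¹ * x.2.2 i.1 i.2) ^ 2 := by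
  rw [dz_χ, dz_mul ((D.isSm_E.const_mul R⁻¹).comp deriv_step_smooth) ((contDiff_z i.1 i.2).const_mul _)]
  unfold dz
  rw [fderiv_scalar (deriv_step_smooth.differentiable (by simp)), fderiv_E_ez,
    fderiv_mul' (.const _) (contDiff_z i.1 i.2), fderiv_z, ez_apply]
  simp; ring

variable (D) in
lemma exists_bound_χ : ∃ C, 0 ≤ C ∧ ∀ R : ℝ, 1 ≤ R → ∀ x : Xsp d m,
    D.Γ (D.χ R) (D.χ R) x ≤ C / R ∧ |D.S (D.χ R) x| ≤ C := by
  obtain ⟨C, hC, hs⟩ := exists_bound_step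
  obtain ⟨B, hB, hE⟩ := D.exists_bound_E
  set M := 2 * (2 + B)
  have hM : 0 ≤ M := by positivity
  have ha : ∀ i, 0 ≤ D.a i := fun i => (D.a_pos i).le
  have hβ := D.hβ
  have n1 : 0 ≤ ∑ i, D.a i * (C ^ 2 * M) :=
    Finset.sum_nonneg fun i _ => mul_nonneg (ha i) (by positivity)
  have n2 : 0 ≤ ∑ i, D.β * D.a i * (C * M) :=
    Finset.sum_nonneg fun i _ => mul_nonneg (mul_nonneg hβ.le (ha i)) (by positivity)
  have n3 : 0 ≤ ∑ i, D.a i * (C + C * M) :=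
    Finset.sum_nonneg fun i _ => mul_nonneg (ha i) (by positivity)
  refine ⟨∑ i, D.a i * (C ^ 2 * M) + (∑ i, D.β * D.a i * (C * M) + ∑ i, D.a i * (C + C * M)),
    add_nonneg n1 (add_nonneg n2 n3), fun R hR x => ?_⟩
  have hR0 : 0 < R := by linarith
  have hRi : R⁻¹ ≤ 1 := inv_le_one_of_one_le₀ hR
  have hRp : 0 < R⁻¹ := inv_pos.2 hR0
  set t := R⁻¹ * D.E x
  -- on the support of the derivatives, `z ^ 2 ≤ M R`
  have key : ∀ f : ℝ → ℝ, (∀ t, |f t| ≤ C) → (∀ t, 2 < t → f t = 0) → ∀ i : Fin m × Fin d,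
      |f t| * (R⁻¹ * (x.2.2 i.1 i.2) ^ 2) ≤ C * M := by
    intro f hf h0 i
    by_cases ht : 2 < t
    · rw [h0 t ht]; simp; positivity
    · refine mul_le_mul (hf t) ?_ (by positivity) hC
      rw [inv_mul_le_iff₀ hR0]
      have h1 := z_sq_le_sz x i.1 i.2
      have h2 : D.E x ≤ 2 * R := by
        rw [not_lt, inv_mul_le_iff₀ hR0] at ht; linarith
      have h3 := (hE x).1
      nlinarith
  have k1 := key (deriv step) (fun t => (hs t).1) (fun t ht => deriv_step_eq_zero (.inr ht))
  have k2 := key (deriv (deriv step)) (fun t => (hs t).2) (fun t ht => deriv2_step_eq_zero (.inr ht))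
  constructor
  · have : D.Γ (D.χ R) (D.χ R) x ≤ ∑ i, D.a i * (C ^ 2 * M) / R := by
      refine Finset.sum_le_sum fun i _ => ?_
      rw [mul_div_assoc]
      refine mul_le_mul_of_nonneg_left ?_ (ha i)
      simp only [dz_χ]
      rw [div_eq_mul_inv]
      have e : deriv step t * (R⁻¹ * x.2.2 i.1 i.2) * (deriv step t * (R⁻¹ * x.2.2 i.1 i.2)) =
        |deriv step t| * (|deriv step t| * (R⁻¹ * (x.2.2 i.1 i.2) ^ 2)) * R⁻¹ := by
        rw [← mul_assoc |_|, abs_mul_abs_self]; ring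
      rw [e]
      refine mul_le_mul_of_nonneg_right ?_ hRp.le
      calc _ ≤ C * (C * M) := mul_le_mul (hs t).1 (k1 i) (by positivity) hC
        _ = _ := by ring
    refine this.trans ?_
    rw [← Finset.sum_div]
    gcongr
    exact le_add_of_nonneg_right (add_nonneg n2 n3)
  · have h1 : |fderiv ℝ (D.χ R) x (D.ζ x)| ≤ ∑ i, D.β * D.a i * (C * M) := by
      rw [fderiv_ζ]
      refine (Finset.abs_sum_le_sum_abs _ _).trans (Finset.sum_le_sum fun i _ => ?_)
      rw [abs_mul, abs_of_nonneg (mul_nonneg hβ.le (ha i))]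
      refine mul_le_mul_of_nonneg_left ?_ (mul_nonneg hβ.le (ha i))
      refine le_trans (le_of_eq ?_) (k1 i)
      rw [dz_χ, show x.2.2 i.1 i.2 * (deriv step (R⁻¹ * D.E x) * (R⁻¹ * x.2.2 i.1 i.2)) =
        deriv step t * (R⁻¹ * x.2.2 i.1 i.2 ^ 2) by ring, abs_mul, abs_of_nonneg (a := R⁻¹ * _) (by positivity)]
    have h2 : |∑ i, D.a i * dz i (dz i (D.χ R)) x| ≤ ∑ i, D.a i * (C + C * M) := by
      refine (Finset.abs_sum_le_sum_abs _ _).trans (Finset.sum_le_sum fun i _ => ?_)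
      rw [abs_mul, abs_of_nonneg (ha i)]
      refine mul_le_mul_of_nonneg_left ?_ (ha i)
      rw [dz_dz_χ]
      refine (abs_add_le _ _).trans (add_le_add ?_ ?_)
      · rw [abs_mul, abs_of_pos hRp]
        calc _ ≤ C * 1 := mul_le_mul (hs t).1 hRi hRp.le hC
          _ = C := mul_one C
      · refine le_trans ?_ (k2 i)
        rw [abs_mul]
        refine mul_le_mul_of_nonneg_left ?_ (abs_nonneg _)
        rw [abs_of_nonneg (sq_nonneg _), mul_pow, pow_two R⁻¹]
        refine mul_le_mul_of_nonneg_right ?_ (sq_nonneg _)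
        nlinarith
    unfold S
    linarith [abs_sub (fderiv ℝ (D.χ R) x (D.ζ x)) (∑ i, D.a i * dz i (dz i (D.χ R)) x)]

end Cutoff

lemma _root_.PerQ.ae_volume {F : Xsp d m → ℝ} (hF : PerQ d m F) (h : F =ᵐ[volX d m] 0) :
    F =ᵐ[volume] 0 := by
  have hm : MeasurableSet {x : Xsp d m | x.1 ∈ cube d} := measurable_fst measurableSet_cube
  rw [volX, EventuallyEq, ae_restrict_iff' hm] at h
  have h2 : ∀ k : Fin d → ℤ, ∀ᵐ x : Xsp d m, x + latv m k ∈ {x : Xsp d m | x.1 ∈ cube d} →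
      F (x + latv m k) = 0 := fun k =>
    (measurePreserving_add_right (volume : Measure (Xsp d m)) (latv m k)).quasiMeasurePreserving.ae h
  filter_upwards [ae_all_iff.2 h2] with x hx
  have := hx (fun i => -⌊x.1 i⌋)
  rw [hF.add_latv] at this
  refine this ?_
  rw [← fractX_eq]; exact fractX_mem x

lemma ae_μ_iff {p : Xsp d m → Prop} : (∀ᵐ x ∂D.μ, p x) ↔ ∀ᵐ x ∂volX d m, p x := by
  have hm : Measurable fun x => ENNReal.ofReal (D.ρ x) :=
    D.isSm_ρ.continuous.measurable.ennreal_ofReal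
  refine (ae_withDensity_iff hm).trans ?_
  simp [D.ρ_pos]

lemma eq_zero_of_ae_μ {F : Xsp d m → ℝ} (hF : IsSm d m F) (h : F =ᵐ[D.μ] 0) : F = 0 :=
  Continuous.ae_eq_iff_eq (volume : Measure (Xsp d m)) hF.continuous continuous_const |>.1
    (hF.2.ae_volume (ae_μ_iff.1 h))

section Rigidity

lemma apply_add_of_fderiv_eq_zero {E : Type*} [NormedAddCommGroup E] [NormedSpace ℝ E] {u : E → ℝ}
    (h : Differentiable ℝ u) {v : E} (h0 : ∀ x, fderiv ℝ u x v = 0) (x) : u (x + v) = u x := by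
  have hd : ∀ t : ℝ, HasDerivAt (fun t : ℝ => u (x + t • v)) 0 t := by
    intro t
    have h2 : HasDerivAt (fun t : ℝ => x + t • v) v t := by
      simpa using ((hasDerivAt_id t).smul_const v).const_add x
    have := (h (x + t • v)).hasFDerivAt.comp_hasDerivAt t h2
    rw [h0] at this; exact this
  have := is_const_of_deriv_eq_zero (fun t => (hd t).differentiableAt) (fun t => (hd t).deriv) 1 0
  simpa using this

lemma fderiv_add_of_fderiv_eq_zero {E : Type*} [NormedAddCommGroup E] [NormedSpace ℝ E] {u : E → ℝ}
    (h : Differentiable ℝ u) {v : E} (h0 : ∀ x, fderiv ℝ u x v = 0) (x) :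
    fderiv ℝ u (x + v) = fderiv ℝ u x := by
  rw [← fderiv_comp_add_right]
  congr 1; ext y; exact apply_add_of_fderiv_eq_zero h h0 y

lemma const_of_dz_T (h : Differentiable ℝ u) (hz : ∀ i x, dz i u x = 0) (hT : ∀ x, D.T u x = 0) :
    ∀ x, u x = u 0 := by
  have hlam := (D.hlam D.j0).ne'
  have hp : ∀ k x, fderiv ℝ u x (ep k) = 0 := by
    intro k x
    have h1 := hT (x + ez (D.j0, k))
    have h2 := hT x
    simp only [T] at h1 h2
    rw [fderiv_add_of_fderiv_eq_zero h (hz _)] at h1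
    have e : D.W (x + ez (D.j0, k)) = D.W x + D.lam D.j0 • ep k := by
      refine Prod.ext ?_ (Prod.ext ?_ ?_)
      · simp [W, ep]
      · ext k'
        simp only [W, Prod.fst_add, Prod.snd_add, ez_fst, Pi.add_apply, ez_apply, ep, mul_add,
          Finset.sum_add_distrib, add_zero, Prod.smul_fst, Prod.smul_snd, Pi.smul_apply]
        by_cases hk : k = k'
        · subst hk; simp [add_assoc]
        · simp [hk, Ne.symm hk]
      · ext j k'; simp [W, ep]
    rw [e, map_add, h2, map_smul, zero_add] at h1
    simpa [hlam] using h1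
  have hq : ∀ k x, fderiv ℝ u x (eq k) = 0 := by
    intro k x
    have h1 := hT (x + ep k)
    have h2 := hT x
    simp only [T] at h1 h2
    rw [fderiv_add_of_fderiv_eq_zero h (hp _)] at h1
    have e : D.W (x + ep k) = D.W x + (eq k + ∑ i : Fin m × Fin d, (-D.lam i.1 * if i.2 = k then 1 else 0) • ez i) := by
      refine Prod.ext ?_ (Prod.ext ?_ ?_)
      · simp [W, ep, eq, Prod.fst_sum, -mul_ite, -neg_mul]
      · ext k'; simp [W, ep, eq, Prod.fst_sum, Prod.snd_sum, -mul_ite, -neg_mul]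
      · ext j k'
        simp [W, ep, eq, Prod.snd_sum, ez_apply, Pi.single_apply, -mul_ite, -ite_mul,
          -neg_mul, Fintype.sum_prod_type, ite_and]
        rw [Finset.sum_eq_single j (fun b _ hb => by simp [hb]) (by simp),
          Finset.sum_eq_single k' (fun b _ hb => by simp [hb]) (by simp)]
        simp only [ite_true, mul_one]
        split_ifs <;> simp
    have hz' : ∀ i, fderiv ℝ u x (ez i) = 0 := fun i => hz i x
    rw [e, map_add, h2, map_add, map_sum, zero_add] at h1
    simpa [hz', -mul_ite, -neg_mul] using h1
  have h0 : ∀ x, fderiv ℝ u x = 0 := by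
    intro x; refine ContinuousLinearMap.ext fun v => ?_
    have hz' : ∀ i, fderiv ℝ u x (ez i) = 0 := fun i => hz i x
    rw [map_eq_sum]; simp [hz', hp, hq]
  exact fun x => is_const_of_fderiv_eq_zero h h0 x 0

end Rigidity

lemma T_const_mul_sq (h : IsSm d m u) (R : ℝ) (hR : 0 < R) :
    ∫ x, (D.χ R x ^ 2 * u x) * D.T u x ∂D.μ = 0 := by
  have hχ := isTest_χ (D := D) hR
  have h1 := integral_T (D := D) ((hχ.sq.mul_right h).mul_right h)
  have e : ∀ x, D.T (fun x => D.χ R x ^ 2 * u x * u x) x = 2 * (D.χ R x ^ 2 * u x * D.T u x) := by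
    intro x
    rw [T_mul (hχ.sq.mul_right h).isSm h, T_mul hχ.sq.isSm h]
    have : D.T (fun x => D.χ R x ^ 2) x = 0 := by
      simp only [pow_two]; rw [T_mul hχ.isSm hχ.isSm, T_χ]; simp
    rw [this]; ring
  simp only [e, integral_const_mul] at h1
  linarith

/-- The Caccioppoli inequality. -/
lemma integral_sq_mul_Γ_le (h : IsSm d m u) {σ : ℝ} (hG : ∀ x, D.G σ u x = 0) {R : ℝ} (hR : 0 < R) :
    ∫ x, D.χ R x ^ 2 * D.Γ u u x ∂D.μ ≤ 4 * ∫ x, u x ^ 2 * D.Γ (D.χ R) (D.χ R) x ∂D.μ := by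
  have hχ := isTest_χ (D := D) hR
  have ht := hχ.sq.mul_right h
  have h1 := integral_mul_S (D := D) ht.isSm h (.inl ht)
  have h2 : ∫ x, (D.χ R x ^ 2 * u x) * D.S u x ∂D.μ = 0 := by
    have e : ∀ x, (D.χ R x ^ 2 * u x) * D.S u x = σ * ((D.χ R x ^ 2 * u x) * D.T u x) := by
      intro x
      have := hG x
      rw [G] at this
      rw [show D.S u x = σ * D.T u x by linarith]; ring
    simp only [e, integral_const_mul, T_const_mul_sq h R hR, mul_zero]
  have e : ∀ x, D.Γ (fun x => D.χ R x ^ 2 * u x) u x =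
      D.χ R x ^ 2 * D.Γ u u x + 2 * D.χ R x * u x * D.Γ (D.χ R) u x := by
    intro x
    have e1 : ∀ i, dz i (fun x => D.χ R x ^ 2 * u x) x =
        D.χ R x ^ 2 * dz i u x + u x * (2 * D.χ R x * dz i (D.χ R) x) := by
      intro i
      rw [dz_mul hχ.sq.isSm h]
      congr 2
      simp only [pow_two]; rw [dz_mul hχ.isSm hχ.isSm]; ring
    simp only [Γ, e1, Finset.mul_sum, ← Finset.sum_add_distrib]
    exact Finset.sum_congr rfl fun i _ => by ring
  have pt : ∀ x, D.χ R x ^ 2 * D.Γ u u x - 4 * (u x ^ 2 * D.Γ (D.χ R) (D.χ R) x) ≤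
      2 * D.Γ (fun x => D.χ R x ^ 2 * u x) u x := by
    intro x
    rw [e]
    have : 0 ≤ ∑ i, D.a i * (D.χ R x * dz i u x + 2 * u x * dz i (D.χ R) x) ^ 2 :=
      Finset.sum_nonneg fun i _ => mul_nonneg (D.a_pos i).le (sq_nonneg _)
    have e2 : ∑ i, D.a i * (D.χ R x * dz i u x + 2 * u x * dz i (D.χ R) x) ^ 2 =
        D.χ R x ^ 2 * D.Γ u u x + 4 * (D.χ R x * u x * D.Γ (D.χ R) u x) +
          4 * (u x ^ 2 * D.Γ (D.χ R) (D.χ R) x) := by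
      simp only [Γ, Finset.mul_sum, ← Finset.sum_add_distrib]
      exact Finset.sum_congr rfl fun i _ => by ring
    rw [e2] at this; linarith
  have i1 := integrable (D := D) (hχ.sq.mul_right (h.Γ (D := D) h))
  have i2 := integrable (D := D) ((hχ.Γ (D := D) hχ.isSm).mul_left h.sq)
  have := integral_mono (i1.sub (i2.const_mul 4)) ((integrable (ht.Γ (D := D) h)).const_mul 2) pt
  rw [integral_const_mul, ← h1, h2] at this
  simp only [Pi.sub_apply] at this
  rw [integral_sub i1 (i2.const_mul 4), integral_const_mul] at this
  linarith

/-- Square integrable solutions of the homogeneous equation are constant. -/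
theorem const_of_G_eq_zero (h : IsSm d m u) (hu : Integrable (fun x => u x ^ 2) D.μ) {σ : ℝ} (hσ : σ ≠ 0)
    (hG : ∀ x, D.G σ u x = 0) : ∀ x, u x = u 0 := by
  obtain ⟨C, hC, hb⟩ := D.exists_bound_χ
  have main : ∀ R0 : ℝ, 1 ≤ R0 → (fun x => D.χ R0 x ^ 2 * D.Γ u u x) = 0 := by
    intro R0 hR0
    have hχ := isTest_χ (D := D) (R := R0) (by linarith)
    have ht := hχ.sq.mul_right (h.Γ (D := D) h)
    have h0 : ∀ x, 0 ≤ D.χ R0 x ^ 2 * D.Γ u u x := fun x => mul_nonneg (sq_nonneg _) (Γ_nonneg x)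
    refine eq_zero_of_ae_μ (D := D) ht.isSm ((integral_eq_zero_iff_of_nonneg h0 (integrable ht)).1 ?_)
    refine le_antisymm ?_ (integral_nonneg h0)
    have hle : ∀ R : ℝ, 2 * R0 ≤ R → ∫ x, D.χ R0 x ^ 2 * D.Γ u u x ∂D.μ ≤
        4 * (C * ∫ x, u x ^ 2 ∂D.μ) / R := by
      intro R hR
      have hR1 : 1 ≤ R := by linarith
      have hRp : 0 < R := by linarith
      have hχ' := isTest_χ (D := D) hRp
      calc _ ≤ ∫ x, D.χ R x ^ 2 * D.Γ u u x ∂D.μ := by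
            refine integral_mono (integrable ht) (integrable (hχ'.sq.mul_right (h.Γ h))) fun x => ?_
            refine mul_le_mul_of_nonneg_right ?_ (Γ_nonneg x)
            rcases le_total (D.E x) R with hx | hx
            · rw [χ_eq_one hRp hx, one_pow]
              exact pow_le_one₀ (step_nonneg _) (step_le_one _)
            · rw [χ_eq_zero (by linarith) (by linarith)]
              simpa using sq_nonneg _
        _ ≤ 4 * ∫ x, u x ^ 2 * D.Γ (D.χ R) (D.χ R) x ∂D.μ := integral_sq_mul_Γ_le h hG hRp
        _ ≤ 4 * ∫ x, u x ^ 2 * (C / R) ∂D.μ := by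
            refine mul_le_mul_of_nonneg_left ?_ (by norm_num)
            refine integral_mono (integrable ((hχ'.Γ hχ'.isSm).mul_left h.sq)) (hu.mul_const _) fun x => ?_
            exact mul_le_mul_of_nonneg_left (hb R hR1 x).1 (sq_nonneg _)
        _ = _ := by rw [integral_mul_const]; ring
    refine ge_of_tendsto (x := atTop) (f := fun R : ℝ => 4 * (C * ∫ x, u x ^ 2 ∂D.μ) / R)
      (tendsto_const_nhds.div_atTop tendsto_id) ?_
    filter_upwards [eventually_ge_atTop (2 * R0)] with R hR using hle R hR
  have hΓ : ∀ x, D.Γ u u x = 0 := by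
    intro x
    have := congrFun (main (max 1 (D.E x)) (le_max_left _ _)) x
    beta_reduce at this
    rw [χ_eq_one (lt_of_lt_of_le one_pos (le_max_left _ _)) (le_max_right _ _)] at this
    simpa using this
  have hz : ∀ i x, dz i u x = 0 := by
    intro i x
    have := (Finset.sum_eq_zero_iff_of_nonneg fun i _ =>
      mul_nonneg (D.a_pos i).le (mul_self_nonneg (dz i u x))).1 (hΓ x) i (Finset.mem_univ i)
    simpa [(D.a_pos i).ne'] using this
  have hz' : ∀ i, dz i u = fun _ => 0 := fun i => funext (hz i)
  refine const_of_dz_T (D := D) h.differentiable hz fun x => ?_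
  have := hG x
  rw [G, S, fderiv_ζ] at this
  simp only [hz'] at this
  simpa [dz, hσ] using this

end Gle

end Estimates

section Coordinates

open scoped RealInnerProductSpace ContDiff

abbrev Idx (d m : ℕ) := Fin d ⊕ (Fin d ⊕ (Fin m × Fin d))

/-- The phase space with its Euclidean structure. -/
abbrev Fsp (d m : ℕ) := EuclideanSpace ℝ (Idx d m)

def toF (d m : ℕ) : Xsp d m ≃L[ℝ] Fsp d m := LinearEquiv.toContinuousLinearEquiv
  { toFun := fun x => WithLp.toLp 2 (Sum.elim x.1 (Sum.elim x.2.1 fun i => x.2.2 i.1 i.2))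
    invFun := fun y => (fun k => y (.inl k), fun k => y (.inr (.inl k)), fun j k => y (.inr (.inr (j, k))))
    map_add' := fun x y => by
      ext i; rcases i with i | i | i <;> simp
    map_smul' := fun c x => by
      ext i; rcases i with i | i | i <;> simp
    left_inv := fun x => rfl
    right_inv := fun y => by
      ext i; rcases i with i | i | i <;> simp }

lemma toF_apply {d m : ℕ} (x : Xsp d m) :
    toF d m x = WithLp.toLp 2 (Sum.elim x.1 (Sum.elim x.2.1 fun i => x.2.2 i.1 i.2)) := rfl

namespace Gle

variable {d m : ℕ} (D : Gle d m)

/-- The displacement which straightens the potential force. -/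
def w (x : Xsp d m) : Xsp d m := ∑ k, (D.dV k x.1 / D.lam D.j0) • ez (D.j0, k)

lemma w_smooth : ContDiff ℝ (⊤ : ℕ∞) (D.w (m := m)) := by
  refine ContDiff.sum fun k _ => ContDiff.fun_smul ?_ contDiff_const
  exact (((D.dV_smooth k).comp contDiff_fst).div_const _)

lemma w_fst (x : Xsp d m) : (D.w x).1 = 0 := by simp [w, Prod.fst_sum]

lemma w_congr {x y : Xsp d m} (h : x.1 = y.1) : D.w x = D.w y := by simp only [w, h]

def sh (s : ℝ) (x : Xsp d m) : Xsp d m := x + s • D.w x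

lemma sh_fst (s : ℝ) (x : Xsp d m) : (D.sh s x).1 = x.1 := by simp [sh, w_fst]

lemma sh_sh (s : ℝ) (x : Xsp d m) : D.sh s (D.sh (-s) x) = x := by
  rw [sh, D.w_congr (D.sh_fst (-s) x), sh]; simp

lemma sh_smooth (s : ℝ) : ContDiff ℝ (⊤ : ℕ∞) (D.sh s) :=
  contDiff_id.add (ContDiff.const_smul s D.w_smooth)

lemma measurePreserving_sh (s : ℝ) : MeasurePreserving (D.sh s) volume volume := by
  have : (volume : Measure (Fin m → Fin d → ℝ)).IsAddHaarMeasure :=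
    Measure.pi.isAddHaarMeasure fun _ : Fin m => (volume : Measure (Fin d → ℝ))
  have : (volume : Measure ((Fin d → ℝ) × (Fin m → Fin d → ℝ))).IsAddHaarMeasure :=
    Measure.prod.instIsAddHaarMeasure _ _
  have h := MeasurePreserving.skew_product (μa := (volume : Measure (Fin d → ℝ)))
    (μc := (volume : Measure ((Fin d → ℝ) × (Fin m → Fin d → ℝ))))
    (μd := (volume : Measure ((Fin d → ℝ) × (Fin m → Fin d → ℝ))))
    (f := id) (g := fun q y => y + s • (D.w (q, 0)).2) (MeasurePreserving.id _)
    (by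
      have : Continuous fun x : Xsp d m => x.2 + s • (D.w (x.1, 0)).2 := by
        have := D.w_smooth.continuous
        fun_prop
      exact this.measurable)
    (Eventually.of_forall fun q => (measurePreserving_add_right volume _).map_eq)
  have e : D.sh s = fun x : Xsp d m => (id x.1, x.2 + s • (D.w (x.1, 0)).2) := by
    funext x
    refine Prod.ext (D.sh_fst s x) ?_
    simp [sh, D.w_congr (x := x) (y := (x.1, 0)) rfl]
  rw [e]
  exact h

/-- The straightening coordinates. -/
def J : Fsp d m ≃ₜ Xsp d m where
  toFun y := D.sh 1 ((toF d m).symm y)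
  invFun x := toF d m (D.sh (-1) x)
  left_inv y := by
    have := D.sh_sh (-1) ((toF d m).symm y)
    rw [neg_neg] at this
    simp [this]
  right_inv x := by simp [D.sh_sh]
  continuous_toFun := (D.sh_smooth 1).continuous.comp (toF d m).symm.continuous
  continuous_invFun := (toF d m).continuous.comp (D.sh_smooth (-1)).continuous

lemma J_smooth : ContDiff ℝ (⊤ : ℕ∞) D.J := (D.sh_smooth 1).comp (toF d m).symm.contDiff

lemma J_symm_smooth : ContDiff ℝ (⊤ : ℕ∞) D.J.symm := (toF d m).contDiff.comp (D.sh_smooth (-1))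

lemma exists_map_J : ∃ c : NNReal, c ≠ 0 ∧ Measure.map D.J volume = c • (volume : Measure (Xsp d m)) := by
  have h1 : (Measure.map (toF d m).symm (volume : Measure (Fsp d m))).IsAddHaarMeasure :=
    ContinuousLinearEquiv.isAddHaarMeasure_map (toF d m).symm volume
  obtain ⟨c, hc⟩ : ∃ c : NNReal, Measure.map (toF d m).symm (volume : Measure (Fsp d m))
      = c • (volume : Measure (Xsp d m)) := ⟨_, Measure.isAddLeftInvariant_eq_smul _ _⟩
  have h2 : Measure.map D.J volume
      = Measure.map (D.sh 1) (Measure.map (toF d m).symm (volume : Measure (Fsp d m))) := by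
    rw [Measure.map_map (D.sh_smooth 1).continuous.measurable (toF d m).symm.continuous.measurable]
    rfl
  refine ⟨c, ?_, ?_⟩
  · rintro rfl
    rw [zero_smul] at hc
    exact (NeZero.ne (Measure.map (toF d m).symm (volume : Measure (Fsp d m)))) hc
  · rw [h2, hc, Measure.map_smul, (D.measurePreserving_sh 1).map_eq]

def cJ : NNReal := D.exists_map_J.choose

lemma cJ_ne : D.cJ ≠ 0 := D.exists_map_J.choose_spec.1
lemma map_J : Measure.map D.J volume = D.cJ • (volume : Measure (Xsp d m)) := D.exists_map_J.choose_spec.2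

lemma integral_J (H : Xsp d m → ℝ) : ∫ y, H (D.J y) = D.cJ * ∫ x, H x := by
  rw [← D.J.measurableEmbedding.integral_map, map_J, integral_smul_nnreal_measure]
  rfl

lemma ae_J {p : Xsp d m → Prop} : (∀ᵐ y, p (D.J y)) ↔ ∀ᵐ x, p x := by
  rw [← D.J.measurableEmbedding.ae_map_iff, map_J,
    Measure.ae_smul_measure_eq (c := D.cJ) D.cJ_ne]

lemma locallyIntegrable_J {H : Xsp d m → ℝ} (h : LocallyIntegrable H) :
    LocallyIntegrable fun y => H (D.J y) := by
  rw [locallyIntegrable_iff] at h ⊢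
  intro k hk
  have h1 := h _ (hk.image D.J.continuous)
  have h2 : IntegrableOn H (D.J '' k) (Measure.map D.J volume) := by
    rw [map_J]
    show Integrable _ _
    rw [Measure.restrict_smul]
    exact Integrable.smul_measure_nnreal h1
  rw [D.J.measurableEmbedding.integrableOn_map_iff, D.J.injective.preimage_image] at h2
  exact h2

end Gle

end Coordinates

section Transfer

open scoped RealInnerProductSpace ContDiff

namespace Gle

variable {d m : ℕ} (D : Gle d m)

/-- The nilpotent linear part of the transport field. -/
def N : Xsp d m →ₗ[ℝ] Xsp d m where
  toFun x := (x.2.1, fun k => ∑ j, D.lam j * x.2.2 j k, 0)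
  map_add' x y := by
    ext <;> simp [mul_add, Finset.sum_add_distrib]
  map_smul' c x := by
    ext
    · simp
    · simp [Finset.mul_sum, mul_left_comm]
    · simp

def BF (σ : ℝ) : Fsp d m →L[ℝ] Fsp d m := LinearMap.toContinuousLinearMap
  (-σ • ((toF d m).toLinearMap ∘ₗ D.N ∘ₗ (toF d m).symm.toLinearMap))

lemma BF_toF (σ : ℝ) (x : Xsp d m) : D.BF σ (toF d m x) = -σ • toF d m (D.N x) := by
  simp [BF]

lemma N_ez (i : Fin m × Fin d) : D.N (ez i) = D.lam i.1 • ep i.2 := by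
  obtain ⟨j, k⟩ := i
  refine Prod.ext ?_ (Prod.ext ?_ ?_)
  · ext; simp [N, ep]
  · ext l
    simp only [N, ep, ez_apply, LinearMap.coe_mk, AddHom.coe_mk, Prod.smul_snd, Prod.smul_fst,
      Pi.smul_apply, smul_eq_mul, Pi.single_apply, Prod.mk.injEq, mul_ite, mul_one, mul_zero]
    by_cases h : k = l
    · subst h; simp
    · simp [h, Ne.symm h]
  · ext; simp [N, ep]

lemma N_ep (k : Fin d) : D.N (ep k : Xsp d m) = eq k := by
  refine Prod.ext ?_ (Prod.ext ?_ ?_) <;> ext <;> simp [N, ep, eq]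

lemma N_N_N (x : Xsp d m) : D.N (D.N (D.N x)) = 0 := by
  refine Prod.ext ?_ (Prod.ext ?_ ?_) <;> ext <;> simp [N]

lemma inner_toF_ez (θ : Fsp d m) (i) : ⟪θ, toF d m (ez i)⟫ = θ (.inr (.inr i)) := by
  rw [PiLp.inner_apply, Finset.sum_eq_single (.inr (.inr i))]
  · simp [toF_apply, ez_apply]
  · rintro (k | k | k) _ hk
    · simp [toF_apply]
    · simp [toF_apply]
    · have : i ≠ k := fun h => hk (by rw [h])
      simp [toF_apply, ez_apply, this]
  · simp

lemma inner_toF_ep (θ : Fsp d m) (i) : ⟪θ, toF d m (ep i)⟫ = θ (.inr (.inl i)) := by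
  rw [PiLp.inner_apply, Finset.sum_eq_single (.inr (.inl i))]
  · simp [toF_apply, ep]
  · rintro (k | k | k) _ hk
    · simp [toF_apply, ep]
    · have : k ≠ i := fun h => hk (by rw [h])
      simp [toF_apply, ep, this]
    · simp [toF_apply, ep]
  · simp

lemma inner_toF_eq (θ : Fsp d m) (i) : ⟪θ, toF d m (eq i)⟫ = θ (.inl i) := by
  rw [PiLp.inner_apply, Finset.sum_eq_single (.inl i)]
  · simp [toF_apply, eq]
  · rintro (k | k | k) _ hk
    · have : k ≠ i := fun h => hk (by rw [h])
      simp [toF_apply, eq, this]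
    · simp [toF_apply, eq]
    · simp [toF_apply, eq]
  · simp

lemma exists_coer : ∃ c > 0, (∀ j, c ≤ D.α j / D.β) ∧ (∀ j, c ≤ D.α j / D.β * D.lam j ^ 2) := by
  have : Nonempty (Fin m) := ⟨D.j0⟩
  obtain ⟨j1, h1⟩ := Finite.exists_min fun j => D.α j / D.β
  obtain ⟨j2, h2⟩ := Finite.exists_min fun j => D.α j / D.β * D.lam j ^ 2
  have p1 := div_pos (D.hα j1) D.hβ
  have p2 := mul_pos (div_pos (D.hα j2) D.hβ) (pow_pos (D.hlam j2) 2)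
  exact ⟨_, lt_min p1 p2, fun j => (min_le_left _ _).trans (h1 j), fun j => (min_le_right _ _).trans (h2 j)⟩

lemma BF_ez (σ : ℝ) (i) : D.BF σ (√(D.a i) • toF d m (ez i)) =
    (-σ * √(D.a i) * D.lam i.1) • toF d m (ep i.2) := by
  rw [map_smul, BF_toF, N_ez, map_smul]; module

lemma BF_BF_ez (σ : ℝ) (hσ : σ ^ 2 = 1) (i) : D.BF σ (D.BF σ (√(D.a i) • toF d m (ez i))) =
    (√(D.a i) * D.lam i.1) • toF d m (eq i.2) := by
  rw [BF_ez, map_smul, BF_toF, N_ep, smul_smul]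
  congr 1
  linear_combination (√(D.a i) * D.lam i.1) * hσ

/-- The Kolmogorov structure of the equation in straightened coordinates. -/
def kol (σ : ℝ) (hσ : σ ^ 2 = 1) : KolData (Fsp d m) (Fin m × Fin d) where
  A := ContinuousLinearMap.adjoint (D.BF σ)
  B := D.BF σ
  e i := √(D.a i) • toF d m (ez i)
  c := D.exists_coer.choose
  c_pos := D.exists_coer.choose_spec.1
  adj θ y := (ContinuousLinearMap.adjoint_inner_left _ _ _).symm
  nil θ := by
    refine ext_inner_right ℝ fun y => ?_
    obtain ⟨x, rfl⟩ := (toF d m).surjective y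
    simp only [ContinuousLinearMap.adjoint_inner_left, BF_toF, map_smul, N_N_N, map_zero, smul_zero,
      inner_zero_right, inner_zero_left]
  coer θ := by
    obtain ⟨hc, h1, h2⟩ := D.exists_coer.choose_spec
    set c := D.exists_coer.choose
    simp only [ContinuousLinearMap.adjoint_inner_left, BF_BF_ez D σ hσ]
    simp only [BF_ez]
    simp only [inner_smul_right, inner_toF_eq, inner_toF_ep, inner_toF_ez]
    have hs : ∀ i, √(D.a i) ^ 2 = D.α i.1 / D.β := fun i => Real.sq_sqrt (D.a_pos i).le
    have key : ∀ i : Fin m × Fin d, c * θ (.inr (.inr i)) ^ 2 + c * θ (.inr (.inl i.2)) ^ 2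
        + c * θ (.inl i.2) ^ 2 ≤ (√(D.a i) * θ (.inr (.inr i))) ^ 2 +
          (-σ * √(D.a i) * D.lam i.1 * θ (.inr (.inl i.2))) ^ 2
          + (√(D.a i) * D.lam i.1 * θ (.inl i.2)) ^ 2 := by
      intro i
      have e1 := mul_le_mul_of_nonneg_right (h1 i.1) (sq_nonneg (θ (.inr (.inr i))))
      have e2 := mul_le_mul_of_nonneg_right (h2 i.1) (sq_nonneg (θ (.inr (.inl i.2))))
      have e3 := mul_le_mul_of_nonneg_right (h2 i.1) (sq_nonneg (θ (.inl i.2)))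
      simp only [mul_pow, hs, neg_sq, hσ, one_mul]
      linarith
    refine le_trans ?_ (Finset.sum_le_sum fun i _ => key i)
    rw [EuclideanSpace.real_norm_sq_eq, Fintype.sum_sum_type, Fintype.sum_sum_type,
      Finset.sum_add_distrib, Finset.sum_add_distrib, mul_add, mul_add, Finset.mul_sum, Finset.mul_sum,
      Finset.mul_sum]
    have tot : ∀ g : Fin d → ℝ, (∀ k, 0 ≤ g k) → ∑ k, g k ≤ ∑ i : Fin m × Fin d, g i.2 := by
      intro g hg
      rw [Fintype.sum_prod_type]
      exact Finset.single_le_sum (f := fun _ : Fin m => ∑ k, g k)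
        (fun _ _ => Finset.sum_nonneg fun k _ => hg k) (Finset.mem_univ D.j0)
    have t1 := tot (fun k => c * θ (.inr (.inl k)) ^ 2) fun k => mul_nonneg hc.le (sq_nonneg _)
    have t2 := tot (fun k => c * θ (.inl k) ^ 2) fun k => mul_nonneg hc.le (sq_nonneg _)
    linarith

lemma w_fderiv (x : Xsp d m) : HasFDerivAt D.w (∑ k, (ContinuousLinearMap.smulRight
    ((D.lam D.j0)⁻¹ • (fderiv ℝ (D.dV k) x.1).comp (ContinuousLinearMap.fst ℝ _ _)) (ez (D.j0, k)))) x := by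
  refine HasFDerivAt.fun_sum fun k _ => HasFDerivAt.smul_const ?_ _
  have h := (((D.dV_smooth k).differentiable (by simp) x.1).hasFDerivAt.comp x hasFDerivAt_fst)
  simpa only [div_eq_mul_inv, mul_comm, Function.comp_def] using h.const_mul (D.lam D.j0)⁻¹

variable {D} in
lemma fderiv_comp_J_symm {φ : Fsp d m → ℝ} (h : Differentiable ℝ φ) (x v : Xsp d m) :
    fderiv ℝ (fun x => φ (D.J.symm x)) x v = fderiv ℝ φ (D.J.symm x) (toF d m v)
      - ∑ k, fderiv ℝ (D.dV k) x.1 v.1 / D.lam D.j0 * fderiv ℝ φ (D.J.symm x) (toF d m (ez (D.j0, k))) := by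
  have h1 : HasFDerivAt (D.sh (-1)) _ x := (hasFDerivAt_id x).add ((D.w_fderiv x).const_smul (-1 : ℝ))
  have h2 : HasFDerivAt (fun x => φ (D.J.symm x)) _ x :=
    (h (D.J.symm x)).hasFDerivAt.comp x ((toF d m).hasFDerivAt.comp x h1)
  rw [h2.fderiv]
  simp [div_eq_inv_mul, sub_eq_add_neg]

lemma fderiv_comp_J_symm_ez {φ : Fsp d m → ℝ} (h : Differentiable ℝ φ) (i) :
    dz i (fun x => φ (D.J.symm x)) = fun x => fderiv ℝ φ (D.J.symm x) (toF d m (ez i)) := by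
  funext x
  rw [dz, fderiv_comp_J_symm h]
  simp

/-- The first-order coefficients in the noisy directions. -/
def rc (σ : ℝ) (i : Fin m × Fin d) (x : Xsp d m) : ℝ :=
  σ * (D.lam i.1 * x.2.1 i.2 + if i.1 = D.j0 then fderiv ℝ (D.dV i.2) x.1 x.2.1 / D.lam D.j0 else 0)
    - D.α i.1 * x.2.2 i.1 i.2

def bc (σ : ℝ) (i : Fin m × Fin d) (y : Fsp d m) : ℝ := D.rc σ i (D.J y) / √(D.a i)

lemma bc_smooth (σ : ℝ) (i) : ContDiff ℝ (⊤ : ℕ∞) (D.bc σ i) := by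
  have h0 : ContDiff ℝ (⊤ : ℕ∞) fun x : Xsp d m => fderiv ℝ (D.dV i.2) x.1 x.2.1 := by
    have h := (D.dV_smooth i.2).fderiv_right (m := (⊤ : ℕ∞)) (by exact_mod_cast le_top)
    exact (h.comp contDiff_fst).clm_apply (contDiff_fst.comp contDiff_snd)
  have h1 : ContDiff ℝ (⊤ : ℕ∞) (D.rc σ i) := by
    refine ContDiff.sub (ContDiff.mul contDiff_const (ContDiff.add ?_ ?_)) ?_
    · exact contDiff_const.mul (contDiff_p i.2).1
    · split_ifs
      · exact h0.div_const _
      · exact contDiff_const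
    · exact contDiff_const.mul (contDiff_z i.1 i.2).1
  exact (h1.comp D.J_smooth).div_const _

lemma sh_N (x : Xsp d m) :
    D.N (D.sh (-1) x) = D.W x + ∑ i : Fin m × Fin d, (D.lam i.1 * x.2.1 i.2) • ez i := by
  have hj := (D.hlam D.j0).ne'
  refine Prod.ext ?_ (Prod.ext ?_ ?_)
  · ext k; simp [N, sh, w, W, Prod.fst_sum, Prod.snd_sum]
  · ext k
    have : ∑ j, D.lam j * ∑ c, D.dV c x.1 / D.lam D.j0 * (if (D.j0, c) = (j, k) then 1 else 0) = D.dV k x.1 := by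
      rw [Finset.sum_eq_single D.j0]
      · simp; field_simp
      · intro j _ hj; simp [hj.symm]
      · simp
    simp [-mul_ite, -ite_mul, N, sh, w, W, Prod.fst_sum, Prod.snd_sum, ez_apply, mul_add, Finset.sum_add_distrib]
    simp only [Prod.mk.injEq] at this
    simp only [this]; ring
  · ext j k; simp [N, W, Prod.snd_sum, ez_apply]

/-- The operator in straightened coordinates. -/
lemma aop_J_symm (σ : ℝ) (hσ : σ ^ 2 = 1) {φ : Fsp d m → ℝ} (h : ContDiff ℝ (⊤ : ℕ∞) φ) (x : Xsp d m) :
    (D.kol σ hσ).aop (D.bc σ) φ (D.J.symm x) = - D.G (-σ) (fun x => φ (D.J.symm x)) x := by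
  have hd := h.differentiable (by simp)
  have h2 : ∀ i, Differentiable ℝ fun y => fderiv ℝ φ y (toF d m (ez i)) := fun i =>
    (fderiv_smooth h contDiff_const).differentiable (by simp)
  have hs : ∀ i, √(D.a i) ≠ 0 := fun i => (Real.sqrt_pos.2 (D.a_pos i)).ne'
  have e1 : ∀ i, fderiv ℝ (fun y => fderiv ℝ φ y (√(D.a i) • toF d m (ez i))) (D.J.symm x) (√(D.a i) • toF d m (ez i))
      = D.a i * fderiv ℝ (fun y => fderiv ℝ φ y (toF d m (ez i))) (D.J.symm x) (toF d m (ez i)) := by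
    intro i
    simp only [map_smul, smul_eq_mul]
    rw [fderiv_const_mul (h2 i _), _root_.smul_apply, smul_eq_mul, ← mul_assoc,
      Real.mul_self_sqrt (D.a_pos i).le]
  have e2 : D.BF σ (D.J.symm x) = -σ • toF d m (D.W x) - ∑ i : Fin m × Fin d, (σ * (D.lam i.1 * x.2.1 i.2)) • toF d m (ez i) := by
    show D.BF σ (toF d m (D.sh (-1) x)) = _
    rw [BF_toF, sh_N, map_add, map_sum, smul_add, Finset.smul_sum]
    simp only [map_smul, smul_smul, neg_smul, Finset.sum_neg_distrib, neg_mul, sub_eq_add_neg]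
  have e3 : toF d m (D.ζ x) = ∑ i : Fin m × Fin d, (D.α i.1 * x.2.2 i.1 i.2) • toF d m (ez i) := by
    conv_lhs => rw [eq_sum (D.ζ x)]
    simp [ζ]
  show fderiv ℝ φ (D.J.symm x) (D.BF σ (D.J.symm x))
    + ∑ i, fderiv ℝ (fun y => fderiv ℝ φ y (√(D.a i) • toF d m (ez i))) (D.J.symm x) (√(D.a i) • toF d m (ez i))
    + ∑ i, D.bc σ i (D.J.symm x) • fderiv ℝ φ (D.J.symm x) (√(D.a i) • toF d m (ez i)) = _
  simp only [e1, G, S, T, fderiv_comp_J_symm_ez D hd, fun i => fderiv_comp_J_symm_ez D (h2 i) i]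
  rw [fderiv_comp_J_symm hd, fderiv_comp_J_symm hd, e2, e3]
  have e4 : ∀ i, D.bc σ i (D.J.symm x) • fderiv ℝ φ (D.J.symm x) (√(D.a i) • toF d m (ez i))
      = D.rc σ i x * fderiv ℝ φ (D.J.symm x) (toF d m (ez i)) := by
    intro i
    simp only [bc, D.J.apply_symm_apply, map_smul, smul_eq_mul]
    field_simp [hs i]
  have e5 : ∑ i, D.rc σ i x * fderiv ℝ φ (D.J.symm x) (toF d m (ez i)) =
      ∑ i : Fin m × Fin d, σ * (D.lam i.1 * x.2.1 i.2) * fderiv ℝ φ (D.J.symm x) (toF d m (ez i))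
      + σ * ∑ k, fderiv ℝ (D.dV k) x.1 x.2.1 / D.lam D.j0 * fderiv ℝ φ (D.J.symm x) (toF d m (ez (D.j0, k)))
      - ∑ i : Fin m × Fin d, (D.α i.1 * x.2.2 i.1 i.2) * fderiv ℝ φ (D.J.symm x) (toF d m (ez i)) := by
    have : ∑ k, fderiv ℝ (D.dV k) x.1 x.2.1 / D.lam D.j0 * fderiv ℝ φ (D.J.symm x) (toF d m (ez (D.j0, k)))
        = ∑ i : Fin m × Fin d, (if i.1 = D.j0 then fderiv ℝ (D.dV i.2) x.1 x.2.1 / D.lam D.j0 else 0)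
          * fderiv ℝ φ (D.J.symm x) (toF d m (ez i)) := by
      rw [Fintype.sum_prod_type, Finset.sum_eq_single D.j0]
      · simp
      · intro j _ hj; simp [hj]
      · simp
    rw [this, Finset.mul_sum, ← Finset.sum_add_distrib, ← Finset.sum_sub_distrib]
    refine Finset.sum_congr rfl fun i _ => ?_
    rw [rc]; ring
  simp only [e4, e5]
  simp [W, ζ]
  ring

end Gle

end Transfer

section Lattice

open scoped ContDiff

variable {d m : ℕ}

/-- Periodization in the position. -/
def per (h : Xsp d m → ℝ) (x : Xsp d m) : ℝ := ∑' g : latX d m, h (g +ᵥ x)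

lemma exists_finset_latX {h : Xsp d m → ℝ} {M : ℝ} (hM : ∀ x : Xsp d m, M < ‖x.1‖ → h x = 0) (R : ℝ) :
    ∃ s : Finset (latX d m), ∀ g ∉ s, ∀ x : Xsp d m, ‖x.1‖ ≤ R → h (g +ᵥ x) = 0 := by
  have hfin : {g : latX d m | ‖(g : Xsp d m).1‖ ≤ R + M}.Finite := by
    have h1 : (Set.Icc (fun _ : Fin d => -⌈R + M⌉) (fun _ => ⌈R + M⌉)).Finite := Set.finite_Icc _ _
    have h2 := (h1.image (latv m)).preimage (f := ((↑) : latX d m → Xsp d m)) Subtype.val_injective.injOn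
    refine h2.subset ?_
    rintro ⟨_, k, rfl⟩ hk
    refine ⟨k, ⟨fun i => ?_, fun i => ?_⟩, rfl⟩ <;>
    · have h3 : |(k i : ℝ)| ≤ R + M := (norm_le_pi_norm (fun i => (k i : ℝ)) i).trans hk
      have h4 := h3.trans (Int.le_ceil _)
      rw [abs_le] at h4
      first | exact_mod_cast h4.1 | exact_mod_cast h4.2
  refine ⟨hfin.toFinset, fun g hg x hx => hM _ ?_⟩
  simp only [Set.Finite.mem_toFinset, Set.mem_ofPred_eq, not_le] at hg
  have h5 : ‖(g : Xsp d m).1‖ ≤ ‖((g : Xsp d m) + x).1‖ + ‖x.1‖ := by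
    have := norm_sub_le ((g : Xsp d m) + x).1 x.1
    rwa [Prod.fst_add, add_sub_cancel_right] at this
  show M < ‖((g : Xsp d m) + x).1‖
  linarith

lemma per_eq_sum {h : Xsp d m → ℝ} {R : ℝ} {s : Finset (latX d m)}
    (hs : ∀ g ∉ s, ∀ x : Xsp d m, ‖x.1‖ ≤ R → h (g +ᵥ x) = 0) {x : Xsp d m} (hx : ‖x.1‖ ≤ R) :
    per h x = ∑ g ∈ s, h (g +ᵥ x) := tsum_eq_sum fun g hg => hs g hg x hx

lemma norm_le_one_of_mem_cube {q : Fin d → ℝ} (h : q ∈ cube d) : ‖q‖ ≤ 1 :=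
  (pi_norm_le_iff_of_nonneg zero_le_one).2 fun i => by
    rw [Real.norm_eq_abs, abs_of_nonneg (h i).1]; exact (h i).2.le

lemma fractX_vadd (g : latX d m) (x : Xsp d m) : fractX (g +ᵥ x) = fractX x := by
  obtain ⟨_, k, rfl⟩ := g
  refine Prod.ext ?_ ?_
  · ext i
    show Int.fract ((k i : ℝ) + x.1 i) = Int.fract (x.1 i)
    simp
  · show 0 + x.2 = x.2
    simp

lemma fractX_of_mem {x : Xsp d m} (h : x.1 ∈ cube d) : fractX x = x := by
  refine Prod.ext (funext fun i => ?_) rfl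
  exact Int.fract_eq_self.2 (h i)

lemma measurable_fractX : Measurable (fractX : Xsp d m → Xsp d m) := by
  refine Measurable.prodMk (measurable_pi_lambda _ fun i => ?_) measurable_snd
  exact measurable_fract.comp ((measurable_pi_apply i).comp measurable_fst)

lemma PerQ.vadd {φ : Xsp d m → ℝ} (h : PerQ d m φ) (g : latX d m) (x) : φ (g +ᵥ x) = φ x := by
  obtain ⟨_, k, rfl⟩ := g
  show φ (latv m k + x) = φ x
  rw [add_comm, h.add_latv]

namespace Gle

variable (D : Gle d m)

lemma integrable_unfold {v h : Xsp d m → ℝ} (hv : Measurable v) (hvi : Integrable v D.μ)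
    (hh : Measurable h) {C M : ℝ} (hC : ∀ x, |h x| ≤ C) (hM : ∀ x : Xsp d m, M < ‖x.1‖ → h x = 0) :
    Integrable fun x => v (fractX x) * D.ρ x * h x := by
  have hmeas : Measurable fun x => v (fractX x) * D.ρ x * h x :=
    ((hv.comp measurable_fractX).mul D.isSm_ρ.continuous.measurable).mul hh
  refine ⟨hmeas.aestronglyMeasurable, ?_⟩
  obtain ⟨s, hs⟩ := exists_finset_latX hM 1
  have hvi' := (D.integrable_μ_iff v).1 hvi
  rw [HasFiniteIntegral, isAddFundamentalDomain_latX.lintegral_eq_tsum'']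
  have hz : ∀ g : latX d m, g ∉ s → ∫⁻ x in {x : Xsp d m | x.1 ∈ cube d},
      ‖v (fractX (g +ᵥ x)) * D.ρ (g +ᵥ x) * h (g +ᵥ x)‖ₑ = 0 := by
    intro g hg
    rw [← lintegral_zero (μ := volume.restrict {x : Xsp d m | x.1 ∈ cube d})]
    refine setLIntegral_congr_fun (measurable_fst measurableSet_cube) fun x hx => ?_
    simp only [hs g hg x (norm_le_one_of_mem_cube hx), mul_zero, enorm_zero]
  rw [tsum_eq_sum hz]
  refine ENNReal.sum_lt_top.2 fun g _ => ?_
  have h1 : Integrable (fun x => D.ρ x * v x * h (g +ᵥ x)) (volX d m) :=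
    hvi'.mul_bdd (c := C) (hh.comp (measurable_const_vadd g)).aestronglyMeasurable
      (Eventually.of_forall fun x => hC _)
  refine lt_of_le_of_lt (le_of_eq ?_) h1.2
  refine setLIntegral_congr_fun (measurable_fst measurableSet_cube) fun x hx => ?_
  simp only [fractX_vadd, fractX_of_mem hx, D.isSm_ρ.2.vadd, mul_comm (v x)]

lemma unfold {v h : Xsp d m → ℝ} (hv : Measurable v) (hvi : Integrable v D.μ)
    (hh : Measurable h) {C M : ℝ} (hC : ∀ x, |h x| ≤ C) (hM : ∀ x : Xsp d m, M < ‖x.1‖ → h x = 0) :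
    ∫ x, v (fractX x) * D.ρ x * h x = ∫ x, v x * per h x ∂D.μ := by
  obtain ⟨s, hs⟩ := exists_finset_latX hM 1
  have hvi' := (D.integrable_μ_iff v).1 hvi
  have h1 : ∀ g : latX d m, Integrable (fun x => D.ρ x * v x * h (g +ᵥ x)) (volX d m) := fun g =>
    hvi'.mul_bdd (c := C) (hh.comp (measurable_const_vadd g)).aestronglyMeasurable
      (Eventually.of_forall fun x => hC _)
  have e : ∀ g : latX d m, ∫ x in {x : Xsp d m | x.1 ∈ cube d},
      v (fractX (g +ᵥ x)) * D.ρ (g +ᵥ x) * h (g +ᵥ x) = ∫ x, D.ρ x * v x * h (g +ᵥ x) ∂volX d m := by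
    intro g
    refine setIntegral_congr_fun (measurable_fst measurableSet_cube) fun x hx => ?_
    simp only [fractX_vadd, fractX_of_mem hx, D.isSm_ρ.2.vadd, mul_comm (v x)]
  rw [isAddFundamentalDomain_latX.integral_eq_tsum'' _ (D.integrable_unfold hv hvi hh hC hM)]
  simp only [e]
  rw [tsum_eq_sum (s := s), ← integral_finsetSum _ fun g _ => h1 g, integral_μ]
  · refine setIntegral_congr_fun (measurable_fst measurableSet_cube) fun x hx => ?_
    simp only [per_eq_sum hs (norm_le_one_of_mem_cube hx), Finset.mul_sum, mul_assoc]
  · intro g hg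
    rw [← integral_zero (Xsp d m) ℝ (μ := volX d m)]
    refine setIntegral_congr_fun (measurable_fst measurableSet_cube) fun x hx => ?_
    simp only [hs g hg x (norm_le_one_of_mem_cube hx), mul_zero]

lemma locallyIntegrable_unfold {v : Xsp d m → ℝ} (hv : Measurable v) (hvi : Integrable v D.μ) :
    LocallyIntegrable fun x => v (fractX x) * D.ρ x := by
  rw [locallyIntegrable_iff]
  intro k hk
  obtain ⟨M, hM⟩ := hk.isBounded.exists_norm_le
  have := D.integrable_unfold hv hvi (h := k.indicator fun _ => 1) (C := 1) (M := M)
    (measurable_const.indicator hk.measurableSet)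
    (fun x => by by_cases hx : x ∈ k <;> simp [hx])
    (fun x hx => by
      by_cases hx' : x ∈ k
      · exact absurd ((norm_fst_le x).trans (hM x hx')) (not_le.2 hx)
      · simp [hx'])
  rw [← integrable_indicator_iff hk.measurableSet]
  refine this.congr (Eventually.of_forall fun x => ?_)
  by_cases hx : x ∈ k <;> simp [hx]

end Gle

lemma IsCc.exists_fst_bound {h : Xsp d m → ℝ} (hh : IsCc h) :
    ∃ M, ∀ x : Xsp d m, M < ‖x.1‖ → h x = 0 := by
  obtain ⟨M, hM⟩ := hh.2.isCompact.isBounded.exists_norm_le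
  refine ⟨M, fun x hx => ?_⟩
  by_contra h0
  exact absurd ((norm_fst_le x).trans (hM x (subset_tsupport _ h0))) (not_le.2 hx)

lemma IsCc.exists_abs_bound {F : Type*} [NormedAddCommGroup F] [NormedSpace ℝ F] {h : F → ℝ} (hh : IsCc h) :
    ∃ C, ∀ x, |h x| ≤ C :=
  hh.2.exists_bound_of_continuous hh.1.continuous

/-- Periodizations are locally finite sums, for a function and finitely many others. -/
lemma IsCc.per_eventuallyEq {h : Xsp d m → ℝ} (hh : IsCc h) (x : Xsp d m) :
    ∃ s : Finset (latX d m), (∀ᶠ y in nhds x, per h y = ∑ g ∈ s, h (g +ᵥ y)) ∧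
      ∀ g ∉ s, ∀ᶠ y in nhds x, h (g +ᵥ y) = 0 := by
  obtain ⟨M, hM⟩ := hh.exists_fst_bound
  obtain ⟨s, hs⟩ := exists_finset_latX hM (‖x.1‖ + 1)
  have : ∀ᶠ y : Xsp d m in nhds x, ‖y.1‖ ≤ ‖x.1‖ + 1 := by
    have hc : ContinuousAt (fun y : Xsp d m => ‖y.1‖) x := by fun_prop
    filter_upwards [hc.eventually_lt (g := fun _ => ‖x.1‖ + 1) continuousAt_const (by linarith)] with y hy
      using hy.le
  refine ⟨s, ?_, fun g hg => ?_⟩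
  · filter_upwards [this] with y hy using per_eq_sum hs hy
  · filter_upwards [this] with y hy using hs g hg y hy

lemma contDiff_vadd (g : latX d m) : ContDiff ℝ (⊤ : ℕ∞) fun x : Xsp d m => g +ᵥ x :=
  (contDiff_const (c := (g : Xsp d m))).add contDiff_id

lemma IsCc.isTest_per {h : Xsp d m → ℝ} (hh : IsCc h) : IsTest d m (per h) := by
  refine ⟨?_, ?_, ?_⟩
  · refine contDiff_iff_contDiffAt.2 fun x => ?_
    obtain ⟨s, hs, -⟩ := hh.per_eventuallyEq x
    refine ContDiffAt.congr_of_eventuallyEq ?_ hs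
    exact (ContDiff.sum fun g _ => hh.1.comp (contDiff_vadd g)).contDiffAt
  · refine perQ_iff.2 fun k x => ?_
    let l : latX d m := ⟨latv m k, k, rfl⟩
    have := (Equiv.addRight l).tsum_eq fun g : latX d m => h (g +ᵥ x)
    rw [per, per, ← this]
    refine tsum_congr fun g => ?_
    congr 1
    show (g : Xsp d m) + (x + latv m k) = ((g : Xsp d m) + latv m k) + x
    abel
  · refine ⟨Prod.snd '' tsupport h, hh.2.isCompact.image continuous_snd, fun x hx => ?_⟩
    have : ∀ g : latX d m, h (g +ᵥ x) = 0 := by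
      rintro ⟨_, k, rfl⟩
      by_contra h0
      refine hx ⟨_, subset_tsupport _ h0, ?_⟩
      show 0 + x.2 = x.2
      simp
    simp [per, this]

namespace Gle

variable (D : Gle d m)

lemma G_congr {φ ψ : Xsp d m → ℝ} {x} (h : φ =ᶠ[nhds x] ψ) (σ : ℝ) : D.G σ φ x = D.G σ ψ x := by
  have h1 : fderiv ℝ φ =ᶠ[nhds x] fderiv ℝ ψ := h.fderiv
  have h2 : ∀ i, dz i φ =ᶠ[nhds x] dz i ψ := fun i => by
    filter_upwards [h1] with y hy; rw [dz, dz, hy]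
  have h3 : ∀ i, dz i (dz i φ) x = dz i (dz i ψ) x := fun i => by
    rw [dz, dz, (h2 i).fderiv_eq]
  simp only [G, T, S, h3, h.fderiv_eq]

lemma G_sum {ι : Type*} {s : Finset ι} {φ : ι → Xsp d m → ℝ} (h : ∀ i, ContDiff ℝ (⊤ : ℕ∞) (φ i)) (σ x) :
    D.G σ (fun x => ∑ i ∈ s, φ i x) x = ∑ i ∈ s, D.G σ (φ i) x := by
  have h1 : ∀ ψ : ι → Xsp d m → ℝ, (∀ i, ContDiff ℝ (⊤ : ℕ∞) (ψ i)) → ∀ y v,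
      fderiv ℝ (fun x => ∑ i ∈ s, ψ i x) y v = ∑ i ∈ s, fderiv ℝ (ψ i) y v := by
    intro ψ hψ y v
    rw [fderiv_fun_sum fun i _ => (hψ i).differentiable (by simp) y, _root_.sum_apply]
  have h2 : ∀ j, dz j (fun x => ∑ i ∈ s, φ i x) = fun x => ∑ i ∈ s, dz j (φ i) x := fun j => by
    ext y; exact h1 φ h y _
  simp only [G, T, S, h2]
  have h3 : ∀ j, dz j (fun x => ∑ i ∈ s, dz j (φ i) x) x = ∑ i ∈ s, dz j (dz j (φ i)) x := fun j =>
    h1 (fun i => dz j (φ i)) (fun i => fderiv_smooth (h i) contDiff_const) x _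
  simp only [h1 φ h, h3, Finset.mul_sum]
  rw [Finset.sum_comm, ← Finset.sum_sub_distrib, ← Finset.sum_add_distrib]

lemma G_vadd (φ : Xsp d m → ℝ) (g : latX d m) (σ x) :
    D.G σ (fun x => φ (g +ᵥ x)) x = D.G σ φ (g +ᵥ x) := by
  have h1 : ∀ ψ : Xsp d m → ℝ, ∀ y, fderiv ℝ (fun x => ψ (g +ᵥ x)) y = fderiv ℝ ψ (g +ᵥ y) :=
    fun ψ y => fderiv_comp_add_left (f := ψ) (g : Xsp d m)
  have h2 : ∀ j, dz j (fun x => φ (g +ᵥ x)) = fun x => dz j φ (g +ᵥ x) := fun j => by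
    ext y; rw [dz, h1]; rfl
  have hW : D.W (g +ᵥ x) = D.W x := by
    obtain ⟨_, k, rfl⟩ := g
    show D.W (latv m k + x) = _
    rw [add_comm, W_per]
  have hζ : D.ζ (g +ᵥ x) = D.ζ x := by
    obtain ⟨_, k, rfl⟩ := g
    show D.ζ (latv m k + x) = _
    rw [add_comm, ζ_per]
  simp only [G, T, S, h2, h1, hW, hζ]
  congr 2
  refine Finset.sum_congr rfl fun j _ => ?_
  rw [dz, h1]; rfl

lemma G_per {ψ : Xsp d m → ℝ} (h : IsCc ψ) (σ : ℝ) : D.G σ (per ψ) = per (D.G σ ψ) := by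
  ext x
  obtain ⟨s, hs, hs'⟩ := h.per_eventuallyEq x
  rw [D.G_congr hs, D.G_sum (φ := fun (g : latX d m) x => ψ (g +ᵥ x)) fun g => h.1.comp (contDiff_vadd g)]
  simp only [G_vadd]
  refine (tsum_eq_sum fun g hg => ?_).symm
  rw [← G_vadd, D.G_congr (hs' g hg)]
  have : ∀ i, dz i (fun _ : Xsp d m => (0 : ℝ)) = fun _ => 0 := fun i => by ext; simp [dz]
  simp [G, T, S, this]

lemma isCc_G {ψ : Xsp d m → ℝ} (h : IsCc ψ) (σ : ℝ) : IsCc (D.G σ ψ) := by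
  have h1 : IsCc (D.T ψ) := h.fderiv_apply D.W_smooth
  have h2 : IsCc fun x => fderiv ℝ ψ x (D.ζ x) := h.fderiv_apply D.ζ_smooth
  have h3 : IsCc fun x => ∑ i, D.a i * dz i (dz i ψ) x := IsCc.sum _ fun i =>
    IsCc.mul_left (φ := dz i (dz i ψ)) ((h.fderiv_apply contDiff_const).fderiv_apply contDiff_const) contDiff_const
  have := (h1.mul_left (contDiff_const (c := -σ))).add (h2.add (h3.mul_left (contDiff_const (c := -1))))
  convert this using 2
  simp only [G, S]; ring

end Gle

end Lattice

section Weak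

open scoped ContDiff

namespace Gle

variable {d m : ℕ} (D : Gle d m)

/-- Weak solutions of `G σ u = f` in `L²(μ)`. -/
structure Weak (σ : ℝ) (u f : Xsp d m → ℝ) : Prop where
  meas : Measurable u
  sq : Integrable (fun x => u x ^ 2) D.μ
  eqn : ∀ φ, IsTest d m φ → ∫ x, u x * D.G (-σ) φ x ∂D.μ = ∫ x, f x * φ x ∂D.μ

variable {D} {σ : ℝ} {u f : Xsp d m → ℝ}

lemma integrable_of_sq (h : AEStronglyMeasurable u D.μ) (h2 : Integrable (fun x => u x ^ 2) D.μ) :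
    Integrable u D.μ :=
  ((memLp_two_iff_integrable_sq h).2 h2).integrable one_le_two

lemma _root_.IsCc.comp_J_symm {φ : Fsp d m → ℝ} (h : IsCc φ) (D : Gle d m) :
    IsCc fun x => φ (D.J.symm x) :=
  ⟨h.1.comp D.J_symm_smooth, h.2.comp_homeomorph D.J.symm⟩

lemma _root_.IsCc.comp_J {φ : Xsp d m → ℝ} (h : IsCc φ) (D : Gle d m) : IsCc fun x => φ (D.J x) :=
  ⟨h.1.comp D.J_smooth, h.2.comp_homeomorph D.J⟩

lemma integral_J_unfold {v h : Xsp d m → ℝ} (hv : Measurable v) (hvi : Integrable v D.μ) (hh : IsCc h) :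
    ∫ y, v (fractX (D.J y)) * D.ρ (D.J y) * h (D.J y) = D.cJ * ∫ x, v x * per h x ∂D.μ := by
  obtain ⟨C, hC⟩ := hh.exists_abs_bound
  obtain ⟨M, hM⟩ := hh.exists_fst_bound
  rw [D.integral_J fun x => v (fractX x) * D.ρ x * h x,
    D.unfold hv hvi hh.1.continuous.measurable hC hM]

lemma Weak.weakSol (h : D.Weak σ u f) (hσ : σ ^ 2 = 1) (hf : IsSm d m f) (hfi : Integrable f D.μ) :
    (D.kol σ hσ).WeakSol (D.bc σ) (fun y => u (fractX (D.J y)) * D.ρ (D.J y))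
      (fun y => -(f (D.J y) * D.ρ (D.J y))) where
  smooth := D.bc_smooth σ
  loc := D.locallyIntegrable_J (D.locallyIntegrable_unfold h.meas
    (integrable_of_sq h.meas.aestronglyMeasurable h.sq))
  loc' := by
    have := hf.continuous.comp D.J.continuous
    have h2 := D.isSm_ρ.continuous.comp D.J.continuous
    exact (this.mul h2).neg.locallyIntegrable
  eqn φ hφ := by
    have hψ := hφ.comp_J_symm D
    have hu := integrable_of_sq h.meas.aestronglyMeasurable h.sq
    have e1 : ∀ y, (D.kol σ hσ).aop (D.bc σ) φ y = -D.G (-σ) (fun x => φ (D.J.symm x)) (D.J y) := by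
      intro y
      rw [← D.aop_J_symm σ hσ hφ.1, D.J.symm_apply_apply]
    have h1 := integral_J_unfold h.meas hu (D.isCc_G hψ (-σ))
    have h2 := integral_J_unfold hf.continuous.measurable hfi hψ
    rw [← D.G_per hψ, h.eqn _ hψ.isTest_per] at h1
    have h3 := h1.trans h2.symm
    simp only [e1, mul_neg, neg_mul, integral_neg, h3, hf.2.fractX, D.J.symm_apply_apply]

/-- Interior regularity. -/
lemma Weak.exists_isSm (h : D.Weak σ u f) (hσ : σ ^ 2 = 1) (hf : IsSm d m f) (hfi : Integrable f D.μ) :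
    ∃ v, IsSm d m v ∧ u =ᵐ[D.μ] v ∧ ∀ x, D.G σ v x = f x := by
  obtain ⟨U, hU, hae⟩ := (h.weakSol hσ hf hfi).exists_smooth
    ((hf.1.comp D.J_smooth).mul (D.isSm_ρ.1.comp D.J_smooth)).neg
  let v : Xsp d m → ℝ := fun x => U (D.J.symm x) * (D.ρ x)⁻¹
  have hv : ContDiff ℝ (⊤ : ℕ∞) v := (hU.comp D.J_symm_smooth).mul
    (D.isSm_ρ.1.inv fun x => (D.ρ_pos x).ne')
  have h1 : ∀ᵐ x : Xsp d m, u (fractX x) = v x := by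
    rw [← D.ae_J]
    filter_upwards [hae] with y hy
    simp only [v, D.J.symm_apply_apply, ← hy]
    rw [mul_inv_cancel_right₀ (D.ρ_pos _).ne']
  have hper : PerQ d m v := by
    refine perQ_iff.2 fun k => ?_
    have h2 : ∀ᵐ x : Xsp d m, u (fractX (x + latv m k)) = v (x + latv m k) :=
      (measurePreserving_add_right (volume : Measure (Xsp d m)) (latv m k)).quasiMeasurePreserving.ae h1
    have h3 : (fun x => v (x + latv m k)) =ᵐ[(volume : Measure (Xsp d m))] v := by
      filter_upwards [h1, h2] with x hx hx2
      rw [← hx, ← hx2, add_comm]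
      exact congrArg u (fractX_vadd ⟨latv m k, k, rfl⟩ x)
    have hc : Continuous fun x => v (x + latv m k) := by
      have := hv.continuous; fun_prop
    exact congrFun ((Continuous.ae_eq_iff_eq (volume : Measure (Xsp d m)) hc hv.continuous).1 h3)
  have hsm : IsSm d m v := ⟨hv, hper⟩
  have huv : u =ᵐ[D.μ] v := by
    have hm : MeasurableSet {x : Xsp d m | x.1 ∈ cube d} := measurable_fst measurableSet_cube
    refine ae_μ_iff.2 ?_
    rw [volX, ae_restrict_iff' hm]
    filter_upwards [h1] with x hx hxc
    rw [← hx, fractX_of_mem hxc]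
  refine ⟨v, hsm, huv, ?_⟩
  have hw : IsSm d m fun x => D.G σ v x - f x := (hsm.G σ).sub hf
  have key : ∀ φ, IsTest d m φ → ∫ x, φ x * (D.G σ v x - f x) ∂D.μ = 0 := by
    intro φ hφ
    have e1 := h.eqn φ hφ
    rw [integral_congr_ae (g := fun x => v x * D.G (-σ) φ x)
      (by filter_upwards [huv] with x hx; rw [hx]),
      integral_mul_G hsm hφ.isSm (.inr hφ), neg_neg] at e1
    have : ∀ x, φ x * (D.G σ v x - f x) = φ x * D.G σ v x - f x * φ x := fun x => by ring
    simp only [this]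
    rw [integral_sub (integrable (hφ.mul_right (hsm.G σ))) (integrable (hφ.mul_left hf)), e1, sub_self]
  intro x
  have hR : 0 < max 1 (D.E x) := lt_of_lt_of_le one_pos (le_max_left _ _)
  have ht := (isTest_χ (D := D) hR).mul_right hw
  have h0 := key _ ht
  have hnn : ∀ y, 0 ≤ D.χ (max 1 (D.E x)) y * (D.G σ v y - f y) * (D.G σ v y - f y) := fun y => by
    rw [mul_assoc]; exact mul_nonneg (step_nonneg _) (mul_self_nonneg _)
  have h5 := (integral_eq_zero_iff_of_nonneg hnn (integrable (ht.mul_right hw))).1 h0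
  have h6 := congrFun (eq_zero_of_ae_μ (ht.mul_right hw).isSm h5) x
  simp only [D.χ_eq_one hR (le_max_right 1 (D.E x)), one_mul, Pi.zero_apply, mul_self_eq_zero] at h6
  linarith

lemma weak_of_isTest (h : IsTest d m u) : D.Weak σ u (D.G σ u) where
  meas := h.1.continuous.measurable
  sq := integrable h.sq
  eqn φ hφ := by
    rw [integral_mul_G h.isSm hφ.isSm (.inl h), neg_neg]
    simp only [mul_comm]

lemma exists_plateau {K : Set (Xsp d m)} (hK : IsCompact K) :
    ∃ θ : Xsp d m → ℝ, IsCc θ ∧ ∀ x ∈ K, θ x = 1 := by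
  obtain ⟨R, hR⟩ := hK.isBounded.exists_norm_le
  let B : ContDiffBump (0 : Xsp d m) := ⟨max R 0 + 1, max R 0 + 2, by positivity, by linarith⟩
  refine ⟨B, ⟨B.contDiff, B.hasCompactSupport⟩, fun x hx => B.one_of_mem_closedBall ?_⟩
  rw [mem_closedBall_zero_iff]
  exact (hR x hx).trans ((le_max_left R 0).trans (by show _ ≤ max R 0 + 1; linarith))

lemma exists_bound_integral_J {φ : ℕ → Xsp d m → ℝ} (hφ : ∀ n, IsTest d m (φ n)) {M : ℝ}
    (hM : ∀ n, ∫ x, φ n x ^ 2 ∂D.μ ≤ M) {χ : Fsp d m → ℝ} (hχ : IsCc χ) :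
    ∃ M', ∀ n, ∫ y, (φ n (D.J y) * D.ρ (D.J y) * χ y) ^ 2 ≤ M' := by
  have hψ := hχ.comp_J_symm D
  have hh : IsCc fun x => (D.ρ x * χ (D.J.symm x)) * χ (D.J.symm x) :=
    hψ.mul_left (D.isSm_ρ.1.mul hψ.1)
  obtain ⟨C, hC⟩ := hh.isTest_per.exists_bound
  refine ⟨D.cJ * (C * M), fun n => ?_⟩
  have h1 := integral_J_unfold (hφ n).sq.1.continuous.measurable (integrable (D := D) (hφ n).sq) hh
  simp only [(hφ n).2.1.fractX, D.J.symm_apply_apply] at h1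
  have e : ∀ y, (φ n (D.J y) * D.ρ (D.J y) * χ y) ^ 2
      = φ n (D.J y) ^ 2 * D.ρ (D.J y) * (D.ρ (D.J y) * χ y * χ y) := fun y => by ring
  simp only [e, h1]
  refine mul_le_mul_of_nonneg_left ?_ D.cJ.coe_nonneg
  refine le_trans ?_ (mul_le_mul_of_nonneg_left (hM n) ((abs_nonneg _).trans (hC 0)))
  rw [← integral_const_mul]
  refine integral_mono (integrable ((hφ n).sq.mul_right hh.isTest_per.isSm))
    (integrable ((hφ n).sq.const_mul C)) fun x => ?_
  beta_reduce
  rw [mul_comm C]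
  exact mul_le_mul_of_nonneg_left ((le_abs_self _).trans (hC x)) (sq_nonneg _)

/-- Local compactness. -/
lemma tendsto_integral_local (hσ : σ ^ 2 = 1) {φ : ℕ → Xsp d m → ℝ} (hφ : ∀ n, IsTest d m (φ n)) {M : ℝ}
    (hM : ∀ n, ∫ x, φ n x ^ 2 ∂D.μ ≤ M) (hG : ∀ n, ∫ x, D.G σ (φ n) x ^ 2 ∂D.μ ≤ M)
    (wk : ∀ ψ, IsTest d m ψ → Tendsto (fun n => ∫ x, φ n x * ψ x ∂D.μ) atTop (nhds 0))
    {χ : Xsp d m → ℝ} (hχ : IsTest d m χ) :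
    Tendsto (fun n => ∫ x, (χ x * φ n x) ^ 2 ∂D.μ) atTop (nhds 0) := by
  obtain ⟨K, hK, hK0⟩ := hχ.2.2
  obtain ⟨θ, hθ, hθ1⟩ := exists_plateau ((isCompact_Icc (a := (0 : Fin d → ℝ)) (b := 1)).prod hK)
  have hw : ∀ n, (D.kol σ hσ).WeakSol (D.bc σ) (fun y => φ n (D.J y) * D.ρ (D.J y))
      (fun y => -(D.G σ (φ n) (D.J y) * D.ρ (D.J y))) := by
    intro n
    have := (weak_of_isTest (D := D) (σ := σ) (hφ n)).weakSol hσ ((hφ n).isSm.G σ) (integrable ((hφ n).G σ))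
    simpa only [(hφ n).2.1.fractX] using this
  have lim := KolData.tendsto_integral_sq_of_weakSol
    (U := fun n y => φ n (D.J y) * D.ρ (D.J y))
    (g := fun n y => -(D.G σ (φ n) (D.J y) * D.ρ (D.J y)))
    (fun n => ((hφ n).1.comp D.J_smooth).mul (D.isSm_ρ.1.comp D.J_smooth))
    (fun n => ((((hφ n).isSm.G σ).1.comp D.J_smooth).mul (D.isSm_ρ.1.comp D.J_smooth)).neg) hw
    (fun χ' h' => exists_bound_integral_J hφ hM h')
    (fun χ' h' => by
      obtain ⟨M', hM'⟩ := exists_bound_integral_J (fun n => (hφ n).G σ) hG h'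
      refine ⟨M', fun n => ?_⟩
      simpa only [neg_mul, neg_sq] using hM' n)
    (fun χ' h' => by
      have hψ := h'.comp_J_symm D
      have e : ∀ n, ∫ y, φ n (D.J y) * D.ρ (D.J y) * χ' y
          = D.cJ * ∫ x, φ n x * per (fun x => χ' (D.J.symm x)) x ∂D.μ := fun n => by
        have h1 := integral_J_unfold (hφ n).1.continuous.measurable (integrable (D := D) (hφ n)) hψ
        simpa only [(hφ n).2.1.fractX, D.J.symm_apply_apply] using h1
      simp only [e]
      simpa using (wk _ hψ.isTest_per).const_mul (D.cJ : ℝ))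
    (hθ.comp_J D)
  have hc : (0 : ℝ) < D.cJ := NNReal.coe_pos.2 (pos_iff_ne_zero.2 D.cJ_ne)
  have hq : IsTest d m fun x => (D.ρ x)⁻¹ * χ x ^ 2 :=
    hχ.sq.mul_left (D.isSm_ρ.inv fun x => (D.ρ_pos x).ne')
  obtain ⟨C, hC⟩ := hq.exists_bound
  have hC0 : 0 ≤ C := (abs_nonneg _).trans (hC 0)
  refine squeeze_zero (fun n => integral_nonneg fun x => sq_nonneg _) (fun n => ?_)
    (by simpa using lim.const_mul (C * (D.cJ : ℝ)⁻¹))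
  have e1 : ∫ y, (φ n (D.J y) * D.ρ (D.J y) * θ (D.J y)) ^ 2
      = D.cJ * ∫ x, (φ n x * D.ρ x * θ x) ^ 2 := D.integral_J fun x => (φ n x * D.ρ x * θ x) ^ 2
  rw [e1, mul_assoc, inv_mul_cancel_left₀ hc.ne', integral_μ]
  have h_int : Integrable fun x => (φ n x * D.ρ x * θ x) ^ 2 := by
    have : IsCc fun x => (φ n x * D.ρ x * θ x) * (φ n x * D.ρ x * θ x) :=
      (hθ.mul_left ((hφ n).1.mul D.isSm_ρ.1)).mul_left
        (((hφ n).1.mul D.isSm_ρ.1).mul hθ.1)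
    simp only [pow_two]
    exact this.1.continuous.integrable_of_hasCompactSupport this.2
  calc ∫ x, D.ρ x * (χ x * φ n x) ^ 2 ∂volX d m
      ≤ ∫ x, C * (φ n x * D.ρ x * θ x) ^ 2 ∂volX d m := by
        refine setIntegral_mono_on ((hχ.mul_right (hφ n).isSm).sq.mul_left D.isSm_ρ).integrable_volX
          (h_int.const_mul C).integrableOn (measurable_fst measurableSet_cube) fun x hx => ?_
        by_cases hxK : x.2 ∈ K
        · have h1 : θ x = 1 := hθ1 x ⟨cube_subset_Icc hx, hxK⟩
          have h2 : D.ρ x * (χ x * φ n x) ^ 2 = ((D.ρ x)⁻¹ * χ x ^ 2) * (φ n x * D.ρ x) ^ 2 := by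
            have := (D.ρ_pos x).ne'
            field_simp
          rw [h1, mul_one, h2]
          exact mul_le_mul_of_nonneg_right ((le_abs_self _).trans (hC x)) (sq_nonneg _)
        · rw [hK0 x hxK]
          simp only [zero_mul, ne_eq, OfNat.ofNat_ne_zero, not_false_eq_true, zero_pow, mul_zero]
          exact mul_nonneg hC0 (sq_nonneg _)
    _ ≤ C * ∫ x, (φ n x * D.ρ x * θ x) ^ 2 := by
        rw [integral_const_mul]
        refine mul_le_mul_of_nonneg_left ?_ hC0
        exact setIntegral_le_integral h_int (Eventually.of_forall fun x => sq_nonneg _)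

end Gle

end Weak

section Multiplier

open scoped ContDiff

namespace Gle

variable {d m : ℕ} {D : Gle d m} {σ : ℝ} {u f : Xsp d m → ℝ}

/-- `|z|²`. -/
def zz (x : Xsp d m) : ℝ := ∑ j, ∑ i, (x.2.2 j i) ^ 2

lemma z_sq_le_zz (x : Xsp d m) (j k) : (x.2.2 j k) ^ 2 ≤ zz x := by
  have h1 := Finset.single_le_sum (f := fun i => (x.2.2 j i) ^ 2) (fun i _ => sq_nonneg _) (Finset.mem_univ k)
  have h2 := Finset.single_le_sum (f := fun j => ∑ i, (x.2.2 j i) ^ 2) (fun i _ => by positivity) (Finset.mem_univ j)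
  exact h1.trans h2

lemma zz_nonneg (x : Xsp d m) : 0 ≤ zz x := by unfold zz; positivity

lemma abs_le_one_add_sq (t : ℝ) : |t| ≤ 1 + t ^ 2 := by
  rw [← sq_abs]; nlinarith [sq_nonneg (|t| - 1), abs_nonneg t]

lemma fderiv_inv_E_add {B : ℝ} (hB : ∀ x, D.E x + B ≠ 0) (x v : Xsp d m) :
    fderiv ℝ (fun x => (D.E x + B)⁻¹) x v = -((D.E x + B) ^ 2)⁻¹ * fderiv ℝ D.E x v := by
  have h := (hasDerivAt_inv (hB x)).comp_hasFDerivAt x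
    ((D.isSm_E.differentiable x).hasFDerivAt.add_const B)
  have h' : HasFDerivAt (fun x => (D.E x + B)⁻¹) (-((D.E x + B) ^ 2)⁻¹ • fderiv ℝ D.E x) x := h
  rw [h'.fderiv]; simp

lemma fderiv_pz (x v : Xsp d m) : fderiv ℝ (fun x : Xsp d m => ∑ k, x.2.1 k * x.2.2 D.j0 k) x v
    = ∑ k, (x.2.1 k * v.2.2 D.j0 k + x.2.2 D.j0 k * v.2.1 k) := by
  rw [fderiv_fun_sum fun k _ => (((contDiff_p k).mul (contDiff_z D.j0 k)).differentiable x)]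
  simp only [_root_.sum_apply]
  refine Finset.sum_congr rfl fun k _ => ?_
  rw [fderiv_mul' (contDiff_p k) (contDiff_z D.j0 k), fderiv_p, fderiv_z]

/-- The mixed multiplier transferring dissipation from `z` to `p`. -/
lemma exists_multiplier : ∃ (Φ : Xsp d m → ℝ) (B C : ℝ), IsSm d m Φ ∧ (∀ x, |Φ x| ≤ 1) ∧
    (∀ i x, |dz i Φ x| ≤ 2) ∧ 0 ≤ B ∧ 0 ≤ C ∧ ∀ x, 1 ≤ D.E x + B ∧ 1 + zz x ≤ 2 * (D.E x + B) ∧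
      D.lam D.j0 ≤ -D.T Φ x + C * ((1 + zz x) * (D.E x + B)⁻¹) := by
  obtain ⟨B, hB, hE⟩ := D.exists_bound_E
  choose Cv hCv0 hCv using fun k => (D.dV_per k).exists_bound (D.dV_smooth k).continuous
  have hl := D.hlam D.j0
  have h1 : ∀ x : Xsp d m, 1 ≤ D.E x + (B + 1) := fun x => by
    have := (hE x).1; have := sz_nonneg x; linarith
  have h0 : ∀ x : Xsp d m, D.E x + (B + 1) ≠ 0 := fun x => by have := h1 x; positivity
  have hzz : ∀ x : Xsp d m, sz x = ∑ k, x.2.1 k ^ 2 + zz x := fun x => rfl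
  have hsN : IsSm d m fun x => ∑ k, x.2.1 k * x.2.2 D.j0 k :=
    .sum fun k => (contDiff_p k).mul (contDiff_z D.j0 k)
  have hsi : IsSm d m fun x => (D.E x + (B + 1))⁻¹ := (D.isSm_E.add (.const _)).inv h0
  have hN : ∀ x : Xsp d m, |∑ k, x.2.1 k * x.2.2 D.j0 k| ≤ D.E x + (B + 1) := fun x => by
    have a1 : |∑ k, x.2.1 k * x.2.2 D.j0 k| ≤ ∑ k, (x.2.1 k ^ 2 + x.2.2 D.j0 k ^ 2) / 2 := by
      refine (Finset.abs_sum_le_sum_abs _ _).trans (Finset.sum_le_sum fun k _ => ?_)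
      rw [abs_le]
      constructor <;> nlinarith [sq_nonneg (x.2.1 k - x.2.2 D.j0 k), sq_nonneg (x.2.1 k + x.2.2 D.j0 k)]
    have a2 : ∑ k, x.2.2 D.j0 k ^ 2 ≤ zz x :=
      Finset.single_le_sum (f := fun j => ∑ i, (x.2.2 j i) ^ 2) (fun i _ => by positivity) (Finset.mem_univ D.j0)
    rw [← Finset.sum_div, Finset.sum_add_distrib] at a1
    have := (hE x).1
    have := hzz x
    linarith
  have hbd : ∀ {a b : ℝ}, 1 ≤ b → |a| ≤ b → |a * b⁻¹| ≤ 1 := fun {a b} hb hab => by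
    rw [abs_mul, abs_inv, abs_of_pos (by linarith : 0 < b), ← div_eq_mul_inv]
    exact (div_le_one (by linarith)).2 hab
  have habs : ∀ (x : Xsp d m) {t : ℝ}, t ^ 2 ≤ sz x → |t| ≤ D.E x + (B + 1) := fun x t ht => by
    have := (hE x).1
    have : |t| ≤ (1 + t ^ 2) / 2 := by
      rw [← sq_abs]; nlinarith [sq_nonneg (|t| - 1)]
    have := sz_nonneg x
    linarith
  refine ⟨fun x => (∑ k, x.2.1 k * x.2.2 D.j0 k) * (D.E x + (B + 1))⁻¹, B + 1,
    D.lam D.j0 * (2 + 4 * B) + ∑ k, (Cv k + ∑ j, D.lam j), hsN.mul hsi,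
    fun x => hbd (h1 x) (hN x), fun i x => ?_, by linarith,
    add_nonneg (by positivity) (Finset.sum_nonneg fun k _ => add_nonneg (hCv0 k)
      (Finset.sum_nonneg fun j _ => (D.hlam j).le)), fun x => ⟨h1 x, ?_, ?_⟩⟩
  · rw [dz_mul hsN hsi, dz, dz, fderiv_inv_E_add h0, fderiv_E_ez, fderiv_pz]
    set h := D.E x + (B + 1)
    simp only [ez_snd_fst, ez_apply, Pi.zero_apply, mul_zero, add_zero, mul_ite, mul_one]
    have e : |∑ k, if i = (D.j0, k) then x.2.1 k else 0| ≤ h := by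
      obtain ⟨j, k⟩ := i
      by_cases hj : j = D.j0
      · subst hj
        simp only [Prod.mk.injEq, true_and]
        simpa using habs x (p_sq_le_sz x k)
      · simp only [Prod.mk.injEq, hj, false_and, if_false, Finset.sum_const_zero, abs_zero]
        linarith [h1 x]
    have e2 := hbd (h1 x) (hN x)
    have e3 := hbd (h1 x) (habs x (z_sq_le_sz x i.1 i.2))
    have e4 := hbd (h1 x) e
    have e5 : (∑ k, x.2.1 k * x.2.2 D.j0 k) * (-(h ^ 2)⁻¹ * x.2.2 i.1 i.2) =
        -(((∑ k, x.2.1 k * x.2.2 D.j0 k) * h⁻¹) * (x.2.2 i.1 i.2 * h⁻¹)) := by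
      rw [pow_two, mul_inv]; ring
    rw [e5, mul_comm h⁻¹]
    refine (abs_add_le _ _).trans ?_
    rw [abs_neg, abs_mul ((∑ k, x.2.1 k * x.2.2 D.j0 k) * h⁻¹)]
    have := mul_le_mul e2 e3 (abs_nonneg _) zero_le_one
    linarith
  · have := (hE x).1
    have a3 : 0 ≤ ∑ k, x.2.1 k ^ 2 := by positivity
    have := hzz x
    linarith
  · rw [T_mul hsN hsi, T, fderiv_inv_E_add h0, T_E, T, fderiv_pz]
    set h := D.E x + (B + 1) with hh
    have hp : 0 < h := by linarith [h1 x]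
    have key : D.lam D.j0 * h ≤ -(∑ k, (x.2.1 k * (D.W x).2.2 D.j0 k + x.2.2 D.j0 k * (D.W x).2.1 k))
        + (D.lam D.j0 * (2 + 4 * B) + ∑ k, (Cv k + ∑ j, D.lam j)) * (1 + zz x) := by
      have hz := zz_nonneg x
      have b1 : ∀ k, x.2.1 k * (D.W x).2.2 D.j0 k + x.2.2 D.j0 k * (D.W x).2.1 k ≤
          -(D.lam D.j0 * x.2.1 k ^ 2) + (Cv k + ∑ j, D.lam j) * (1 + zz x) := by
        intro k
        simp only [W, Pi.smul_apply, smul_eq_mul, mul_add, Finset.mul_sum, add_mul, Finset.sum_mul]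
        have c1 : x.2.2 D.j0 k * -D.dV k x.1 ≤ Cv k * (1 + zz x) := by
          refine (le_abs_self _).trans ?_
          rw [abs_mul, abs_neg, mul_comm]
          exact mul_le_mul (hCv k _) ((abs_le_one_add_sq _).trans (by linarith [z_sq_le_zz x D.j0 k]))
            (abs_nonneg _) (hCv0 k)
        have c2 : ∑ j, x.2.2 D.j0 k * (D.lam j * x.2.2 j k) ≤ ∑ j, D.lam j * (1 + zz x) := by
          refine Finset.sum_le_sum fun j _ => ?_
          rw [mul_left_comm]
          refine mul_le_mul_of_nonneg_left ?_ (D.hlam j).le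
          nlinarith [sq_nonneg (x.2.2 D.j0 k - x.2.2 j k), z_sq_le_zz x D.j0 k, z_sq_le_zz x j k]
        simp only [mul_add, mul_one] at c1 c2
        simp only [Finset.sum_add_distrib, mul_one] at c2 ⊢
        linarith [show x.2.1 k * (-D.lam D.j0 * x.2.1 k) = -(D.lam D.j0 * x.2.1 k ^ 2) by ring]
      have b2 := Finset.sum_le_sum fun k (_ : k ∈ Finset.univ) => b1 k
      rw [Finset.sum_add_distrib (f := fun k => -(D.lam D.j0 * x.2.1 k ^ 2)), Finset.sum_neg_distrib, ← Finset.mul_sum, ← Finset.sum_mul] at b2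
      have b3 : h ≤ ∑ k, x.2.1 k ^ 2 + (2 + 4 * B) * (1 + zz x) := by
        have := (hE x).2
        have := hzz x
        nlinarith [mul_nonneg hB hz]
      have b4 := mul_le_mul_of_nonneg_left b3 hl.le
      linarith
    have := mul_le_mul_of_nonneg_right key (inv_nonneg.2 hp.le)
    rw [mul_assoc, mul_inv_cancel₀ hp.ne'] at this
    refine le_trans (le_of_eq (mul_one _).symm) (this.trans (le_of_eq ?_))
    ring

end Gle

end Multiplier

section LocalBound

open scoped ContDiff

namespace Gle

variable {d m : ℕ} {D : Gle d m} {σ : ℝ} {u f : Xsp d m → ℝ}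

lemma young {η : ℝ} (hη : 0 < η) (a b : ℝ) : a * b ≤ η * a ^ 2 + (4 * η)⁻¹ * b ^ 2 := by
  have h : η * a ^ 2 + (4 * η)⁻¹ * b ^ 2 - a * b = (4 * η)⁻¹ * (2 * η * a - b) ^ 2 := by
    field_simp; ring
  have : 0 ≤ (4 * η)⁻¹ * (2 * η * a - b) ^ 2 := by positivity
  linarith

lemma integral_Γ_le (σ : ℝ) {η : ℝ} (hη : 0 < η) (h : IsTest d m u) :
    ∫ x, D.Γ u u x ∂D.μ ≤ η * ∫ x, u x ^ 2 ∂D.μ + (4 * η)⁻¹ * ∫ x, D.G σ u x ^ 2 ∂D.μ := by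
  rw [← integral_mul_G_self h σ, ← integral_const_mul, ← integral_const_mul,
    ← integral_add (integrable (h.sq.const_mul _)) (integrable ((h.G σ).sq.const_mul _))]
  exact integral_mono (integrable (h.mul_right (h.G σ).isSm))
    (integrable ((h.sq.const_mul _).add ((h.G σ).sq.const_mul _))) fun x => young hη _ _

lemma dz_sq_le (i) (x : Xsp d m) : dz i u x ^ 2 ≤ (D.a i)⁻¹ * D.Γ u u x := by
  have h := D.a_pos i
  have : D.a i * (dz i u x * dz i u x) ≤ D.Γ u u x :=
    Finset.single_le_sum (f := fun i => D.a i * (dz i u x * dz i u x))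
      (fun i _ => mul_nonneg (D.a_pos i).le (mul_self_nonneg _)) (Finset.mem_univ i)
  rw [← div_eq_inv_mul, le_div_iff₀ h]
  linarith [pow_two (dz i u x), mul_comm (D.a i) (dz i u x ^ 2)]

variable (D) in
lemma exists_moment_bound : ∃ C, 0 ≤ C ∧ ∀ u, IsTest d m u →
    ∫ x, zz x * u x ^ 2 ∂D.μ ≤ C * (∫ x, u x ^ 2 ∂D.μ + ∫ x, D.Γ u u x ∂D.μ) := by
  have hβ := D.hβ
  have key : ∀ (i : Fin m × Fin d) u, IsTest d m u → ∫ x, x.2.2 i.1 i.2 ^ 2 * u x ^ 2 ∂D.μ ≤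
      (2 / D.β * (1 + 2 / D.β * (D.a i)⁻¹)) * (∫ x, u x ^ 2 ∂D.μ + ∫ x, D.Γ u u x ∂D.μ) := by
    intro i u h
    have hz : IsSm d m fun x => x.2.2 i.1 i.2 := contDiff_z i.1 i.2
    have hi := inv_pos.2 (D.a_pos i)
    have h1 := integral_dz (D := D) ((h.mul_right h.isSm).mul_right hz) i
    have e1 : ∀ x, dz i (fun x => u x * u x * x.2.2 i.1 i.2) x
        = u x ^ 2 + 2 * (x.2.2 i.1 i.2 * u x * dz i u x) := fun x => by
      rw [dz_mul (h.isSm.mul h.isSm) hz, dz_mul h.isSm h.isSm]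
      have : dz i (fun x : Xsp d m => x.2.2 i.1 i.2) x = 1 := by
        rw [dz, fderiv_z, ez_apply]; simp
      rw [this]; ring
    have e2 : ∀ x : Xsp d m, u x * u x * x.2.2 i.1 i.2 * x.2.2 i.1 i.2
      = x.2.2 i.1 i.2 ^ 2 * u x ^ 2 := fun x => by ring
    simp only [e1, e2] at h1
    have i1 : IsTest d m fun x => x.2.2 i.1 i.2 ^ 2 * u x ^ 2 := h.sq.mul_left hz.sq
    have h2 : ∫ x, (u x ^ 2 + 2 * (x.2.2 i.1 i.2 * u x * dz i u x)) ∂D.μ ≤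
        ∫ x, (u x ^ 2 + D.β / 2 * (x.2.2 i.1 i.2 ^ 2 * u x ^ 2) + 2 / D.β * (D.a i)⁻¹ * D.Γ u u x) ∂D.μ := by
      refine integral_mono (integrable (h.sq.add (((h.mul_left hz).mul_right (h.dz i).isSm).const_mul 2)))
        (integrable ((h.sq.add (i1.const_mul _)).add ((h.Γ h.isSm).const_mul _))) fun x => ?_
      have y := young (η := D.β / 4) (by positivity) (x.2.2 i.1 i.2 * u x) (dz i u x)
      have y2 := mul_le_mul_of_nonneg_left (dz_sq_le (D := D) (u := u) i x) (by positivity : 0 ≤ 2 / D.β)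
      rw [show (4 * (D.β / 4))⁻¹ = (2 / D.β) / 2 by field_simp] at y
      rw [← mul_assoc] at y2
      beta_reduce
      linarith [mul_pow (x.2.2 i.1 i.2) (u x) 2]
    rw [h1, integral_add_three (integrable h.sq) (integrable (i1.const_mul _))
      (integrable ((h.Γ h.isSm).const_mul _)), integral_const_mul, integral_const_mul] at h2
    have p1 : 0 ≤ ∫ x, u x ^ 2 ∂D.μ := integral_nonneg fun x => sq_nonneg _
    have p2 : 0 ≤ ∫ x, D.Γ u u x ∂D.μ := integral_nonneg fun x => Γ_nonneg x
    set J := ∫ x, x.2.2 i.1 i.2 ^ 2 * u x ^ 2 ∂D.μ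
    set c := 2 / D.β * (D.a i)⁻¹
    have hc : 0 ≤ c := by positivity
    have h3 : D.β / 2 * J ≤ (1 + c) * (∫ x, u x ^ 2 ∂D.μ + ∫ x, D.Γ u u x ∂D.μ) := by
      nlinarith [mul_nonneg hc p1]
    have h4 := mul_le_mul_of_nonneg_left h3 (by positivity : 0 ≤ 2 / D.β)
    rw [← mul_assoc, ← mul_assoc, show 2 / D.β * (D.β / 2) = 1 by field_simp, one_mul] at h4
    exact h4
  refine ⟨∑ i : Fin m × Fin d, 2 / D.β * (1 + 2 / D.β * (D.a i)⁻¹), Finset.sum_nonneg fun i _ => ?_,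
    fun u h => ?_⟩
  · have := inv_pos.2 (D.a_pos i); positivity
  · have e : ∀ x : Xsp d m, zz x * u x ^ 2 = ∑ i : Fin m × Fin d, x.2.2 i.1 i.2 ^ 2 * u x ^ 2 := fun x => by
      rw [zz, ← Fintype.sum_prod_type' (f := fun j i => x.2.2 j i ^ 2), Finset.sum_mul]
    simp only [e]
    rw [integral_finsetSum _ fun i _ => integrable (h.sq.mul_left (contDiff_z i.1 i.2).sq), Finset.sum_mul]
    exact Finset.sum_le_sum fun i _ => key i u h

lemma abs_mul_le_of_abs_le_one {s : ℝ} (hs : |s| ≤ 1) (t : ℝ) : s * t ≤ |t| := by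
  refine (le_abs_self _).trans ?_
  rw [abs_mul]
  exact mul_le_of_le_one_left (abs_nonneg _) hs

lemma exists_multiplier_bound (hσ : σ ^ 2 = 1) {Φ : Xsp d m → ℝ} (hΦ : IsSm d m Φ) (h1 : ∀ x, |Φ x| ≤ 1)
    (h2 : ∀ i x, |dz i Φ x| ≤ 2) {δ : ℝ} (hδ : 0 < δ) : ∃ C, 0 ≤ C ∧ ∀ u, IsTest d m u →
    ∫ x, -D.T Φ x * u x ^ 2 ∂D.μ ≤ δ * ∫ x, u x ^ 2 ∂D.μ + C * ∫ x, D.G σ u x ^ 2 ∂D.μ := by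
  set A := ∑ i, D.a i with hA
  have hA0 : 0 ≤ A := Finset.sum_nonneg fun i _ => (D.a_pos i).le
  set κ := δ / (2 * (4 * A + 2)) with hκ
  have hκ0 : 0 < κ := by positivity
  set c := 2 + κ⁻¹ with hc
  have hc0 : 0 < c := by positivity
  set η := δ / (2 * c) with hη
  have hη0 : 0 < η := by positivity
  have hs1 : |σ| = 1 := by rw [← Real.sqrt_sq_eq_abs, hσ, Real.sqrt_one]
  refine ⟨c * (4 * η)⁻¹ + (2 * κ)⁻¹, by positivity, fun u h => ?_⟩
  have hσΦ : ∀ x, |σ * Φ x| ≤ 1 := fun x => by rw [abs_mul, hs1, one_mul]; exact h1 x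
  have iΦu : IsTest d m fun x => Φ x * u x := h.mul_left hΦ
  have e1 : ∫ x, -D.T Φ x * u x ^ 2 ∂D.μ = 2 * σ * ∫ x, Φ x * u x * D.S u x ∂D.μ
      - 2 * σ * ∫ x, Φ x * u x * D.G σ u x ∂D.μ := by
    have t := integral_mul_T (D := D) hΦ (h.mul_right h.isSm).isSm (.inr (h.mul_right h.isSm))
    rw [← integral_const_mul, ← integral_const_mul, ← integral_sub
      (integrable ((iΦu.mul_right h.S.isSm).const_mul _))
      (integrable ((iΦu.mul_right (h.G σ).isSm).const_mul _))]
    have t1 : ∫ x, -D.T Φ x * u x ^ 2 ∂D.μ = - ∫ x, u x * u x * D.T Φ x ∂D.μ := by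
      rw [← integral_neg]; congr 1; ext x; ring
    rw [t1, ← t]
    congr 1; ext x
    rw [T_mul h.isSm h.isSm, G]
    linear_combination (-2 * Φ x * u x * D.T u x) * hσ
  rw [e1, integral_mul_S iΦu.isSm h.isSm (.inr h)]
  have hG := integral_Γ_le (D := D) σ hη0 h
  have e2 : 2 * σ * ∫ x, D.Γ (fun x => Φ x * u x) u x ∂D.μ - 2 * σ * ∫ x, Φ x * u x * D.G σ u x ∂D.μ ≤
      c * ∫ x, D.Γ u u x ∂D.μ + (4 * A + 2) * κ * ∫ x, u x ^ 2 ∂D.μ + (2 * κ)⁻¹ * ∫ x, D.G σ u x ^ 2 ∂D.μ := by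
    simp only [← integral_const_mul]
    rw [← integral_sub (integrable ((iΦu.Γ h.isSm).const_mul _))
      (integrable ((iΦu.mul_right (h.G σ).isSm).const_mul _)), ← integral_add_three
      (integrable ((h.Γ h.isSm).const_mul _)) (integrable (h.sq.const_mul _))
      (integrable ((h.G σ).sq.const_mul _))]
    refine integral_mono (integrable ((iΦu.Γ h.isSm).const_mul _) |>.sub
      (integrable ((iΦu.mul_right (h.G σ).isSm).const_mul _)))
      (integrable ((((h.Γ h.isSm).const_mul _).add (h.sq.const_mul _)).add
      ((h.G σ).sq.const_mul _))) fun x => ?_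
    beta_reduce
    have y1 : -(2 * σ * (Φ x * u x * D.G σ u x)) ≤ 2 * (κ * u x ^ 2 + (4 * κ)⁻¹ * D.G σ u x ^ 2) := by
      have := abs_mul_le_of_abs_le_one (by rw [abs_neg]; exact hσΦ x : |-(σ * Φ x)| ≤ 1) (u x * D.G σ u x)
      rw [abs_mul] at this
      have y := young hκ0 |u x| |D.G σ u x|
      rw [sq_abs, sq_abs] at y
      linarith
    have y2 : 2 * σ * D.Γ (fun x => Φ x * u x) u x ≤ c * D.Γ u u x + 4 * A * κ * u x ^ 2 := by
      simp only [Γ, Finset.mul_sum, hA, Finset.sum_mul]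
      rw [← Finset.sum_add_distrib]
      refine Finset.sum_le_sum fun i _ => ?_
      have ha := (D.a_pos i).le
      rw [dz_mul hΦ h.isSm]
      have z1 := abs_mul_le_of_abs_le_one (hσΦ x) (dz i u x * dz i u x)
      rw [abs_mul_self] at z1
      have z2 : |σ * dz i Φ x / 2| ≤ 1 := by
        rw [abs_div, abs_mul, hs1, abs_two]; linarith [h2 i x]
      have z3 := abs_mul_le_of_abs_le_one z2 (u x * dz i u x)
      rw [abs_mul] at z3
      have y := young hκ0 |u x| |dz i u x|
      rw [sq_abs, sq_abs] at y
      have y4 : (4 * κ)⁻¹ = κ⁻¹ / 4 := by rw [mul_inv]; ring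
      rw [y4] at y
      have z4 : 2 * σ * ((Φ x * dz i u x + u x * dz i Φ x) * dz i u x)
          ≤ c * (dz i u x * dz i u x) + 4 * κ * u x ^ 2 := by
        rw [hc]; linarith [pow_two (dz i u x)]
      have := mul_le_mul_of_nonneg_left z4 ha
      linarith
    have y4 : (2 * κ)⁻¹ = 2 * (4 * κ)⁻¹ := by rw [mul_inv, mul_inv]; ring
    rw [y4]
    linarith
  have e3 : (4 * A + 2) * κ = δ / 2 := by rw [hκ]; field_simp
  have e4 : c * η = δ / 2 := by rw [hη]; field_simp
  have e5 := mul_le_mul_of_nonneg_left hG hc0.le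
  rw [mul_add, ← mul_assoc, e4, ← mul_assoc] at e5
  rw [e3] at e2
  linarith

/-- A priori estimate modulo a local term. -/
lemma exists_local_bound (D : Gle d m) (hσ : σ ^ 2 = 1) : ∃ R C, 0 < R ∧ 0 ≤ C ∧ ∀ u, IsTest d m u →
    ∫ x, u x ^ 2 ∂D.μ ≤ C * (∫ x, (D.χ R x * u x) ^ 2 ∂D.μ + ∫ x, D.G σ u x ^ 2 ∂D.μ) := by
  obtain ⟨Φ, B, C1, hΦ, hΦ1, hΦ2, hB, hC1, hh⟩ := exists_multiplier (D := D)
  obtain ⟨Cm, hCm, hmom⟩ := D.exists_moment_bound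
  have hl := D.hlam D.j0
  set l := D.lam D.j0
  obtain ⟨Cd, hCd, hmul⟩ := exists_multiplier_bound (D := D) hσ hΦ hΦ1 hΦ2 (δ := l / 4) (by positivity)
  set R := 1 + 4 * C1 * (1 + 2 * Cm) / l with hR
  have hR0 : 0 < R := by positivity
  have hRl : C1 * (R⁻¹ * (1 + 2 * Cm)) ≤ l / 4 := by
    rw [← mul_assoc, mul_comm C1, mul_assoc, ← div_eq_inv_mul, div_le_iff₀ hR0, hR]
    have : l / 4 * (1 + 4 * C1 * (1 + 2 * Cm) / l) = l / 4 + C1 * (1 + 2 * Cm) := by field_simp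
    linarith
  have hR1 : R⁻¹ ≤ 1 := inv_le_one_of_one_le₀ (by rw [hR]; linarith [show 0 ≤ 4 * C1 * (1 + 2 * Cm) / l by positivity])
  refine ⟨R, 2 / l * (Cd + 2 * C1 + C1 * Cm), hR0, by positivity, fun u h => ?_⟩
  have hszz : IsSm d m (zz : Xsp d m → ℝ) := .sum fun j => .sum fun i => (contDiff_z j i).sq
  have hpt : ∀ x, l * u x ^ 2 ≤ -D.T Φ x * u x ^ 2 + C1 * 2 * (D.χ R x * u x) ^ 2
      + C1 * R⁻¹ * (u x ^ 2 + zz x * u x ^ 2) := by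
    intro x
    obtain ⟨g1, g2, g3⟩ := hh x
    have hp : 0 < D.E x + B := by linarith
    have hz := zz_nonneg x
    have g4 : (1 + zz x) * (D.E x + B)⁻¹ ≤ 2 * D.χ R x ^ 2 + R⁻¹ * (1 + zz x) := by
      rcases le_or_gt (D.E x) R with hx | hx
      · rw [χ_eq_one hR0 hx]
        have : (1 + zz x) * (D.E x + B)⁻¹ ≤ 2 := by
          rw [← div_eq_mul_inv, div_le_iff₀ hp]; exact g2
        have : 0 ≤ R⁻¹ * (1 + zz x) := by positivity
        linarith
      · have : (D.E x + B)⁻¹ ≤ R⁻¹ := inv_anti₀ hR0 (by linarith)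
        have := mul_le_mul_of_nonneg_left this (by positivity : 0 ≤ 1 + zz x)
        have : 0 ≤ D.χ R x ^ 2 := sq_nonneg _
        linarith
    have g5 := mul_le_mul_of_nonneg_right (g3.trans (add_le_add_right (mul_le_mul_of_nonneg_left g4 hC1) _)) (sq_nonneg (u x))
    refine g5.trans (le_of_eq ?_)
    ring
  have t1 := (IsTest.mul_left h.sq (ψ := fun x => -D.T Φ x)
    (by simpa using (IsSm.const_mul (IsSm.T (D := D) hΦ) (-1))))
  have t2 := (h.mul_left (isTest_χ (D := D) hR0).isSm).sq
  have t3 := h.sq.mul_left hszz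
  have h_int : l * ∫ x, u x ^ 2 ∂D.μ ≤ ∫ x, -D.T Φ x * u x ^ 2 ∂D.μ
      + C1 * 2 * ∫ x, (D.χ R x * u x) ^ 2 ∂D.μ + C1 * R⁻¹ * (∫ x, u x ^ 2 ∂D.μ + ∫ x, zz x * u x ^ 2 ∂D.μ) := by
    rw [← integral_add (integrable h.sq) (integrable t3)]
    simp only [← integral_const_mul]
    rw [← integral_add_three (integrable t1) (integrable (t2.const_mul _)) (integrable ((h.sq.add t3).const_mul _))]
    exact integral_mono (integrable (h.sq.const_mul _))
      (integrable ((t1.add (t2.const_mul _)).add ((h.sq.add t3).const_mul _))) hpt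
  have m1 := hmom u h
  have m2 := integral_Γ_le (D := D) σ one_pos h
  have m3 := hmul u h
  have p1 : 0 ≤ ∫ x, u x ^ 2 ∂D.μ := integral_nonneg fun x => sq_nonneg _
  have p2 : 0 ≤ ∫ x, D.G σ u x ^ 2 ∂D.μ := integral_nonneg fun x => sq_nonneg _
  have p3 : 0 ≤ ∫ x, (D.χ R x * u x) ^ 2 ∂D.μ := integral_nonneg fun x => sq_nonneg _
  set I := ∫ x, u x ^ 2 ∂D.μ
  set g := ∫ x, D.G σ u x ^ 2 ∂D.μ
  set X := ∫ x, (D.χ R x * u x) ^ 2 ∂D.μ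
  have m4 : I + ∫ x, zz x * u x ^ 2 ∂D.μ ≤ (1 + 2 * Cm) * I + Cm * g := by
    have : I + ∫ x, D.Γ u u x ∂D.μ ≤ 2 * I + g := by linarith
    have := mul_le_mul_of_nonneg_left this hCm
    linarith
  have m5 := mul_le_mul_of_nonneg_left m4 (by positivity : 0 ≤ C1 * R⁻¹)
  have m6 := mul_le_mul_of_nonneg_right hRl p1
  have m7 : C1 * R⁻¹ * (Cm * g) ≤ C1 * Cm * g := by
    have := mul_le_mul_of_nonneg_left hR1 (by positivity : 0 ≤ C1 * Cm * g)
    linarith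
  have m8 : l / 2 * I ≤ (Cd + 2 * C1 + C1 * Cm) * (X + g) := by
    have : 0 ≤ Cd * X := by positivity
    have : 0 ≤ C1 * g := by positivity
    have : 0 ≤ C1 * Cm * X := by positivity
    linarith
  have m9 := mul_le_mul_of_nonneg_left m8 (by positivity : 0 ≤ 2 / l)
  rw [← mul_assoc, ← mul_assoc, show 2 / l * (l / 2) = 1 by field_simp, one_mul] at m9
  exact m9

end Gle

end LocalBound

section Apriori

open scoped ContDiff

section Hilbert

variable {H : Type*} [NormedAddCommGroup H] [InnerProductSpace ℝ H] [CompleteSpace H]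

lemma exists_weak_subseq [TopologicalSpace.SeparableSpace H] (v : ℕ → H) {M : ℝ} (hv : ∀ n, ‖v n‖ ≤ M) :
    ∃ (w : H) (s : ℕ → ℕ), StrictMono s ∧
      ∀ h, Tendsto (fun n => inner ℝ (v (s n)) h) atTop (nhds (inner ℝ w h)) := by
  have hK := WeakDual.isSeqCompact_closedBall ℝ H 0 M
  obtain ⟨L, -, s, hs, hL⟩ := hK (x := fun n => StrongDual.toWeakDual (InnerProductSpace.toDual ℝ H (v n)))
    fun n => by
      show InnerProductSpace.toDual ℝ H (v n) ∈ Metric.closedBall 0 M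
      simpa using hv n
  refine ⟨(InnerProductSpace.toDual ℝ H).symm (WeakDual.toStrongDual L), s, hs, fun h => ?_⟩
  have := ((WeakDual.eval_continuous h).tendsto L).comp hL
  rw [InnerProductSpace.toDual_symm_apply]
  exact this

lemma exists_inner_repr {M : Type*} [AddCommGroup M] [Module ℝ M] (A : M →ₗ[ℝ] H) (L : M →ₗ[ℝ] ℝ)
    {C : ℝ} (h : ∀ x, |L x| ≤ C * ‖A x‖) : ∃ w : H, ∀ x, L x = inner ℝ w (A x) := by
  have hL : L ∈ LinearMap.range A.dualMap := by
    rw [LinearMap.range_dualMap_eq_dualAnnihilator_ker, Submodule.mem_dualAnnihilator]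
    intro x hx
    have := h x
    rw [LinearMap.mem_ker.1 hx, norm_zero, mul_zero] at this
    exact abs_nonpos_iff.1 this
  obtain ⟨l, hl⟩ := hL
  have hl' : ∀ x, l (A x) = L x := fun x => LinearMap.congr_fun hl x
  let g : StrongDual ℝ (LinearMap.range A) := (l.comp (LinearMap.range A).subtype).mkContinuous C (by
    rintro ⟨_, x, rfl⟩
    simpa [hl'] using h x)
  obtain ⟨G, hG, -⟩ := exists_extension_norm_eq (LinearMap.range A) g
  refine ⟨(InnerProductSpace.toDual ℝ H).symm G, fun x => ?_⟩
  rw [InnerProductSpace.toDual_symm_apply, hG ⟨A x, x, rfl⟩]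
  exact (hl' x).symm

end Hilbert

lemma inner_toLp {X : Type*} [MeasurableSpace X] {ν : Measure X} {a b : X → ℝ} (ha : MemLp a 2 ν)
    (hb : MemLp b 2 ν) : inner ℝ (ha.toLp a) (hb.toLp b) = ∫ x, a x * b x ∂ν := by
  rw [L2.inner_def]
  refine integral_congr_ae ?_
  filter_upwards [ha.coeFn_toLp, hb.coeFn_toLp] with x h1 h2
  rw [h1, h2, real_inner_eq_re_inner]
  simp [mul_comm]

lemma norm_toLp_sq {X : Type*} [MeasurableSpace X] {ν : Measure X} {a : X → ℝ} (ha : MemLp a 2 ν) :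
    ‖ha.toLp a‖ ^ 2 = ∫ x, a x ^ 2 ∂ν := by
  rw [← real_inner_self_eq_norm_sq, inner_toLp]
  simp only [pow_two]

/-- Cauchy-Schwarz. -/
lemma integral_mul_sq_le {X : Type*} [MeasurableSpace X] {ν : Measure X} {a b : X → ℝ} (ha : MemLp a 2 ν)
    (hb : MemLp b 2 ν) : (∫ x, a x * b x ∂ν) ^ 2 ≤ (∫ x, a x ^ 2 ∂ν) * ∫ x, b x ^ 2 ∂ν := by
  rw [← inner_toLp ha hb, ← norm_toLp_sq ha, ← norm_toLp_sq hb, ← mul_pow, ← sq_abs]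
  exact pow_le_pow_left₀ (abs_nonneg _) (abs_real_inner_le_norm _ _) 2

namespace Gle

variable {d m : ℕ} {D : Gle d m} {σ : ℝ} {u f φ ψ : Xsp d m → ℝ}

lemma _root_.IsTest.memLp (h : IsTest d m φ) (D : Gle d m) : MemLp φ 2 D.μ :=
  (memLp_two_iff_integrable_sq h.isSm.continuous.aestronglyMeasurable).2 (integrable h.sq)

lemma G_linear (h : IsSm d m φ) (h' : IsSm d m ψ) (σ c c' : ℝ) (x) :
    D.G σ (fun x => c * φ x + c' * ψ x) x = c * D.G σ φ x + c' * D.G σ ψ x := by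
  have e : ∀ {φ ψ : Xsp d m → ℝ}, IsSm d m φ → IsSm d m ψ → ∀ y v,
      fderiv ℝ (fun x => c * φ x + c' * ψ x) y v = c * fderiv ℝ φ y v + c' * fderiv ℝ ψ y v :=
    fun h h' y v => by
      rw [(((h.differentiable y).hasFDerivAt.const_mul c).fun_add
        ((h'.differentiable y).hasFDerivAt.const_mul c')).fderiv]
      simp
  have h2 : ∀ j, dz j (fun x => c * φ x + c' * ψ x) = fun x => c * dz j φ x + c' * dz j ψ x := fun j => by
    ext y; exact e h h' y _
  have h3 : ∀ j, dz j (fun x => c * dz j φ x + c' * dz j ψ x) x = c * dz j (dz j φ) x + c' * dz j (dz j ψ) x :=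
    fun j => e (h.dz j) (h'.dz j) x _
  simp only [G, T, S, h2, h3, e h h', mul_add, Finset.sum_add_distrib]
  simp only [mul_left_comm (D.a _), ← Finset.mul_sum]
  ring

lemma G_const_mul (h : IsSm d m φ) (σ c : ℝ) (x) : D.G σ (fun x => c * φ x) x = c * D.G σ φ x := by
  simpa using G_linear (D := D) h h σ c 0 x

lemma tendsto_of_weak_limit (hσ : σ ^ 2 = 1) {φ : ℕ → Xsp d m → ℝ} (hφ : ∀ n, IsTest d m (φ n))
    (w : Lp ℝ 2 D.μ)
    (hw : ∀ h, Tendsto (fun n => inner ℝ (((hφ n).memLp D).toLp _) h) atTop (nhds (inner ℝ w h)))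
    (hG : Tendsto (fun n => ∫ x, D.G σ (φ n) x ^ 2 ∂D.μ) atTop (nhds 0))
    (h0 : Tendsto (fun n => ∫ x, φ n x ∂D.μ) atTop (nhds 0)) :
    ∀ ψ, IsTest d m ψ → Tendsto (fun n => ∫ x, φ n x * ψ x ∂D.μ) atTop (nhds 0) := by
  have hmw := Lp.memLp w
  have hms := Lp.aestronglyMeasurable w
  set w' := hms.mk w with hw'
  have hae : (w : Xsp d m → ℝ) =ᵐ[D.μ] w' := hms.ae_eq_mk
  have hmw' : MemLp w' 2 D.μ := hmw.ae_eq hae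
  have hww : w = hmw'.toLp w' := by
    rw [← Lp.toLp_coeFn w hmw]; exact (MemLp.toLp_eq_toLp_iff _ _).2 hae
  have hlim : ∀ ψ, MemLp ψ 2 D.μ → Tendsto (fun n => ∫ x, φ n x * ψ x ∂D.μ) atTop
      (nhds (∫ x, w' x * ψ x ∂D.μ)) := fun ψ hψ => by
    have := hw (hψ.toLp ψ)
    rw [hww] at this
    simpa only [inner_toLp] using this
  have hweak : D.Weak σ w' fun _ => 0 := by
    refine ⟨hms.stronglyMeasurable_mk.measurable, hmw'.integrable_sq, fun ψ hψ => ?_⟩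
    simp only [zero_mul, integral_zero]
    refine tendsto_nhds_unique (hlim _ ((hψ.G (-σ)).memLp D)) ?_
    have e : ∀ n, ∫ x, φ n x * D.G (-σ) ψ x ∂D.μ = ∫ x, ψ x * D.G σ (φ n) x ∂D.μ := fun n => by
      rw [integral_mul_G (hφ n).isSm hψ.isSm (.inr hψ), neg_neg]
    simp only [e]
    have h1 : Tendsto (fun n => (∫ x, ψ x * D.G σ (φ n) x ∂D.μ) ^ 2) atTop (nhds 0) := by
      refine squeeze_zero (fun n => sq_nonneg _)
        (fun n => integral_mul_sq_le (hψ.memLp D) (((hφ n).G σ).memLp D)) ?_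
      simpa using hG.const_mul (∫ x, ψ x ^ 2 ∂D.μ)
    have h2 := h1.sqrt
    simp only [Real.sqrt_sq_eq_abs, Real.sqrt_zero] at h2
    exact (tendsto_zero_iff_abs_tendsto_zero _).2 h2
  obtain ⟨v, hv, hwv, hGv⟩ := hweak.exists_isSm hσ (.const 0) (integrable_zero _ _ _)
  have hconst := const_of_G_eq_zero hv (hweak.sq.congr (hwv.mono fun x hx => by simp only [hx]))
    (by rintro rfl; simp at hσ) hGv
  have hv0 : v 0 = 0 := by
    have h1 := hlim (fun _ => 1) (memLp_const 1)
    simp only [mul_one] at h1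
    have h2 := tendsto_nhds_unique h1 h0
    rw [integral_congr_ae hwv] at h2
    simpa [hconst] using h2
  intro ψ hψ
  have : ∫ x, w' x * ψ x ∂D.μ = 0 := by
    rw [integral_congr_ae (g := fun _ => 0)]
    · simp
    · filter_upwards [hwv] with x hx
      rw [hx, hconst, hv0, zero_mul]
  rw [← this]
  exact hlim ψ (hψ.memLp D)

/-- A priori estimate on test functions. -/
lemma exists_apriori_bound (D : Gle d m) (hσ : σ ^ 2 = 1) : ∃ C, 0 ≤ C ∧ ∀ φ, IsTest d m φ →
    ∫ x, φ x ^ 2 ∂D.μ ≤ C * (∫ x, D.G σ φ x ^ 2 ∂D.μ + (∫ x, φ x ∂D.μ) ^ 2) := by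
  by_contra! hcon
  choose φ hφ hlt using fun n : ℕ => hcon (n + 1) (by positivity)
  set N : ℕ → ℝ := fun n => ∫ x, φ n x ^ 2 ∂D.μ with hN
  have hN0 : ∀ n, 0 < N n := fun n => lt_of_le_of_lt (mul_nonneg (by positivity)
    (add_nonneg (integral_nonneg fun x => sq_nonneg _) (sq_nonneg _))) (hlt n)
  set c : ℕ → ℝ := fun n => (√(N n))⁻¹ with hc
  have hc2 : ∀ n, c n ^ 2 = (N n)⁻¹ := fun n => by rw [hc]; simp only [inv_pow, Real.sq_sqrt (hN0 n).le]
  set v : ℕ → Xsp d m → ℝ := fun n x => c n * φ n x with hv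
  have hvt : ∀ n, IsTest d m (v n) := fun n => (hφ n).const_mul (c n)
  have hv1 : ∀ n, ∫ x, v n x ^ 2 ∂D.μ = 1 := fun n => by
    simp only [hv, mul_pow, integral_const_mul, hc2]
    exact inv_mul_cancel₀ (hN0 n).ne'
  have hsmall : ∀ n, ∫ x, D.G σ (v n) x ^ 2 ∂D.μ + (∫ x, v n x ∂D.μ) ^ 2 ≤ 1 / ((n : ℝ) + 1) := fun n => by
    simp only [hv, fun x => G_const_mul (D := D) (hφ n).isSm σ (c n) x, mul_pow, integral_const_mul, hc2]
    rw [← mul_add, inv_mul_le_iff₀ (hN0 n), mul_one_div, le_div_iff₀ (by positivity)]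
    linarith [hlt n]
  have hp : ∀ n, 0 ≤ ∫ x, D.G σ (v n) x ^ 2 ∂D.μ := fun n => integral_nonneg fun x => sq_nonneg _
  have hG : Tendsto (fun n => ∫ x, D.G σ (v n) x ^ 2 ∂D.μ) atTop (nhds 0) :=
    squeeze_zero hp (fun n => by linarith [hsmall n, sq_nonneg (∫ x, v n x ∂D.μ)])
      tendsto_one_div_add_atTop_nhds_zero_nat
  have hm : Tendsto (fun n => ∫ x, v n x ∂D.μ) atTop (nhds 0) := by
    have h1 : Tendsto (fun n => (∫ x, v n x ∂D.μ) ^ 2) atTop (nhds 0) :=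
      squeeze_zero (fun n => sq_nonneg _) (fun n => by linarith [hsmall n, hp n])
        tendsto_one_div_add_atTop_nhds_zero_nat
    have h2 := h1.sqrt
    simp only [Real.sqrt_sq_eq_abs, Real.sqrt_zero] at h2
    exact (tendsto_zero_iff_abs_tendsto_zero _).2 h2
  have : Fact ((2 : ENNReal) ≠ ⊤) := ⟨by simp⟩
  have : MeasurableSpace.CountablyGenerated (Xsp d m) := inferInstance
  obtain ⟨w, s, hs, hw⟩ := exists_weak_subseq (fun n => ((hvt n).memLp D).toLp _) (M := 1) fun n => by
    rw [← abs_norm, ← sq_le_one_iff_abs_le_one, norm_toLp_sq, hv1]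
  have hwk := tendsto_of_weak_limit hσ (fun n => hvt (s n)) w hw (hG.comp hs.tendsto_atTop) (hm.comp hs.tendsto_atTop)
  obtain ⟨R, C, hR, hC, hb⟩ := exists_local_bound D hσ
  have hG1 : ∀ n, ∫ x, D.G σ (v n) x ^ 2 ∂D.μ ≤ 1 := fun n => by
    have h1 : 1 / ((n : ℝ) + 1) ≤ 1 := by
      rw [div_le_one (by positivity)]; linarith [(Nat.cast_nonneg n : (0 : ℝ) ≤ n)]
    linarith [hsmall n, sq_nonneg (∫ x, v n x ∂D.μ)]
  have hloc := tendsto_integral_local hσ (fun n => hvt (s n)) (M := 1) (fun n => (hv1 _).le)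
    (fun n => hG1 _) hwk (isTest_χ (D := D) hR)
  have hlim := (hloc.add (hG.comp hs.tendsto_atTop)).const_mul C
  simp only [add_zero, mul_zero] at hlim
  have := ge_of_tendsto' hlim fun n => (hv1 (s n)).symm.le.trans (hb _ (hvt (s n)))
  linarith

end Gle

end Apriori

section Existence

open scoped ContDiff

namespace Gle

variable {d m : ℕ} {D : Gle d m} {σ : ℝ} {u f φ ψ : Xsp d m → ℝ}

lemma eventually_χ_eq_one (D : Gle d m) (x : Xsp d m) :
    ∀ᶠ n : ℕ in atTop, D.χ ((n : ℝ) + 1) x = 1 ∧ D.G σ (D.χ ((n : ℝ) + 1)) x = 0 := by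
  filter_upwards [eventually_ge_atTop ⌈D.E x⌉₊] with n hn
  have hx : D.E x < (n : ℝ) + 1 := by
    have := (Nat.le_ceil (D.E x)).trans (Nat.cast_le.2 hn)
    linarith
  have hn0 : (0 : ℝ) < n + 1 := by positivity
  refine ⟨χ_eq_one hn0 hx.le, ?_⟩
  have : D.χ ((n : ℝ) + 1) =ᶠ[nhds x] fun _ => 1 := by
    filter_upwards [D.isSm_E.continuous.continuousAt.eventually (Iio_mem_nhds hx)] with y hy
    exact χ_eq_one hn0 (le_of_lt hy)
  rw [D.G_congr this]
  have e : ∀ i, dz (d := d) (m := m) i (fun _ => (1 : ℝ)) = fun _ => 0 := fun i => by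
    ext y; simp [dz]
  simp [G, T, S, e]
  simp [dz]

lemma tendsto_integral_mul_χ (hf : Integrable f D.μ) :
    Tendsto (fun n : ℕ => ∫ x, f x * D.χ ((n : ℝ) + 1) x ∂D.μ) atTop (nhds (∫ x, f x ∂D.μ)) := by
  refine tendsto_integral_of_dominated_convergence (fun x => |f x|)
    (fun n => hf.aestronglyMeasurable.mul
      (isTest_χ (D := D) (by positivity : (0 : ℝ) < n + 1)).isSm.continuous.aestronglyMeasurable)
    hf.abs (fun n => Eventually.of_forall fun x => ?_) (Eventually.of_forall fun x => ?_)
  · rw [Real.norm_eq_abs, abs_mul]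
    refine mul_le_of_le_one_right (abs_nonneg _) (abs_le.2 ⟨?_, step_le_one _⟩)
    exact le_trans (by norm_num) (step_nonneg _)
  · refine tendsto_const_nhds.congr' ?_
    filter_upwards [eventually_χ_eq_one (σ := 0) D x] with n hn
    rw [hn.1, mul_one]

lemma tendsto_integral_G_χ (hφ : IsTest d m φ) (σ c : ℝ) :
    Tendsto (fun n : ℕ => ∫ x, (D.G σ φ x + c * D.G σ (D.χ ((n : ℝ) + 1)) x) ^ 2 ∂D.μ) atTop
      (nhds (∫ x, D.G σ φ x ^ 2 ∂D.μ)) := by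
  obtain ⟨C, hC0, hC⟩ := D.exists_bound_χ
  obtain ⟨M, hM⟩ := (hφ.G (D := D) σ).exists_bound
  have ht : ∀ n : ℕ, IsTest d m (D.χ ((n : ℝ) + 1)) := fun n => isTest_χ (by positivity)
  refine tendsto_integral_of_dominated_convergence (fun _ => (M + |c| * C) ^ 2)
    (fun n => (((hφ.G σ).add (((ht n).G σ).const_mul c)).sq).isSm.continuous.aestronglyMeasurable)
    (integrable_const _) (fun n => Eventually.of_forall fun x => ?_) (Eventually.of_forall fun x => ?_)
  · rw [norm_pow, Real.norm_eq_abs]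
    refine pow_le_pow_left₀ (abs_nonneg _) ((abs_add_le _ _).trans (add_le_add (hM x) ?_)) 2
    rw [abs_mul]
    refine mul_le_mul_of_nonneg_left ?_ (abs_nonneg _)
    rw [G, T_χ, mul_zero, zero_add]
    exact (hC _ (by linarith [(Nat.cast_nonneg n : (0 : ℝ) ≤ n)]) x).2
  · refine tendsto_const_nhds.congr' ?_
    filter_upwards [eventually_χ_eq_one (σ := σ) D x] with n hn
    rw [hn.2, mul_zero, add_zero]

lemma exists_functional_bound (hσ : σ ^ 2 = 1) (hf : IsSm d m f) (hf2 : Integrable (fun x => f x ^ 2) D.μ)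
    (hf0 : ∫ x, f x ∂D.μ = 0) : ∃ C, 0 ≤ C ∧ ∀ φ, IsTest d m φ →
      (∫ x, f x * φ x ∂D.μ) ^ 2 ≤ C * ∫ x, D.G σ φ x ^ 2 ∂D.μ := by
  obtain ⟨C, hC0, hC⟩ := exists_apriori_bound D hσ
  have hfm : MemLp f 2 D.μ := (memLp_two_iff_integrable_sq hf.continuous.aestronglyMeasurable).2 hf2
  have hfi : Integrable f D.μ := hfm.integrable one_le_two
  have hF0 : 0 ≤ ∫ x, f x ^ 2 ∂D.μ := integral_nonneg fun x => sq_nonneg _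
  refine ⟨(∫ x, f x ^ 2 ∂D.μ) * C, by positivity, fun φ hφ => ?_⟩
  set c := ∫ x, φ x ∂D.μ with hc
  have ht : ∀ n : ℕ, IsTest d m (D.χ ((n : ℝ) + 1)) := fun n => isTest_χ (by positivity)
  have hs : ∀ n : ℕ, IsTest d m fun x => 1 * φ x + -c * D.χ ((n : ℝ) + 1) x := fun n =>
    (hφ.const_mul 1).add ((ht n).const_mul (-c))
  have hb : ∀ n : ℕ, (∫ x, f x * φ x ∂D.μ - c * ∫ x, f x * D.χ ((n : ℝ) + 1) x ∂D.μ) ^ 2 ≤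
      (∫ x, f x ^ 2 ∂D.μ) * (C * (∫ x, (D.G σ φ x + -c * D.G σ (D.χ ((n : ℝ) + 1)) x) ^ 2 ∂D.μ
        + (c - c * ∫ x, D.χ ((n : ℝ) + 1) x ∂D.μ) ^ 2)) := fun n => by
    have h1 := integral_mul_sq_le hfm ((hs n).memLp D)
    have h2 := hC _ (hs n)
    simp only [fun x => G_linear (D := D) hφ.isSm (ht n).isSm σ 1 (-c) x] at h2
    simp only [one_mul] at h1 h2
    have i1 : Integrable (fun x => f x * φ x) D.μ := MemLp.integrable_mul hfm (hφ.memLp D)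
    have i2 : Integrable (fun x => f x * D.χ ((n : ℝ) + 1) x) D.μ := MemLp.integrable_mul hfm ((ht n).memLp D)
    have e1 : ∫ x, f x * (φ x + -c * D.χ ((n : ℝ) + 1) x) ∂D.μ
        = ∫ x, f x * φ x ∂D.μ - c * ∫ x, f x * D.χ ((n : ℝ) + 1) x ∂D.μ := by
      rw [← integral_const_mul, ← integral_sub i1 (i2.const_mul c)]
      congr 1; ext x; ring
    have e2 : ∫ x, (φ x + -c * D.χ ((n : ℝ) + 1) x) ∂D.μ = c - c * ∫ x, D.χ ((n : ℝ) + 1) x ∂D.μ := by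
      rw [integral_add (integrable hφ) (integrable ((ht n).const_mul (-c))), integral_const_mul, ← hc]
      ring
    rw [e1] at h1
    rw [e2] at h2
    exact h1.trans (mul_le_mul_of_nonneg_left h2 hF0)
  have l1 := tendsto_integral_mul_χ hfi
  have l2 := tendsto_integral_mul_χ (D := D) (integrable_const (1 : ℝ))
  simp only [one_mul, integral_const, probReal_univ, smul_eq_mul, mul_one] at l2
  have l3 := tendsto_integral_G_χ (D := D) hφ σ (-c)
  have L := ((tendsto_const_nhds (x := ∫ x, f x * φ x ∂D.μ)).sub (l1.const_mul c)).pow 2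
  have R := ((l3.add (((tendsto_const_nhds (x := c)).sub (l2.const_mul c)).pow 2)).const_mul C).const_mul
    (∫ x, f x ^ 2 ∂D.μ)
  have := le_of_tendsto_of_tendsto' L R hb
  rw [hf0] at this
  simpa [mul_assoc] using this

variable (d m) in
/-- The space of test functions. -/
def testSubmodule : Submodule ℝ (Xsp d m → ℝ) where
  carrier := {φ | IsTest d m φ}
  add_mem' h h' := IsTest.add h h'
  zero_mem' := IsTest.zero
  smul_mem' c _ h := IsTest.const_mul h c

lemma exists_weak (hf : IsSm d m f) (hf2 : Integrable (fun x => f x ^ 2) D.μ)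
    (hf0 : ∫ x, f x ∂D.μ = 0) : ∃ u, D.Weak 1 u f := by
  obtain ⟨C, hC0, hC⟩ := exists_functional_bound (D := D) (σ := -1) (by norm_num) hf hf2 hf0
  have hfm : MemLp f 2 D.μ := (memLp_two_iff_integrable_sq hf.continuous.aestronglyMeasurable).2 hf2
  have hi : ∀ {φ}, IsTest d m φ → Integrable (fun x => f x * φ x) D.μ := fun h =>
    MemLp.integrable_mul hfm (h.memLp D)
  let A : testSubmodule d m →ₗ[ℝ] Lp ℝ 2 D.μ :=
    { toFun := fun φ => ((IsTest.G (D := D) φ.2 (-1)).memLp D).toLp _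
      map_add' := fun φ ψ => by
        rw [← MemLp.toLp_add]
        congr 1; ext x
        have := G_linear (D := D) (IsTest.isSm φ.2) (IsTest.isSm ψ.2) (-1) 1 1 x
        simp only [one_mul] at this
        exact this
      map_smul' := fun c φ => by
        rw [RingHom.id_apply, ← MemLp.toLp_const_smul]
        congr 1; ext x
        exact G_const_mul (D := D) (IsTest.isSm φ.2) (-1) c x }
  let L : testSubmodule d m →ₗ[ℝ] ℝ :=
    { toFun := fun φ => ∫ x, f x * φ.1 x ∂D.μ
      map_add' := fun φ ψ => by
        rw [← integral_add (hi φ.2) (hi ψ.2)]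
        congr 1; ext x
        exact mul_add _ _ _
      map_smul' := fun c φ => by
        rw [RingHom.id_apply, smul_eq_mul, ← integral_const_mul]
        congr 1; ext x
        exact mul_left_comm _ _ _ }
  obtain ⟨w, hw⟩ := exists_inner_repr A L (C := √C) fun φ => by
    refine abs_le_of_sq_le_sq ?_ (by positivity)
    rw [mul_pow, Real.sq_sqrt hC0]
    have : ‖A φ‖ ^ 2 = _ := norm_toLp_sq ((IsTest.G (D := D) φ.2 (-1)).memLp D)
    rw [this]
    exact hC _ φ.2
  have hmw := Lp.memLp w
  have hms := Lp.aestronglyMeasurable w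
  set w' := hms.mk w with hw'
  have hae : (w : Xsp d m → ℝ) =ᵐ[D.μ] w' := hms.ae_eq_mk
  have hmw' : MemLp w' 2 D.μ := hmw.ae_eq hae
  have hww : w = hmw'.toLp w' := by
    rw [← Lp.toLp_coeFn w hmw]; exact (MemLp.toLp_eq_toLp_iff _ _).2 hae
  refine ⟨w', hms.stronglyMeasurable_mk.measurable, hmw'.integrable_sq, fun φ hφ => ?_⟩
  have h1 : ∫ x, f x * φ x ∂D.μ = inner ℝ w (A ⟨φ, hφ⟩) := hw ⟨φ, hφ⟩
  have h2 : A ⟨φ, hφ⟩ = ((hφ.G (D := D) (-1)).memLp D).toLp _ := rfl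
  rw [h1, h2, ← inner_toLp hmw', ← hww]

theorem existsUnique (D : Gle d m) (hf : IsSm d m f) (hf2 : Integrable (fun x => f x ^ 2) D.μ)
    (hf0 : ∫ x, f x ∂D.μ = 0) : ∃! u : Xsp d m → ℝ, ContDiff ℝ (⊤ : ℕ∞) u ∧ PerQ d m u ∧
      Integrable (fun x => u x ^ 2) D.μ ∧ ∫ x, u x ∂D.μ = 0 ∧ ∀ x, D.G 1 u x = f x := by
  have hfi : Integrable f D.μ := integrable_of_sq hf.continuous.aestronglyMeasurable hf2
  have sq_sub : ∀ {a b : Xsp d m → ℝ}, IsSm d m a → IsSm d m b → Integrable (fun x => a x ^ 2) D.μ →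
      Integrable (fun x => b x ^ 2) D.μ → Integrable (fun x => (a x - b x) ^ 2) D.μ :=
    fun ha hb ha2 hb2 =>
      (((memLp_two_iff_integrable_sq ha.continuous.aestronglyMeasurable).2 ha2).sub
        ((memLp_two_iff_integrable_sq hb.continuous.aestronglyMeasurable).2 hb2)).integrable_sq
  have G_sub : ∀ {a b : Xsp d m → ℝ}, IsSm d m a → IsSm d m b → ∀ x,
      D.G 1 (fun x => a x - b x) x = D.G 1 a x - D.G 1 b x := fun {a b} ha hb x => by
    have := G_linear (D := D) ha hb 1 1 (-1) x
    simpa only [one_mul, neg_mul, ← sub_eq_add_neg] using this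
  obtain ⟨w, hw⟩ := exists_weak hf hf2 hf0
  obtain ⟨v, hv, hwv, hG⟩ := hw.exists_isSm (by norm_num) hf hfi
  have hv2 : Integrable (fun x => v x ^ 2) D.μ := hw.sq.congr (hwv.mono fun x hx => by simp only [hx])
  have hvi := integrable_of_sq hv.continuous.aestronglyMeasurable hv2
  set c := ∫ x, v x ∂D.μ
  have hu := hv.sub (.const c)
  refine ⟨fun x => v x - c, ⟨hu.1, hu.2, sq_sub hv (.const c) hv2 (integrable_const _), ?_, fun x => ?_⟩, ?_⟩
  · rw [integral_sub hvi (integrable_const _)]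
    simp [c]
  · have e2 : ∀ i, dz (d := d) (m := m) i (fun _ => c) = fun _ => 0 := fun i => by
      ext y; simp [dz]
    rw [G_sub hv (.const c), hG]
    simp [G, T, S, e2]
    simp [dz]
  · rintro u' ⟨h1, h2, h3, h4, h5⟩
    have hu' : IsSm d m u' := ⟨h1, h2⟩
    have hi' := integrable_of_sq hu'.continuous.aestronglyMeasurable h3
    have hz := const_of_G_eq_zero (D := D) (hu'.sub hv) (sq_sub hu' hv h3 hv2) one_ne_zero fun x => by
      rw [G_sub hu' hv, h5, hG, sub_self]
    have hI : ∫ x, (u' x - v x) ∂D.μ = -c := by rw [integral_sub hi' hvi, h4, zero_sub]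
    ext x
    simp only [hz, integral_const, probReal_univ, one_smul] at hI
    have := hz x
    linarith

end Gle

end Existence

/-- (Well-posedness of the Poisson equation.) Assume `V ∈ C^∞(𝕋^d)`.
For every `f ∈ C^∞(X) ∩ L²(μ_β)` with `∫ f dμ_β = 0` there is exactly one
`u ∈ C^∞(X) ∩ L²(μ_β)` with `∫ u dμ_β = 0` and `𝓛u = f` pointwise. -/
theorem poisson_wellposed
    (d m : ℕ) (hd : 1 ≤ d) (hm : 1 ≤ m)
    (β : ℝ) (hβ : 0 < β)
    (α lam : Fin m → ℝ) (hα : ∀ j, 0 < α j) (hlam : ∀ j, 0 < lam j)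
    (V : (Fin d → ℝ) → ℝ) (hV : ContDiff ℝ (⊤ : ℕ∞) V) (hVper : PerV d V)
    (Z : ℝ) (hZ : 0 < Z)
    (hprob : IsProbabilityMeasure (gibbs d m β Z V))
    (f : Xsp d m → ℝ) (hf : ContDiff ℝ (⊤ : ℕ∞) f) (hfper : PerQ d m f)
    (hfL2 : Integrable (fun x => (f x) ^ 2) (gibbs d m β Z V))
    (hfmean : (∫ x, f x ∂(gibbs d m β Z V)) = 0) :
    ∃! u : Xsp d m → ℝ,
      ContDiff ℝ (⊤ : ℕ∞) u ∧ PerQ d m u ∧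
      Integrable (fun x => (u x) ^ 2) (gibbs d m β Z V) ∧
      (∫ x, u x ∂(gibbs d m β Z V)) = 0 ∧
      ∀ x, gen d m β α lam V u x = f x := by
  let D : Gle d m :=
    { β := β, α := α, lam := lam, V := V, Z := Z, j0 := ⟨0, hm⟩, hβ := hβ, hα := hα, hlam := hlam,
      hV := hV, hVper := hVper, hZ := hZ, prob := hprob }
  have h := D.existsUnique ⟨hf, hfper⟩ hfL2 hfmean
  simp only [← D.gen_eq] at h
  exact h
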